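/- Let Ω ⊆ ℝⁿ be a C² domain, let a : [0,∞) → ℝ be C¹ with locally Lipschitz derivative, a(t) > 0 and (t·a(t))′ > 0 for all t ≥ 0, let f ∈ C¹(ℝ), and let u ∈ C³(Ω) ∩ C²(cl Ω) be a stable weak solution of Δ_a u + f(u) = 0 in Ω such that both u and ⟨∇u, η⟩ are locally constant on ∂Ω. Let e ∈ ℝⁿ and set w := ⟨∇u, e⟩; assume w ≥ 0 in Ω and w does not vanish identically in Ω. Then w > 0 everywhere in Ω (in particular ∇u ≠ 0 in Ω), and for every Lipschitz φ : ℝⁿ → ℝ with compact support (not necessarily supported in Ω): ∫_Ω |∇u|²⟨A(∇u)∇φ, ∇φ⟩ dx ≥ ∫_Ω φ²·{ λ₁·|∇ᵀ|∇u||² + λ₂·( ‖Hess u‖² − |∇|∇u||² − |∇ᵀ|∇u||² ) } dx + ∫_Ω w²·⟨A(∇u)∇(φ|∇u|/w), ∇(φ|∇u|/w)⟩ dx, where ν := ∇u/|∇u|, ∇ᵀξ := ξ − ⟨ξ, ν⟩ν, λ_i := λ_i(|∇u|), and ∇(φ|∇u|/w) is the almost-everywhere gradient of the locally Lipschitz function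 φ|∇u|/w. -/

import Mathlib

open MeasureTheory Set Metric Filter
open scoped RealInnerProductSpace Topology ENNReal

noncomputable section

variable {n : ℕ}

/-- The quasilinear operator matrix `A(p)` applied to a vector `v`:
`A(p)v = a(|p|) v + (a'(|p|)/|p|) ⟨p,v⟩ p` (with the second term vanishing at `p = 0`). -/
def Aop (a : ℝ → ℝ) (p v : EuclideanSpace ℝ (Fin n)) : EuclideanSpace ℝ (Fin n) :=
  a ‖p‖ • v + ((deriv a ‖p‖ / ‖p‖) * ⟪p, v⟫) • p

/-- `λ₁(t) = a(t) + t·a'(t) = (t a(t))'`. -/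
def lam1 (a : ℝ → ℝ) (t : ℝ) : ℝ := a t + t * deriv a t

/-- `λ₂(t) = a(t)`. -/
def lam2 (a : ℝ → ℝ) (t : ℝ) : ℝ := a t

/-- `λmax(t) = max{λ₁(t), λ₂(t)}`. -/
def lamMax (a : ℝ → ℝ) (t : ℝ) : ℝ := max (lam1 a t) (lam2 a t)

/-- A Lipschitz test function with compact support contained in `Ω`. -/
def IsTestOn (Ω : Set (EuclideanSpace ℝ (Fin n))) (φ : EuclideanSpace ℝ (Fin n) → ℝ) : Prop :=
  (∃ K, LipschitzWith K φ) ∧ HasCompactSupport φ ∧ tsupport φ ⊆ Ω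

/-- `u` is a weak solution of `div(a(|∇u|)∇u) + f(u) = 0` in `Ω`. -/
def IsWeakSolution (a f : ℝ → ℝ) (Ω : Set (EuclideanSpace ℝ (Fin n)))
    (u : EuclideanSpace ℝ (Fin n) → ℝ) : Prop :=
  ∀ φ : EuclideanSpace ℝ (Fin n) → ℝ, IsTestOn Ω φ →
    ∫ x in Ω, a ‖gradient u x‖ * ⟪gradient u x, gradient φ x⟫
      = ∫ x in Ω, f (u x) * φ x

/-- The stability inequality for a solution `u`. -/
def IsStable (a f : ℝ → ℝ) (Ω : Set (EuclideanSpace ℝ (Fin n)))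
    (u : EuclideanSpace ℝ (Fin n) → ℝ) : Prop :=
  ∀ φ : EuclideanSpace ℝ (Fin n) → ℝ, IsTestOn Ω φ →
    ∫ x in Ω, deriv f (u x) * φ x ^ 2
      ≤ ∫ x in Ω, ⟪Aop a (gradient u x) (gradient φ x), gradient φ x⟫

/-- `u` has moderate energy growth in `Ω₀`. -/
def ModerateEnergyGrowth (a : ℝ → ℝ) (u : EuclideanSpace ℝ (Fin n) → ℝ)
    (Ω₀ : Set (EuclideanSpace ℝ (Fin n))) : Prop :=
  ∃ φ : ℕ → EuclideanSpace ℝ (Fin n) → ℝ,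
    (∀ j, ∃ K, LipschitzWith K (φ j)) ∧
    (∀ j, HasCompactSupport (φ j)) ∧
    (∀ j x, 0 ≤ φ j x) ∧
    (∀ K : Set (EuclideanSpace ℝ (Fin n)), IsCompact K → K ⊆ closure Ω₀ →
      TendstoUniformlyOn (fun j => φ j) (fun _ => (1 : ℝ)) atTop K) ∧
    Tendsto (fun j => ∫ x in Ω₀, ‖gradient u x‖ ^ 2 *
        ⟪Aop a (gradient u x) (gradient (φ j) x), gradient (φ j) x⟫)
      atTop (nhds 0)

/-- A `C^k` domain: nonempty, open, connected, with boundary locally given by a regular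
`C^k` defining function. -/
def IsCkDomain (k : ℕ∞) (Ω : Set (EuclideanSpace ℝ (Fin n))) : Prop :=
  Ω.Nonempty ∧ IsOpen Ω ∧ IsConnected Ω ∧
    ∀ p ∈ frontier Ω, ∃ V : Set (EuclideanSpace ℝ (Fin n)),
      ∃ g : EuclideanSpace ℝ (Fin n) → ℝ,
        IsOpen V ∧ p ∈ V ∧ ContDiffOn ℝ k g V ∧ (∀ x ∈ V, gradient g x ≠ 0) ∧
        Ω ∩ V = {x ∈ V | g x < 0}

/-- A `C^k` domain together with its interior unit normal field `η`. -/
def IsCkDomainWithNormal (k : ℕ∞) (Ω : Set (EuclideanSpace ℝ (Fin n)))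
    (η : EuclideanSpace ℝ (Fin n) → EuclideanSpace ℝ (Fin n)) : Prop :=
  Ω.Nonempty ∧ IsOpen Ω ∧ IsConnected Ω ∧
    ∀ p ∈ frontier Ω, ∃ V : Set (EuclideanSpace ℝ (Fin n)),
      ∃ g : EuclideanSpace ℝ (Fin n) → ℝ,
        IsOpen V ∧ p ∈ V ∧ ContDiffOn ℝ k g V ∧ (∀ x ∈ V, gradient g x ≠ 0) ∧
        Ω ∩ V = {x ∈ V | g x < 0} ∧
        η p = -(‖gradient g p‖⁻¹ • gradient g p)

/-- `a ∈ C^{1,1}_loc([0,∞))`: `C¹` on `[0,∞)` with locally Lipschitz derivative. -/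
def C11Loc (a : ℝ → ℝ) : Prop :=
  ContDiffOn ℝ 1 a (Ici 0) ∧
    ∀ t ∈ Ici (0 : ℝ), ∃ V ∈ 𝓝[Ici (0 : ℝ)] t, ∃ K, LipschitzOnWith K (deriv a) V

/-- The tangential part `∇ᵀ|∇u|` of the gradient of `|∇u|` (orthogonal to `ν = ∇u/|∇u|`). -/
def tangGrad (u : EuclideanSpace ℝ (Fin n) → ℝ) (x : EuclideanSpace ℝ (Fin n)) :
    EuclideanSpace ℝ (Fin n) :=
  gradient (fun y => ‖gradient u y‖) x -
    ⟪gradient (fun y => ‖gradient u y‖) x, ‖gradient u x‖⁻¹ • gradient u x⟫ •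
      (‖gradient u x‖⁻¹ • gradient u x)

/-- The squared Frobenius norm `‖Hess u‖²` of the Hessian of `u`. -/
def hessFrob2 (u : EuclideanSpace ℝ (Fin n) → ℝ) (x : EuclideanSpace ℝ (Fin n)) : ℝ :=
  ∑ i : Fin n, ‖(fderiv ℝ (gradient u) x) (EuclideanSpace.single i (1 : ℝ))‖ ^ 2

local notation "𝔼" => EuclideanSpace ℝ (Fin n)

def BL (a : ℝ → ℝ) (p : 𝔼) : 𝔼 →L[ℝ] 𝔼 :=
  (deriv a ‖p‖ / ‖p‖) • (innerSL ℝ p).smulRight p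

def AL (a : ℝ → ℝ) (p : 𝔼) : 𝔼 →L[ℝ] 𝔼 :=
  a ‖p‖ • ContinuousLinearMap.id ℝ 𝔼 + BL a p

lemma BL_apply (a : ℝ → ℝ) (p v : 𝔼) : BL a p v = ((deriv a ‖p‖ / ‖p‖) * ⟪p, v⟫) • p := by
  simp [BL, smul_smul]

lemma AL_apply (a : ℝ → ℝ) (p v : 𝔼) : AL a p v = Aop a p v := by
  simp [AL, BL_apply, Aop]

lemma inner_Aop (a : ℝ → ℝ) (p v w : 𝔼) :
    ⟪Aop a p v, w⟫ = a ‖p‖ * ⟪v, w⟫ + (deriv a ‖p‖ / ‖p‖) * (⟪p, v⟫ * ⟪p, w⟫) := by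
  simp [Aop, inner_add_left, inner_smul_left]; ring

lemma inner_Aop_symm (a : ℝ → ℝ) (p v w : 𝔼) : ⟪Aop a p v, w⟫ = ⟪v, Aop a p w⟫ := by
  rw [real_inner_comm (Aop a p w) v, inner_Aop, inner_Aop, real_inner_comm v w]; ring

lemma Aop_add (a : ℝ → ℝ) (p v w : 𝔼) : Aop a p (v + w) = Aop a p v + Aop a p w := by
  simp only [← AL_apply, map_add]

lemma Aop_smul (a : ℝ → ℝ) (p v : 𝔼) (c : ℝ) : Aop a p (c • v) = c • Aop a p v := by
  simp only [← AL_apply, map_smul]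

lemma Aop_self (a : ℝ → ℝ) (p : 𝔼) : Aop a p p = lam1 a ‖p‖ • p := by
  by_cases hp : ‖p‖ = 0
  · have : p = 0 := norm_eq_zero.1 hp
    subst this; simp [Aop]
  · simp only [Aop, real_inner_self_eq_norm_sq, lam1, ← add_smul]
    congr 2; field_simp

lemma inner_Aop_lower (a : ℝ → ℝ) (p v : 𝔼) :
    min (a ‖p‖) (lam1 a ‖p‖) * ‖v‖ ^ 2 ≤ ⟪Aop a p v, v⟫ := by
  rw [inner_Aop, real_inner_self_eq_norm_sq]
  set m := min (a ‖p‖) (lam1 a ‖p‖)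
  have h1 : m ≤ a ‖p‖ := min_le_left _ _
  have h2 : m ≤ lam1 a ‖p‖ := min_le_right _ _
  by_cases hp : ‖p‖ = 0
  · have : p = 0 := norm_eq_zero.1 hp
    simp only [hp, div_zero, zero_mul, add_zero] at *
    gcongr
  · have hp' : 0 < ‖p‖ := lt_of_le_of_ne (norm_nonneg _) (Ne.symm hp)
    have hcs : ⟪p, v⟫ ^ 2 ≤ ‖p‖ ^ 2 * ‖v‖ ^ 2 := by
      rw [← mul_pow]; exact sq_le_sq' (by linarith [neg_le_of_abs_le (abs_real_inner_le_norm p v)]) (real_inner_le_norm p v)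
    set k := ⟪p, v⟫ ^ 2 / ‖p‖ ^ 2 with hk
    have hk1 : k ≤ ‖v‖ ^ 2 := by rw [hk, div_le_iff₀ (by positivity)]; linarith
    have hk0 : 0 ≤ k := by positivity
    have he : deriv a ‖p‖ / ‖p‖ * (⟪p, v⟫ * ⟪p, v⟫) = (lam1 a ‖p‖ - a ‖p‖) * k := by
      rw [hk, lam1]; field_simp; ring
    rw [he]
    nlinarith [mul_nonneg (sub_nonneg.2 h1) (sub_nonneg.2 hk1), mul_nonneg (sub_nonneg.2 h2) hk0]

lemma inner_Aop_nonneg {a : ℝ → ℝ} (hapos : ∀ t ≥ (0 : ℝ), 0 < a t)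
    (hlam : ∀ t ≥ (0 : ℝ), 0 < lam1 a t) (p v : 𝔼) : 0 ≤ ⟪Aop a p v, v⟫ :=
  le_trans (mul_nonneg (le_min (hapos _ (norm_nonneg _)).le (hlam _ (norm_nonneg _)).le)
    (sq_nonneg _)) (inner_Aop_lower a p v)

lemma unit_diff (p q : 𝔼) : ‖q‖ * ‖(‖p‖⁻¹ • p - ‖q‖⁻¹ • q)‖ ≤ 2 * ‖p - q‖ := by
  by_cases hp : ‖p‖ = 0
  · have : p = 0 := norm_eq_zero.1 hp
    subst this
    by_cases hq : ‖q‖ = 0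
    · simp [hq]
    · simp [norm_smul, hq]
      linarith [norm_nonneg q]
  by_cases hq : ‖q‖ = 0
  · simp [hq]
  have : ‖q‖ • (‖p‖⁻¹ • p - ‖q‖⁻¹ • q) = (p - q) + ((‖q‖ - ‖p‖) * ‖p‖⁻¹) • p := by
    rw [smul_sub, smul_smul, smul_smul, mul_inv_cancel₀ hq, sub_mul, sub_smul, mul_inv_cancel₀ hp]
    simp only [one_smul]; abel
  calc ‖q‖ * ‖(‖p‖⁻¹ • p - ‖q‖⁻¹ • q)‖ = ‖‖q‖ • (‖p‖⁻¹ • p - ‖q‖⁻¹ • q)‖ := by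
        rw [norm_smul, norm_norm]
    _ ≤ ‖p - q‖ + ‖((‖q‖ - ‖p‖) * ‖p‖⁻¹) • p‖ := by rw [this]; exact norm_add_le _ _
    _ = ‖p - q‖ + |‖q‖ - ‖p‖| := by
        rw [norm_smul, norm_mul, norm_inv, norm_norm, mul_assoc, inv_mul_cancel₀ hp, mul_one,
          Real.norm_eq_abs]
    _ ≤ 2 * ‖p - q‖ := by
        have := abs_norm_sub_norm_le q p
        rw [norm_sub_rev] at this
        linarith

lemma C11Loc.continuousOn_deriv {a : ℝ → ℝ} (ha : C11Loc a) : ContinuousOn (deriv a) (Ici 0) := by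
  intro t ht
  obtain ⟨V, hV, K, hK⟩ := ha.2 t ht
  have h1 : ContinuousWithinAt (deriv a) V t := hK.continuousOn t (mem_of_mem_nhdsWithin ht hV)
  exact h1.mono_of_mem_nhdsWithin hV

lemma C11Loc.lip_deriv {a : ℝ → ℝ} (ha : C11Loc a) (S : ℝ) :
    ∃ L : ℝ, 0 ≤ L ∧ (∀ s ∈ Icc 0 S, ∀ t ∈ Icc 0 S, |deriv a s - deriv a t| ≤ L * |s - t|) ∧
      (∀ s ∈ Icc 0 S, |deriv a s| ≤ L) ∧
      (∀ s ∈ Icc 0 S, ∀ t ∈ Icc 0 S, |a s - a t| ≤ L * |s - t|) := by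
  have h1 : LocallyLipschitzOn (Icc 0 S) (deriv a) := by
    intro t ht
    obtain ⟨V, hV, K, hK⟩ := ha.2 t ht.1
    exact ⟨K, V, nhdsWithin_mono t Icc_subset_Ici_self hV, hK⟩
  obtain ⟨K, hK⟩ := h1.exists_lipschitzOnWith_of_compact isCompact_Icc
  obtain ⟨B, hB⟩ := isCompact_Icc.exists_bound_of_continuousOn
    (ha.continuousOn_deriv.mono (fun x (hx : x ∈ Icc 0 S) => hx.1))
  refine ⟨max K |B|, le_max_of_le_right (abs_nonneg _), ?_, ?_, ?_⟩
  · intro s hs t ht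
    have := hK.dist_le_mul s hs t ht
    rw [Real.dist_eq, Real.dist_eq] at this
    exact this.trans (by gcongr; exact le_max_left _ _)
  · intro s hs
    exact (hB s hs).trans ((le_abs_self _).trans (le_max_right _ _))
  · have key : ∀ s ∈ Icc 0 S, ∀ t ∈ Icc 0 S, s < t → |a s - a t| ≤ max (K : ℝ) |B| * |s - t| := by
      intro s hs t ht hst
      have hd : ∀ x ∈ Ioo s t, HasDerivAt a (deriv a x) x := by
        intro x hx
        have hx0 : 0 < x := lt_of_le_of_lt hs.1 hx.1
        exact (((ha.1.differentiableOn (by norm_num)) x hx0.le).differentiableAt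
          (Ici_mem_nhds hx0)).hasDerivAt
      obtain ⟨c, hc, hc'⟩ := exists_hasDerivAt_eq_slope a (deriv a) hst
        (ha.1.continuousOn.mono (fun x hx => hs.1.trans hx.1)) hd
      have hcB := (hB c ⟨hs.1.trans hc.1.le, hc.2.le.trans ht.2⟩).trans
        ((le_abs_self _).trans (le_max_right (K : ℝ) _))
      have hts : t - s ≠ 0 := by linarith
      have : a t - a s = deriv a c * (t - s) := by rw [hc']; field_simp
      rw [abs_sub_comm, this, abs_mul, abs_sub_comm s t]
      exact mul_le_mul_of_nonneg_right hcB (abs_nonneg _)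
    intro s hs t ht
    rcases lt_trichotomy s t with h | h | h
    · exact key s hs t ht h
    · simp [h]
    · rw [abs_sub_comm, abs_sub_comm s t]; exact key t ht s hs h

lemma BL_lip {a : ℝ → ℝ} (ha : C11Loc a) (S : ℝ) :
    ∃ L : ℝ, 0 ≤ L ∧ (∀ p q : 𝔼, ‖p‖ ≤ S → ‖q‖ ≤ S → ‖BL a p - BL a q‖ ≤ L * ‖p - q‖) ∧
      (∀ p q : 𝔼, ‖p‖ ≤ S → ‖q‖ ≤ S → |a ‖p‖ - a ‖q‖| ≤ L * ‖p - q‖) := by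
  obtain ⟨L, hL0, h1, h2, h3⟩ := ha.lip_deriv S
  refine ⟨L * |S| + 3 * L + L, by positivity, ?_, ?_⟩
  · intro p q hp hq
    refine ContinuousLinearMap.opNorm_le_bound _ (by positivity) (fun v => ?_)
    have form : ∀ r : 𝔼, BL a r v = (deriv a ‖r‖ * ⟪‖r‖⁻¹ • r, v⟫) • r := by
      intro r; rw [BL_apply, inner_smul_left]; simp [div_eq_mul_inv, mul_assoc]
    have unit : ∀ r : 𝔼, ‖‖r‖⁻¹ • r‖ ≤ 1 := by
      intro r
      rw [norm_smul, norm_inv, norm_norm]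
      exact inv_mul_le_one
    have hpI : ‖p‖ ∈ Icc 0 S := ⟨norm_nonneg _, hp⟩
    have hqI : ‖q‖ ∈ Icc 0 S := ⟨norm_nonneg _, hq⟩
    have hin : ∀ r : 𝔼, |⟪‖r‖⁻¹ • r, v⟫| ≤ ‖v‖ := fun r =>
      (abs_real_inner_le_norm _ _).trans (by nlinarith [unit r, norm_nonneg v])
    have dec : (BL a p - BL a q) v = ((deriv a ‖p‖ - deriv a ‖q‖) * ⟪‖p‖⁻¹ • p, v⟫) • p
        + (deriv a ‖q‖ * ⟪‖p‖⁻¹ • p, v⟫) • (p - q)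
        + (deriv a ‖q‖ * ⟪‖p‖⁻¹ • p - ‖q‖⁻¹ • q, v⟫) • q := by
      rw [sub_apply, form, form, inner_sub_left]
      simp only [sub_mul, mul_sub, sub_smul, smul_sub]; abel
    rw [dec]
    have hS : |S| = S := abs_of_nonneg ((norm_nonneg p).trans hp)
    have e1 : ‖((deriv a ‖p‖ - deriv a ‖q‖) * ⟪‖p‖⁻¹ • p, v⟫) • p‖ ≤ L * |S| * ‖p - q‖ * ‖v‖ := by
      rw [norm_smul, norm_mul, Real.norm_eq_abs, Real.norm_eq_abs]
      calc |deriv a ‖p‖ - deriv a ‖q‖| * |⟪‖p‖⁻¹ • p, v⟫| * ‖p‖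
          ≤ (L * ‖p - q‖) * ‖v‖ * |S| := by
            gcongr
            · exact (h1 _ hpI _ hqI).trans (by gcongr; exact abs_norm_sub_norm_le p q)
            · exact hin p
            · rw [hS]; exact hp
        _ = _ := by ring
    have e2 : ‖(deriv a ‖q‖ * ⟪‖p‖⁻¹ • p, v⟫) • (p - q)‖ ≤ L * ‖p - q‖ * ‖v‖ := by
      rw [norm_smul, norm_mul, Real.norm_eq_abs, Real.norm_eq_abs]
      calc |deriv a ‖q‖| * |⟪‖p‖⁻¹ • p, v⟫| * ‖p - q‖
          ≤ L * ‖v‖ * ‖p - q‖ := by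
            gcongr
            · exact (h2 _ hqI)
            · exact hin p
        _ = _ := by ring
    have e3 : ‖(deriv a ‖q‖ * ⟪‖p‖⁻¹ • p - ‖q‖⁻¹ • q, v⟫) • q‖ ≤ 2 * L * ‖p - q‖ * ‖v‖ := by
      rw [norm_smul, norm_mul, Real.norm_eq_abs, Real.norm_eq_abs]
      calc |deriv a ‖q‖| * |⟪‖p‖⁻¹ • p - ‖q‖⁻¹ • q, v⟫| * ‖q‖
          ≤ L * (‖(‖p‖⁻¹ • p - ‖q‖⁻¹ • q)‖ * ‖v‖) * ‖q‖ := by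
            gcongr
            · exact (h2 _ hqI)
            · exact abs_real_inner_le_norm _ _
        _ = L * ‖v‖ * (‖q‖ * ‖(‖p‖⁻¹ • p - ‖q‖⁻¹ • q)‖) := by ring
        _ ≤ L * ‖v‖ * (2 * ‖p - q‖) := mul_le_mul_of_nonneg_left (unit_diff p q) (by positivity)
        _ = _ := by ring
    calc _ ≤ _ := norm_add₃_le
      _ ≤ L * |S| * ‖p - q‖ * ‖v‖ + L * ‖p - q‖ * ‖v‖ + 2 * L * ‖p - q‖ * ‖v‖ := by gcongr
      _ ≤ _ := by nlinarith [mul_nonneg (mul_nonneg hL0 (norm_nonneg (p - q))) (norm_nonneg v)]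
  · intro p q hp hq
    calc _ ≤ _ := h3 _ ⟨norm_nonneg _, hp⟩ _ ⟨norm_nonneg _, hq⟩
      _ ≤ L * ‖p - q‖ := by gcongr; exact abs_norm_sub_norm_le p q
      _ ≤ _ := by
        gcongr; nlinarith [mul_nonneg hL0 (abs_nonneg S)]

lemma continuous_BL {a : ℝ → ℝ} (ha : C11Loc a) : Continuous (fun p : 𝔼 => BL a p) := by
  rw [continuous_iff_continuousAt]
  intro p
  obtain ⟨L, hL0, h1, -⟩ := BL_lip (n := n) ha (‖p‖ + 1)
  have : LipschitzOnWith L.toNNReal (fun p : 𝔼 => BL a p) (closedBall 0 (‖p‖ + 1)) := by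
    refine LipschitzOnWith.of_dist_le_mul (fun x hx y hy => ?_)
    rw [dist_eq_norm, dist_eq_norm, Real.coe_toNNReal _ hL0]
    exact h1 x y (by simpa using hx) (by simpa using hy)
  refine this.continuousOn.continuousAt (mem_of_superset (closedBall_mem_nhds p one_pos) ?_)
  intro x hx
  rw [mem_closedBall, dist_eq_norm] at *
  have := norm_add_le (x - p) p
  simp only [sub_add_cancel, sub_zero] at *; linarith

lemma continuous_a_norm {a : ℝ → ℝ} (ha : C11Loc a) : Continuous (fun p : 𝔼 => a ‖p‖) :=
  ha.1.continuousOn.comp_continuous continuous_norm (fun p => norm_nonneg p)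

lemma continuous_AL {a : ℝ → ℝ} (ha : C11Loc a) : Continuous (fun p : 𝔼 => AL a p) := by
  unfold AL
  exact ((continuous_a_norm ha).smul continuous_const).add (continuous_BL ha)

lemma hasFDerivAt_norm_of_ne {p : 𝔼} (hp : p ≠ 0) :
    HasFDerivAt (fun q : 𝔼 => ‖q‖) (‖p‖⁻¹ • innerSL ℝ p) p := by
  have hp' : 0 < ‖p‖ := norm_pos_iff.2 hp
  have h1 := (hasStrictFDerivAt_norm_sq p).hasFDerivAt.sqrt (by positivity)
  have h2 : (fun q : 𝔼 => Real.sqrt (‖q‖ ^ 2)) = fun q => ‖q‖ := by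
    ext q; exact Real.sqrt_sq (norm_nonneg q)
  rw [h2, Real.sqrt_sq hp'.le] at h1
  refine h1.congr_fderiv ?_
  ext v; simp; field_simp


lemma hasFDerivAt_X {a : ℝ → ℝ} (ha : C11Loc a) (p : 𝔼) :
    HasFDerivAt (fun q : 𝔼 => a ‖q‖ • q) (AL a p) p := by
  by_cases hp : p = 0
  · subst hp
    have hAL : AL a (0 : 𝔼) = a 0 • ContinuousLinearMap.id ℝ 𝔼 := by
      ext v; simp [AL_apply, Aop]
    rw [hAL, hasFDerivAt_iff_isLittleO_nhds_zero]
    have h1 : Tendsto (fun q : 𝔼 => a ‖q‖ - a 0) (𝓝 0) (𝓝 0) := by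
      have := ((continuous_a_norm (n := n) ha).tendsto 0).sub_const (a 0)
      simpa using this
    have h2 : (fun q : 𝔼 => (a ‖q‖ - a 0) • q) =o[𝓝 0] (fun q : 𝔼 => q) := by
      have := ((Asymptotics.isLittleO_one_iff ℝ).2 h1).smul_isBigO
        (Asymptotics.isBigO_refl (fun q : 𝔼 => q) (𝓝 0))
      simpa using this
    refine h2.congr_left (fun q => ?_)
    simp [sub_smul]
  · have hp' : 0 < ‖p‖ := norm_pos_iff.2 hp
    have hd : HasDerivAt a (deriv a ‖p‖) ‖p‖ :=
      (((ha.1.differentiableOn (by norm_num)) ‖p‖ hp'.le).differentiableAt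
          (Ici_mem_nhds hp')).hasDerivAt
    have hnorm := hasFDerivAt_norm_of_ne hp
    have hc := (hd.comp_hasFDerivAt p hnorm).smul (hasFDerivAt_id p)
    refine HasFDerivAt.congr_fderiv hc ?_
    ext v
    simp [AL, BL_apply]
    left; field_simp

lemma contDiff_X {a : ℝ → ℝ} (ha : C11Loc a) : ContDiff ℝ 1 (fun q : 𝔼 => a ‖q‖ • q) :=
  contDiff_one_iff_hasFDerivAt.2 ⟨_, continuous_AL ha, hasFDerivAt_X ha⟩

set_option linter.unusedSectionVars false
section Tools
variable {E : Type*} [NormedAddCommGroup E] [InnerProductSpace ℝ E] [FiniteDimensional ℝ E]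

open scoped Manifold ContDiff in
lemma exists_cutoff {K U : Set E} (hK : IsCompact K) (hU : IsOpen U) (hKU : K ⊆ U) :
    ∃ ρ : E → ℝ, ContDiff ℝ ∞ ρ ∧ HasCompactSupport ρ ∧ tsupport ρ ⊆ U ∧
      (∀ᶠ x in 𝓝ˢ K, ρ x = 1) ∧ ∀ x, ρ x ∈ Icc (0 : ℝ) 1 := by
  obtain ⟨L, hL, hKL, hLU⟩ := exists_compact_between hK hU hKU
  obtain ⟨f, h1, h0, hf⟩ := exists_contMDiffMap_one_nhds_of_subset_interior (n := (⊤ : ℕ∞))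
    𝓘(ℝ, E) hK.isClosed hKL
  have hs : tsupport f ⊆ L := closure_minimal (fun x hx => by
    by_contra h; exact hx (h0 x h)) hL.isClosed
  exact ⟨f, f.contMDiff.contDiff, hL.of_isClosed_subset (isClosed_tsupport _) hs, hs.trans hLU, h1, hf⟩

end Tools

section Tools2
variable {E : Type*} [NormedAddCommGroup E] [InnerProductSpace ℝ E] [FiniteDimensional ℝ E]
variable {F : Type*} [NormedAddCommGroup F] [NormedSpace ℝ F]

lemma exists_C1_ext {K U : Set E} (hK : IsCompact K) (hU : IsOpen U) (hKU : K ⊆ U) {h : E → F}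
    (hh : ContDiffOn ℝ 1 h U) :
    ∃ k : E → F, ContDiff ℝ 1 k ∧ HasCompactSupport k ∧ tsupport k ⊆ U ∧
      ∀ᶠ x in 𝓝ˢ K, k x = h x := by
  obtain ⟨ρ, h1, h2, h3, h4, h5⟩ := exists_cutoff hK hU hKU
  have hs : tsupport (fun x => ρ x • h x) ⊆ tsupport ρ := closure_mono (fun x hx => by
    intro h; apply hx; simp [h])
  refine ⟨fun x => ρ x • h x, ?_, h2.of_isClosed_subset (isClosed_tsupport _) hs, hs.trans h3, ?_⟩
  · rw [contDiff_iff_contDiffAt]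
    intro x
    by_cases hx : x ∈ U
    · exact (h1.of_le (by exact_mod_cast le_top)).contDiffAt.smul (hh.contDiffAt (hU.mem_nhds hx))
    · have hx' : x ∉ tsupport (fun x => ρ x • h x) := fun hx' => hx (h3 (hs hx'))
      have : (fun x => ρ x • h x) =ᶠ[𝓝 x] fun _ => 0 := notMem_tsupport_iff_eventuallyEq.1 hx'
      exact contDiffAt_const.congr_of_eventuallyEq this
  · filter_upwards [h4] with x hx
    simp [hx]

lemma lip_mul_of_bdd {f g : E → ℝ} {K L : NNReal} {M N : ℝ} (hf : LipschitzWith K f)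
    (hg : LipschitzWith L g) (hM : ∀ x, |f x| ≤ M) (hN : ∀ x, |g x| ≤ N) :
    ∃ C, LipschitzWith C (fun x => f x * g x) := by
  have hM0 : 0 ≤ M := (abs_nonneg _).trans (hM 0)
  have hN0 : 0 ≤ N := (abs_nonneg _).trans (hN 0)
  refine ⟨(K * N + M * L).toNNReal, LipschitzWith.of_dist_le_mul (fun x y => ?_)⟩
  rw [Real.coe_toNNReal _ (by positivity), Real.dist_eq]
  have h1 := hf.dist_le_mul x y
  have h2 := hg.dist_le_mul x y
  rw [Real.dist_eq] at h1 h2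
  calc |f x * g x - f y * g y| = |(f x - f y) * g x + f y * (g x - g y)| := by congr 1; ring
    _ ≤ |f x - f y| * |g x| + |f y| * |g x - g y| := by
      rw [← abs_mul, ← abs_mul]; exact abs_add_le _ _
    _ ≤ (K * dist x y) * N + M * (L * dist x y) := by
      gcongr
      · exact hN x
      · exact hM y
    _ = _ := by ring

lemma bdd_of_lip {f : E → F} {K : NNReal} (hf : LipschitzWith K f) (hc : HasCompactSupport f) :
    ∃ M, ∀ x, ‖f x‖ ≤ M := hc.exists_bound_of_continuous hf.continuous

lemma lip_sq {f : E → ℝ} {K : NNReal} (hf : LipschitzWith K f) (hc : HasCompactSupport f) :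
    ∃ C, LipschitzWith C (fun x => f x ^ 2) := by
  obtain ⟨M, hM⟩ := bdd_of_lip hf hc
  obtain ⟨C, hC⟩ := lip_mul_of_bdd hf hf hM hM
  exact ⟨C, by simpa only [sq] using hC⟩

lemma lip_mul_C1 {U : Set E} (hU : IsOpen U) {ζ h : E → ℝ} (hζ : ∃ K, LipschitzWith K ζ)
    (hc : HasCompactSupport ζ) (hs : tsupport ζ ⊆ U) (hh : ContDiffOn ℝ 1 h U) :
    (∃ K, LipschitzWith K (fun x => ζ x * h x)) ∧ HasCompactSupport (fun x => ζ x * h x) ∧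
      tsupport (fun x => ζ x * h x) ⊆ tsupport ζ := by
  have hss : tsupport (fun x => ζ x * h x) ⊆ tsupport ζ := closure_mono (fun x hx => by
    intro h; apply hx; simp [h])
  refine ⟨?_, hc.of_isClosed_subset (isClosed_tsupport _) hss, hss⟩
  obtain ⟨k, k1, k2, k3, k4⟩ := exists_C1_ext hc hU hs hh
  obtain ⟨C, hC⟩ := ContDiff.lipschitzWith_of_hasCompactSupport k2 k1 (by norm_num)
  obtain ⟨K, hK⟩ := hζ
  obtain ⟨M, hM⟩ := bdd_of_lip hK hc
  obtain ⟨N, hN⟩ := bdd_of_lip hC k2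
  have : (fun x => ζ x * h x) = fun x => ζ x * k x := by
    ext x
    by_cases hx : x ∈ tsupport ζ
    · rw [k4.self_of_nhdsSet x hx]
    · simp [image_eq_zero_of_notMem_tsupport hx]
  rw [this]
  exact lip_mul_of_bdd hK hC hM hN

variable [MeasurableSpace E] [BorelSpace E]

lemma integral_fderiv_zero {ζ : E → ℝ} (hζ : ∃ K, LipschitzWith K ζ)
    (hc : HasCompactSupport ζ) (v : E) : ∫ x, fderiv ℝ ζ x v = 0 := by
  obtain ⟨K, hK⟩ := hζ
  have h := LipschitzWith.integral_lineDeriv_mul_eq (μ := volume) (LipschitzWith.const (1 : ℝ)) hK hc (-v)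
  simp only [neg_neg, mul_one] at h
  have h0 : ∀ x : E, lineDeriv ℝ (fun _ : E => (1 : ℝ)) x (-v) = 0 := by
    intro x; simp [lineDeriv]
  simp only [h0, zero_mul, integral_zero] at h
  rw [h]
  apply integral_congr_ae
  filter_upwards [hK.ae_differentiableAt (μ := volume)] with x hx
  rw [hx.lineDeriv_eq_fderiv]

/-- measurability and integrability -/
lemma integrable_of_bdd_compact {f : E → F} {K : Set E} {M : ℝ}
    (hm : AEStronglyMeasurable f volume) (hK : IsCompact K) (h0 : ∀ x ∉ K, f x = 0)
    (hM : ∀ x, ‖f x‖ ≤ M) : Integrable f := by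
  rw [← integrableOn_iff_integrable_of_support_subset (s := K)
    (fun x hx => by by_contra h; exact hx (h0 x h))]
  exact Measure.integrableOn_of_bounded (M := M) hK.measure_lt_top.ne hm (ae_of_all _ hM)

lemma fderiv_zero_off {ζ : E → ℝ} {x : E} (hx : x ∉ tsupport ζ) : fderiv ℝ ζ x = 0 := by
  have : ζ =ᶠ[𝓝 x] fun _ => 0 := notMem_tsupport_iff_eventuallyEq.1 hx
  rw [this.fderiv_eq]; simp

lemma gradient_zero_off {ζ : E → ℝ} {x : E} (hx : x ∉ tsupport ζ) : gradient ζ x = 0 := by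
  simp [gradient, fderiv_zero_off hx]

lemma norm_gradient_le {ζ : E → ℝ} {K : NNReal} (hK : LipschitzWith K ζ) (x : E) :
    ‖gradient ζ x‖ ≤ K := by
  simp only [gradient, LinearIsometryEquiv.norm_map]
  exact norm_fderiv_le_of_lipschitz ℝ hK

lemma measurable_gradient (ζ : E → ℝ) : Measurable (gradient ζ) := by
  unfold gradient
  exact (LinearIsometryEquiv.continuous _).measurable.comp (measurable_fderiv ℝ ζ)

end Tools2

section Tr
variable {E : Type*} [NormedAddCommGroup E] [InnerProductSpace ℝ E] [FiniteDimensional ℝ E]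

def tr (M : E →L[ℝ] E) : ℝ := LinearMap.trace ℝ E (M : E →ₗ[ℝ] E)

lemma tr_add (M N : E →L[ℝ] E) : tr (M + N) = tr M + tr N := by simp [tr]
lemma tr_sub (M N : E →L[ℝ] E) : tr (M - N) = tr M - tr N := by simp [tr]
lemma tr_smul (c : ℝ) (M : E →L[ℝ] E) : tr (c • M) = c * tr M := by simp [tr]

def trL (E : Type*) [NormedAddCommGroup E] [InnerProductSpace ℝ E] [FiniteDimensional ℝ E] :
    (E →L[ℝ] E) →L[ℝ] ℝ :=
  LinearMap.toContinuousLinearMap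
    { toFun := tr, map_add' := tr_add, map_smul' := fun c M => tr_smul c M }

lemma trL_apply (M : E →L[ℝ] E) : trL E M = tr M := rfl

lemma continuous_tr : Continuous (tr : (E →L[ℝ] E) → ℝ) := (trL E).continuous

lemma tr_eq_sum {ι : Type*} [Fintype ι] (b : OrthonormalBasis ι ℝ E) (M : E →L[ℝ] E) :
    tr M = ∑ i, ⟪b i, M (b i)⟫ := LinearMap.trace_eq_sum_inner _ b

variable [MeasurableSpace E] [BorelSpace E]

lemma ibp_vec {k : E → E} (hk : ContDiff ℝ 1 k) {φ : E → ℝ} (hφ : ∃ K, LipschitzWith K φ)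
    (hc : HasCompactSupport φ) :
    ∫ x, ⟪k x, gradient φ x⟫ = - ∫ x, φ x * tr (fderiv ℝ k x) := by
  set b := stdOrthonormalBasis ℝ E
  obtain ⟨K, hK⟩ := hφ
  have hkd : ∀ x, HasFDerivAt k (fderiv ℝ k x) x := fun x =>
    (hk.differentiable (by norm_num) x).hasFDerivAt
  have hki : ∀ i, ContDiff ℝ 1 (fun x => ⟪b i, k x⟫) := fun i => contDiff_const.inner ℝ hk
  have h0 : ∀ i, ∫ x, fderiv ℝ (fun y => φ y * ⟪b i, k y⟫) x (b i) = 0 := by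
    intro i
    obtain ⟨h1, h2, -⟩ := lip_mul_C1 isOpen_univ ⟨K, hK⟩ hc (subset_univ _) (hki i).contDiffOn
    exact integral_fderiv_zero h1 h2 (b i)
  have hint1 : ∀ i, Integrable (fun x => ⟪b i, k x⟫ * fderiv ℝ φ x (b i)) := by
    intro i
    obtain ⟨k', k1, k2, -, k4⟩ := exists_C1_ext hc isOpen_univ (subset_univ _) (hki i).contDiffOn
    obtain ⟨M, hM⟩ := k2.exists_bound_of_continuous k1.continuous
    have hM0 : 0 ≤ M := (norm_nonneg _).trans (hM 0)
    refine integrable_of_bdd_compact (K := tsupport φ) (M := M * K) ?_ hc ?_ ?_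
    · exact ((hki i).continuous.measurable.mul
        (measurable_fderiv_apply_const ℝ φ (b i))).aestronglyMeasurable
    · intro x hx; simp [fderiv_zero_off hx]
    · intro x
      by_cases hx : x ∈ tsupport φ
      · rw [norm_mul]
        gcongr
        · rw [← k4.self_of_nhdsSet x hx]; exact hM x
        · refine (ContinuousLinearMap.le_opNorm _ _).trans ?_
          rw [b.norm_eq_one, mul_one]
          exact norm_fderiv_le_of_lipschitz ℝ hK
      · simp [fderiv_zero_off hx]; positivity
  have hint2 : ∀ i, Integrable (fun x => φ x * ⟪b i, fderiv ℝ k x (b i)⟫) := by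
    intro i
    apply Continuous.integrable_of_hasCompactSupport
    · exact hK.continuous.mul (continuous_const.inner
        ((hk.continuous_fderiv (by norm_num)).clm_apply continuous_const))
    · exact hc.mul_right
  have hprod : ∀ i, ∫ x, ⟪b i, k x⟫ * fderiv ℝ φ x (b i) = - ∫ x, φ x * ⟪b i, fderiv ℝ k x (b i)⟫ := by
    intro i
    rw [eq_neg_iff_add_eq_zero, ← integral_add (hint1 i) (hint2 i), ← h0 i]
    apply integral_congr_ae
    filter_upwards [hK.ae_differentiableAt (μ := volume)] with x hx
    have := hx.hasFDerivAt.mul ((hasFDerivAt_const (b i) x).inner ℝ (hkd x))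
    have h2 : fderiv ℝ (fun y => φ y * ⟪b i, k y⟫) x = _ := this.fderiv
    rw [h2]
    simp
    ring
  have e1 : ∀ x, ⟪k x, gradient φ x⟫ = ∑ i, ⟪b i, k x⟫ * fderiv ℝ φ x (b i) := by
    intro x
    rw [← b.sum_inner_mul_inner]
    refine Finset.sum_congr rfl (fun i _ => ?_)
    rw [inner_gradient_right, real_inner_comm]; simp
  have e2 : ∀ x, φ x * tr (fderiv ℝ k x) = ∑ i, φ x * ⟪b i, fderiv ℝ k x (b i)⟫ := by
    intro x
    rw [tr_eq_sum b, Finset.mul_sum]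
  simp_rw [e1, e2]
  rw [integral_finsetSum _ (fun i _ => hint1 i), integral_finsetSum _ (fun i _ => hint2 i),
    ← Finset.sum_neg_distrib]
  exact Finset.sum_congr rfl (fun i _ => hprod i)

end Tr

structure Setup (Ω : Set 𝔼) (a f : ℝ → ℝ) (u : 𝔼 → ℝ) (D : 𝔼 → 𝔼) (H : 𝔼 → 𝔼 →L[ℝ] 𝔼) (e : 𝔼) :
    Prop where
  hΩ : IsOpen Ω
  hconn : IsPreconnected Ω
  ha : C11Loc a
  hapos : ∀ t ≥ (0 : ℝ), 0 < a t
  hlam : ∀ t ≥ (0 : ℝ), 0 < lam1 a t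
  hf : ContDiff ℝ 1 f
  hu : ∀ x ∈ Ω, HasGradientAt u (D x) x
  hD : ContDiffOn ℝ 2 D Ω
  hDH : ∀ x ∈ Ω, HasFDerivAt D (H x) x
  hsymm : ∀ x ∈ closure Ω, ∀ v w, ⟪H x v, w⟫ = ⟪v, H x w⟫
  hucl : ContinuousOn u (closure Ω)
  hDcl : ContinuousOn D (closure Ω)
  hHcl : ContinuousOn H (closure Ω)
  hsol : ∀ φ : 𝔼 → ℝ, IsTestOn Ω φ →
    ∫ x in Ω, ⟪a ‖D x‖ • D x, gradient φ x⟫ = ∫ x in Ω, f (u x) * φ x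
  hw0 : ∀ x ∈ Ω, 0 ≤ ⟪D x, e⟫
  hwne : ∃ x ∈ Ω, ⟪D x, e⟫ ≠ 0

namespace Setup
variable {Ω : Set (EuclideanSpace ℝ (Fin n))} {a f : ℝ → ℝ} {u : EuclideanSpace ℝ (Fin n) → ℝ}
  {D : EuclideanSpace ℝ (Fin n) → EuclideanSpace ℝ (Fin n)}
  {H : EuclideanSpace ℝ (Fin n) → EuclideanSpace ℝ (Fin n) →L[ℝ] EuclideanSpace ℝ (Fin n)}
  {e : EuclideanSpace ℝ (Fin n)}

lemma C1u (S : Setup Ω a f u D H e) : ContDiffOn ℝ 1 u Ω := by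
  rw [show (1 : WithTop ℕ∞) = 0 + 1 from rfl, contDiffOn_succ_iff_fderiv_of_isOpen S.hΩ]
  refine ⟨fun x hx => (S.hu x hx).hasFDerivAt.differentiableAt.differentiableWithinAt, by simp, ?_⟩
  rw [contDiffOn_zero]
  have : ContinuousOn (fun x => innerSL ℝ (D x)) Ω :=
    (innerSL ℝ).continuous.comp_continuousOn S.hD.continuousOn
  refine this.congr (fun x hx => ?_)
  rw [(S.hu x hx).hasFDerivAt.fderiv]
  rfl

lemma contY (S : Setup Ω a f u D H e) : ContDiffOn ℝ 1 (fun x => a ‖D x‖ • D x) Ω :=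
  (contDiff_X S.ha).comp_contDiffOn (S.hD.of_le (by norm_num))

lemma derivY (S : Setup Ω a f u D H e) {x : 𝔼} (hx : x ∈ Ω) :
    HasFDerivAt (fun x => a ‖D x‖ • D x) ((AL a (D x)).comp (H x)) x :=
  (hasFDerivAt_X S.ha (D x)).comp x (S.hDH x hx)

lemma setInt {Ω : Set 𝔼} {g : 𝔼 → ℝ} {K : Set 𝔼} (hK : K ⊆ Ω) (h : ∀ x ∉ K, g x = 0) :
    ∫ x in Ω, g x = ∫ x, g x :=
  setIntegral_eq_integral_of_forall_compl_eq_zero (fun x hx => h x (fun h' => hx (hK h')))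

lemma strong (S : Setup Ω a f u D H e) : ∀ x ∈ Ω, tr ((AL a (D x)).comp (H x)) + f (u x) = 0 := by
  have hcont : ContinuousOn (fun x => tr ((AL a (D x)).comp (H x)) + f (u x)) Ω := by
    refine ContinuousOn.add (continuous_tr.comp_continuousOn (ContinuousOn.clm_comp
      ((continuous_AL S.ha).comp_continuousOn (S.hDcl.mono subset_closure))
      (S.hHcl.mono subset_closure))) ?_
    exact S.hf.continuous.comp_continuousOn (S.hucl.mono subset_closure)
  have hae : ∀ᵐ x, x ∈ Ω → tr ((AL a (D x)).comp (H x)) + f (u x) = 0 := by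
    refine IsOpen.ae_eq_zero_of_integral_contDiff_smul_eq_zero S.hΩ
      (hcont.locallyIntegrableOn S.hΩ.measurableSet) ?_
    intro φ hφ hc hs
    obtain ⟨C, hC⟩ := ContDiff.lipschitzWith_of_hasCompactSupport hc hφ (by norm_num)
    have h1 := S.hsol φ ⟨⟨C, hC⟩, hc, hs⟩
    obtain ⟨k, k1, k2, k3, k4⟩ := exists_C1_ext hc S.hΩ hs S.contY
    rw [setInt hs (fun x hx => by simp [gradient_zero_off hx]),
      setInt hs (fun x hx => by simp [image_eq_zero_of_notMem_tsupport hx])] at h1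
    have h2 := ibp_vec k1 ⟨C, hC⟩ hc
    have e1 : ∀ x, ⟪a ‖D x‖ • D x, gradient φ x⟫ = ⟪k x, gradient φ x⟫ := by
      intro x
      by_cases hx : x ∈ tsupport φ
      · rw [k4.self_of_nhdsSet x hx]
      · simp [gradient_zero_off hx]
    have e2 : ∀ x, φ x * tr (fderiv ℝ k x) = φ x * tr ((AL a (D x)).comp (H x)) := by
      intro x
      by_cases hx : x ∈ tsupport φ
      · have : k =ᶠ[𝓝 x] fun x => a ‖D x‖ • D x :=
          k4.filter_mono (nhds_le_nhdsSet hx)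
        rw [this.fderiv_eq, (S.derivY (hs hx)).fderiv]
      · simp [image_eq_zero_of_notMem_tsupport hx]
    simp_rw [e1] at h1
    simp_rw [e2] at h2
    rw [h2] at h1
    have i1 : Integrable (fun x => φ x * tr ((AL a (D x)).comp (H x))) := by
      simp_rw [← e2]
      exact (hC.continuous.mul (continuous_tr.comp
        (k1.continuous_fderiv (by norm_num)))).integrable_of_hasCompactSupport hc.mul_right
    have i2 : Integrable (fun x => f (u x) * φ x) := by
      refine Continuous.integrable_of_hasCompactSupport ?_ hc.mul_left
      rw [continuous_iff_continuousAt]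
      intro x
      by_cases hx : x ∈ Ω
      · exact (S.hf.continuous.continuousAt.comp
          ((S.hucl.mono subset_closure).continuousAt (S.hΩ.mem_nhds hx))).mul hC.continuous.continuousAt
      · have : φ =ᶠ[𝓝 x] 0 := notMem_tsupport_iff_eventuallyEq.1 (fun h => hx (hs h))
        refine (continuousAt_const (y := (0 : ℝ))).congr ?_
        filter_upwards [this] with y hy
        simp [hy]
    have : ∀ x, φ x • (tr ((AL a (D x)).comp (H x)) + f (u x)) =
      φ x * tr ((AL a (D x)).comp (H x)) + f (u x) * φ x := fun x => by simp; ring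
    simp_rw [this]
    rw [integral_add i1 i2]; linarith
  have hE := Measure.eqOn_open_of_ae_eq (μ := volume)
    (f := fun x => tr ((AL a (D x)).comp (H x)) + f (u x)) (g := fun _ => (0 : ℝ)) (U := Ω)
    ((ae_restrict_iff' S.hΩ.measurableSet).2 hae) S.hΩ hcont continuousOn_const
  exact hE

lemma linearized (S : Setup Ω a f u D H e) (v : 𝔼) {ψ : 𝔼 → ℝ} (hψ : IsTestOn Ω ψ) :
    ∫ x in Ω, ⟪Aop a (D x) (H x v), gradient ψ x⟫ = ∫ x in Ω, deriv f (u x) * ⟪D x, v⟫ * ψ x := by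
  obtain ⟨⟨C, hC⟩, hc, hs⟩ := hψ
  set K := tsupport ψ with hKdef
  have hKc : IsCompact K := hc
  obtain ⟨ε, hε, hεs⟩ := hKc.exists_cthickening_subset_open S.hΩ hs
  have hK'c : IsCompact (cthickening ε K) := hKc.cthickening
  obtain ⟨k, k1, k2, k3, k4⟩ := exists_C1_ext hK'c S.hΩ hεs S.contY
  obtain ⟨m, m1, m2, m3, m4⟩ := exists_C1_ext hK'c S.hΩ hεs (S.hf.comp_contDiffOn S.C1u)
  have hKK : K ⊆ cthickening ε K := self_subset_cthickening K
  -- step 1: translated weak equation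
  have step1 : ∀ h : ℝ, |h| * ‖v‖ ≤ ε →
      ∫ x, (⟪k (x + h • v), gradient ψ x⟫ - m (x + h • v) * ψ x) = 0 := by
    intro h hh
    have hmem : ∀ x ∈ K, x + h • v ∈ cthickening ε K := by
      intro x hx
      refine mem_cthickening_of_dist_le _ x _ _ hx ?_
      simpa [dist_eq_norm, norm_smul] using hh
    set ψh : 𝔼 → ℝ := fun x => ψ (x - h • v) with hψh
    have hsh : tsupport ψh ⊆ cthickening ε K := by
      refine closure_minimal ?_ isClosed_cthickening
      intro x hx
      have : x - h • v ∈ K := subset_tsupport ψ hx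
      simpa using hmem _ this
    have hgr : ∀ x, gradient ψh x = gradient ψ (x - h • v) := by
      intro x
      simp only [gradient, hψh]
      rw [fderiv_comp_sub (h • v)]
    have htest : IsTestOn Ω ψh := by
      refine ⟨⟨C, ?_⟩, hK'c.of_isClosed_subset (isClosed_tsupport _) hsh, hsh.trans hεs⟩
      have h1 : LipschitzWith 1 (fun x : 𝔼 => x - h • v) :=
        LipschitzWith.of_dist_le_mul (fun x y => by simp)
      have h2 := hC.comp h1
      rw [mul_one] at h2
      exact h2
    have h1 := S.hsol ψh htest
    rw [setInt hεs (fun x hx => by simp [gradient_zero_off (fun h => hx (hsh h))]),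
      setInt hεs (fun x hx => by
        simp [image_eq_zero_of_notMem_tsupport (fun h => hx (hsh h))])] at h1
    have e1 : ∀ x, ⟪a ‖D x‖ • D x, gradient ψh x⟫ = ⟪k x, gradient ψ (x - h • v)⟫ := by
      intro x
      rw [← hgr]
      by_cases hx : x ∈ cthickening ε K
      · rw [k4.self_of_nhdsSet x hx]
      · simp [gradient_zero_off (fun h => hx (hsh h))]
    have e2 : ∀ x, f (u x) * ψh x = m x * ψ (x - h • v) := by
      intro x
      by_cases hx : x ∈ cthickening ε K
      · rw [m4.self_of_nhdsSet x hx]; rfl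
      · have := image_eq_zero_of_notMem_tsupport (fun h => hx (hsh h))
        rw [this]
        have h3 : ψ (x - h • v) = 0 := this
        rw [h3]; simp
    simp_rw [e1, e2] at h1
    have t1 := integral_add_right_eq_self (μ := (volume : Measure 𝔼))
      (fun x => ⟪k x, gradient ψ (x - h • v)⟫) (h • v)
    have t2 := integral_add_right_eq_self (μ := (volume : Measure 𝔼))
      (fun x => m x * ψ (x - h • v)) (h • v)
    simp only [add_sub_cancel_right] at t1 t2
    rw [integral_sub, t1, t2, h1, sub_self]
    · obtain ⟨M, hM⟩ := k2.exists_bound_of_continuous k1.continuous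
      have hM0 : 0 ≤ M := (norm_nonneg _).trans (hM 0)
      refine integrable_of_bdd_compact (K := K) (M := M * C) ?_ hKc ?_ ?_
      · exact (((k1.continuous.comp (continuous_add_const (h • v))).measurable).inner
          (measurable_gradient ψ)).aestronglyMeasurable
      · intro x hx; simp [gradient_zero_off hx]
      · intro x
        refine (norm_inner_le_norm _ _).trans ?_
        gcongr
        · exact hM _
        · exact norm_gradient_le hC x
    · exact ((m1.continuous.comp (continuous_add_const (h • v))).mul
        hC.continuous).integrable_of_hasCompactSupport hc.mul_left
  -- step 2 : differentiate
  have hkc := k1.continuous_fderiv (by norm_num : (1 : WithTop ℕ∞) ≠ 0)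
  have hmc := m1.continuous_fderiv (by norm_num : (1 : WithTop ℕ∞) ≠ 0)
  obtain ⟨M, hM⟩ := (k2.fderiv (𝕜 := ℝ)).exists_bound_of_continuous hkc
  obtain ⟨N, hN⟩ := (m2.fderiv (𝕜 := ℝ)).exists_bound_of_continuous hmc
  obtain ⟨P, hP⟩ := bdd_of_lip hC hc
  have hM0 : 0 ≤ M := (norm_nonneg _).trans (hM 0)
  have hN0 : 0 ≤ N := (norm_nonneg _).trans (hN 0)
  have hP0 : 0 ≤ P := (norm_nonneg _).trans (hP 0)
  have main := hasDerivAt_integral_of_dominated_loc_of_deriv_le (μ := (volume : Measure 𝔼))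
    (F := fun (h : ℝ) (x : 𝔼) => ⟪k (x + h • v), gradient ψ x⟫ - m (x + h • v) * ψ x)
    (F' := fun (h : ℝ) (x : 𝔼) => ⟪fderiv ℝ k (x + h • v) v, gradient ψ x⟫
      - fderiv ℝ m (x + h • v) v * ψ x) (x₀ := 0) (s := univ)
    (bound := K.indicator (fun _ => M * ‖v‖ * C + N * ‖v‖ * P)) univ_mem
    (Eventually.of_forall (fun h => by
      refine Measurable.aestronglyMeasurable ?_
      exact (((k1.continuous.comp (continuous_add_const (h • v))).measurable).inner
          (measurable_gradient ψ)).sub ((m1.continuous.comp (continuous_add_const (h • v))).mul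
        hC.continuous).measurable))
    (by
      obtain ⟨M, hM⟩ := k2.exists_bound_of_continuous k1.continuous
      have hM0 : 0 ≤ M := (norm_nonneg _).trans (hM 0)
      simp only [zero_smul, add_zero]
      refine Integrable.sub ?_ ((m1.continuous.mul
        hC.continuous).integrable_of_hasCompactSupport hc.mul_left)
      refine integrable_of_bdd_compact (K := K) (M := M * C) ?_ hKc ?_ ?_
      · exact ((k1.continuous.measurable).inner (measurable_gradient ψ)).aestronglyMeasurable
      · intro x hx; simp [gradient_zero_off hx]
      · intro x
        refine (norm_inner_le_norm _ _).trans ?_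
        gcongr
        · exact hM _
        · exact norm_gradient_le hC x)
    (by
      simp only [zero_smul, add_zero]
      refine Measurable.aestronglyMeasurable ?_
      exact ((hkc.clm_apply continuous_const).measurable.inner (measurable_gradient ψ)).sub
        ((hmc.clm_apply continuous_const).mul hC.continuous).measurable)
    (ae_of_all _ (fun x h _ => by
      by_cases hx : x ∈ K
      · rw [indicator_of_mem hx]
        refine (norm_sub_le _ _).trans (add_le_add ?_ ?_)
        · refine (norm_inner_le_norm _ _).trans ?_
          gcongr
          · exact (ContinuousLinearMap.le_opNorm _ _).trans (by gcongr; exact hM _)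
          · exact norm_gradient_le hC x
        · rw [norm_mul]
          gcongr
          · exact (ContinuousLinearMap.le_opNorm _ _).trans (by gcongr; exact hN _)
          · exact hP x
      · rw [indicator_of_notMem hx, gradient_zero_off hx, image_eq_zero_of_notMem_tsupport hx]
        simp))
    ((integrable_indicator_iff hKc.measurableSet).2
      (integrableOn_const (hs := hKc.measure_lt_top.ne)))
    (ae_of_all _ (fun x h _ => by
      have hl : HasDerivAt (fun h : ℝ => x + h • v) v h := by
        simpa using ((hasDerivAt_id h).smul_const v).const_add x
      have h1 := ((k1.differentiable (by norm_num) (x + h • v)).hasFDerivAt).comp_hasDerivAt h hl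
      have h2 := ((m1.differentiable (by norm_num) (x + h • v)).hasFDerivAt).comp_hasDerivAt h hl
      have h3 := (h1.inner ℝ (hasDerivAt_const h (gradient ψ x))).sub (h2.mul_const (ψ x))
      refine h3.congr_deriv ?_
      simp))
  obtain ⟨-, hder⟩ := main
  have hzero : (fun h : ℝ => ∫ x, (⟪k (x + h • v), gradient ψ x⟫ - m (x + h • v) * ψ x))
      =ᶠ[𝓝 0] fun _ => 0 := by
    have hcont : Tendsto (fun h : ℝ => |h| * ‖v‖) (𝓝 0) (𝓝 0) := by
      have : Continuous (fun h : ℝ => |h| * ‖v‖) := continuous_abs.mul continuous_const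
      simpa using this.tendsto 0
    filter_upwards [hcont.eventually (ge_mem_nhds hε)] with h hh
    exact step1 h hh
  have hder0 := (hasDerivAt_const (0 : ℝ) (0 : ℝ)).congr_of_eventuallyEq hzero
  have hfin := hder.unique hder0
  simp only [zero_smul, add_zero] at hfin
  have kx : ∀ x ∈ K, fderiv ℝ k x v = Aop a (D x) (H x v) := by
    intro x hx
    have : k =ᶠ[𝓝 x] fun x => a ‖D x‖ • D x := k4.filter_mono (nhds_le_nhdsSet (hKK hx))
    rw [this.fderiv_eq, (S.derivY (hs hx)).fderiv]
    simp [AL_apply]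
  have mx : ∀ x ∈ K, fderiv ℝ m x v = deriv f (u x) * ⟪D x, v⟫ := by
    intro x hx
    have : m =ᶠ[𝓝 x] f ∘ u := m4.filter_mono (nhds_le_nhdsSet (hKK hx))
    have hfd : HasDerivAt f (deriv f (u x)) (u x) := (S.hf.differentiable (by norm_num) _).hasDerivAt
    rw [this.fderiv_eq, (hfd.comp_hasFDerivAt x (S.hu x (hs hx)).hasFDerivAt).fderiv]
    simp
  rw [setInt hs (fun x hx => by simp [gradient_zero_off hx]),
      setInt hs (fun x hx => by simp [image_eq_zero_of_notMem_tsupport hx])]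
  rw [integral_sub, sub_eq_zero] at hfin
  · convert hfin using 2
    · ext x
      by_cases hx : x ∈ K
      · rw [kx x hx]
      · simp [gradient_zero_off hx]
    · ext x
      by_cases hx : x ∈ K
      · rw [mx x hx]
      · simp [image_eq_zero_of_notMem_tsupport hx]
  · refine integrable_of_bdd_compact (K := K) (M := M * ‖v‖ * C) ?_ hKc ?_ ?_
    · exact ((hkc.clm_apply continuous_const).measurable.inner
        (measurable_gradient ψ)).aestronglyMeasurable
    · intro x hx; simp [gradient_zero_off hx]
    · intro x
      refine (norm_inner_le_norm _ _).trans ?_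
      gcongr
      · exact (ContinuousLinearMap.le_opNorm _ _).trans (by gcongr; exact hM _)
      · exact norm_gradient_le hC x
  · exact ((hmc.clm_apply continuous_const).mul
        hC.continuous).integrable_of_hasCompactSupport hc.mul_left

end Setup

lemma adapted_basis (p : 𝔼) : ∃ (s : Finset 𝔼) (b : OrthonormalBasis s ℝ 𝔼),
    ∀ i, ∀ a : ℝ → ℝ, Aop a p (b i) = a ‖p‖ • b i ∨ Aop a p (b i) = lam1 a ‖p‖ • b i := by
  by_cases hp : p = 0
  · obtain ⟨s, b, -, -⟩ := Orthonormal.exists_orthonormalBasis_extension (𝕜 := ℝ) (E := 𝔼)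
      (v := ∅) (by simp [orthonormal_empty])
    refine ⟨s, b, fun i a => Or.inl ?_⟩
    simp [Aop, hp]
  · have hp' : ‖p‖ ≠ 0 := norm_ne_zero_iff.2 hp
    obtain ⟨s, b, h1, h2⟩ := Orthonormal.exists_orthonormalBasis_extension (𝕜 := ℝ) (E := 𝔼)
      (v := {‖p‖⁻¹ • p}) (by
        refine ⟨?_, ?_⟩
        · rintro ⟨x, hx⟩
          have : x = ‖p‖⁻¹ • p := hx
          simp [this, norm_smul, hp']
        · rintro ⟨x, hx⟩ ⟨y, hy⟩ hxy
          exfalso; apply hxy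
          have h1 : x = ‖p‖⁻¹ • p := hx
          have h2 : y = ‖p‖⁻¹ • p := hy
          simp [h1, h2])
    refine ⟨s, b, fun i a => ?_⟩
    have hν : ‖p‖⁻¹ • p ∈ s := h1 rfl
    by_cases hi : i = ⟨‖p‖⁻¹ • p, hν⟩
    · right
      have : b i = ‖p‖⁻¹ • p := by rw [hi, h2]
      rw [this, Aop_smul, Aop_self, smul_comm]
    · left
      have h3 : ⟪b i, b ⟨‖p‖⁻¹ • p, hν⟩⟫ = 0 := b.orthonormal.2 hi
      have h4 : b ⟨‖p‖⁻¹ • p, hν⟩ = ‖p‖⁻¹ • p := by rw [h2]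
      rw [h4, inner_smul_right] at h3
      have h5 : ⟪p, b i⟫ = 0 := by
        rw [real_inner_comm]
        rcases mul_eq_zero.1 h3 with h | h
        · exact absurd h (inv_ne_zero hp')
        · exact h
      simp [Aop, h5]

lemma tr_AL_nonneg {a : ℝ → ℝ} (hapos : ∀ t ≥ (0 : ℝ), 0 < a t)
    (hlam : ∀ t ≥ (0 : ℝ), 0 < lam1 a t) (p : 𝔼) {M : 𝔼 →L[ℝ] 𝔼} (hM : ∀ v, 0 ≤ ⟪M v, v⟫) :
    0 ≤ tr ((AL a p).comp M) := by
  obtain ⟨s, b, hb⟩ := adapted_basis p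
  rw [tr_eq_sum b]
  refine Finset.sum_nonneg (fun i _ => ?_)
  rw [ContinuousLinearMap.comp_apply, AL_apply, ← inner_Aop_symm]
  rcases hb i a with h | h <;> rw [h, inner_smul_left, real_inner_comm]
  · exact mul_nonneg (by simpa using (hapos _ (norm_nonneg p)).le) (hM _)
  · exact mul_nonneg (by simpa using (hlam _ (norm_nonneg p)).le) (hM _)

lemma second_deriv_nonneg {h h' : ℝ → ℝ} {c : ℝ} (h1 : ∀ᶠ t in 𝓝 0, HasDerivAt h (h' t) t)
    (h2 : HasDerivAt h' c 0) (h3 : IsLocalMin h 0) : 0 ≤ c := by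
  by_contra hc
  push Not at hc
  have e1 : deriv h =ᶠ[𝓝 0] h' := by
    filter_upwards [h1] with t ht using ht.deriv
  have e2 : deriv (deriv h) 0 = c := by rw [e1.deriv_eq, h2.deriv]
  have e3 : deriv h 0 = 0 := h3.deriv_eq_zero
  have h4 := isLocalMax_of_deriv_deriv_neg (by rw [e2]; exact hc) e3
    h1.self_of_nhds.continuousAt
  have h5 : h =ᶠ[𝓝 0] fun _ => h 0 := by
    filter_upwards [h3, h4] with t a1 a2 using le_antisymm a2 a1
  have h6 : deriv h =ᶠ[𝓝 0] fun _ => 0 := by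
    filter_upwards [h5.eventuallyEq_nhds] with t ht
    rw [ht.deriv_eq]; simp
  have : deriv (deriv h) 0 = 0 := by rw [h6.deriv_eq]; simp
  rw [e2] at this; linarith

namespace Setup
variable {Ω : Set (EuclideanSpace ℝ (Fin n))} {a f : ℝ → ℝ} {u : EuclideanSpace ℝ (Fin n) → ℝ}
  {D : EuclideanSpace ℝ (Fin n) → EuclideanSpace ℝ (Fin n)}
  {H : EuclideanSpace ℝ (Fin n) → EuclideanSpace ℝ (Fin n) →L[ℝ] EuclideanSpace ℝ (Fin n)}
  {e : EuclideanSpace ℝ (Fin n)}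

lemma H_C1 (S : Setup Ω a f u D H e) : ContDiffOn ℝ 1 H Ω :=
  (S.hD.fderiv_of_isOpen S.hΩ (m := 1) (by norm_num)).congr (fun x hx => (S.hDH x hx).fderiv.symm)

lemma H_diff (S : Setup Ω a f u D H e) {x : 𝔼} (hx : x ∈ Ω) :
    HasFDerivAt H (fderiv ℝ H x) x :=
  ((S.H_C1.contDiffAt (S.hΩ.mem_nhds hx)).differentiableAt (by norm_num)).hasFDerivAt

lemma H_symm (S : Setup Ω a f u D H e) {x : 𝔼} (hx : x ∈ Ω) (v w : 𝔼) :
    fderiv ℝ H x v w = fderiv ℝ H x w v := by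
  have h1 : H =ᶠ[𝓝 x] fderiv ℝ D := by
    filter_upwards [S.hΩ.mem_nhds hx] with y hy using (S.hDH y hy).fderiv.symm
  rw [h1.fderiv_eq]
  exact (S.hD.contDiffAt (S.hΩ.mem_nhds hx)).isSymmSndFDerivAt (by simp) v w

lemma hasDerivAt_line (x v : 𝔼) (t : ℝ) : HasDerivAt (fun t : ℝ => x + t • v) v t := by
  simpa using ((hasDerivAt_id t).smul_const v).const_add x

lemma W_line (S : Setup Ω a f u D H e) (v : 𝔼) {x : 𝔼} {t : ℝ} (hx : x + t • v ∈ Ω) :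
    HasDerivAt (fun t : ℝ => ⟪D (x + t • v), e⟫) ⟪H (x + t • v) e, v⟫ t := by
  have h1 := (S.hDH _ hx).comp_hasDerivAt t (hasDerivAt_line x v t)
  have h2 := h1.inner ℝ (hasDerivAt_const t e)
  refine h2.congr_deriv ?_
  simp only [inner_zero_right, zero_add]
  rw [S.hsymm _ (subset_closure hx), real_inner_comm]

lemma W_line2 (S : Setup Ω a f u D H e) (v : 𝔼) {x : 𝔼} (hx : x ∈ Ω) :
    HasDerivAt (fun t : ℝ => ⟪H (x + t • v) e, v⟫) ⟪fderiv ℝ H x e v, v⟫ 0 := by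
  have h0 : HasFDerivAt H (fderiv ℝ H x) (x + (0 : ℝ) • v) := by simpa using S.H_diff hx
  have h1 := h0.comp_hasDerivAt 0 (hasDerivAt_line x v 0)
  have h2 := (h1.clm_apply (hasDerivAt_const (0 : ℝ) e)).inner ℝ (hasDerivAt_const (0 : ℝ) v)
  refine h2.congr_deriv ?_
  simp [S.H_symm hx v e]

lemma W_grad (S : Setup Ω a f u D H e) {x : 𝔼} (hx : x ∈ Ω) :
    HasFDerivAt (fun x => ⟪D x, e⟫) (innerSL ℝ (H x e)) x := by
  have h2 := (S.hDH _ hx).inner ℝ (hasFDerivAt_const e x)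
  refine h2.congr_fderiv ?_
  ext v
  simp [S.hsymm _ (subset_closure hx)]
  rw [real_inner_comm, S.hsymm _ (subset_closure hx)]

lemma line_mem (S : Setup Ω a f u D H e) (v : 𝔼) {x : 𝔼} (hx : x ∈ Ω) :
    ∀ᶠ t : ℝ in 𝓝 0, x + t • v ∈ Ω := by
  have : ContinuousAt (fun t : ℝ => x + t • v) 0 := by fun_prop
  exact this.eventually_mem (by simpa using S.hΩ.mem_nhds hx)

lemma AL_lip {a : ℝ → ℝ} (ha : C11Loc a) (R : ℝ) :
    ∃ L : ℝ, 0 ≤ L ∧ (∀ p q : 𝔼, ‖p‖ ≤ R → ‖q‖ ≤ R → ‖AL a p - AL a q‖ ≤ L * ‖p - q‖) := by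
  obtain ⟨L, hL, h1, h2⟩ := BL_lip (n := n) ha R
  refine ⟨L * 1 + L, by positivity, fun p q hp hq => ?_⟩
  have : AL a p - AL a q = (a ‖p‖ - a ‖q‖) • ContinuousLinearMap.id ℝ 𝔼 + (BL a p - BL a q) := by
    unfold AL; module
  rw [this]
  refine (norm_add_le _ _).trans ?_
  rw [norm_smul, add_mul]
  refine add_le_add ?_ (h1 p q hp hq)
  have h3 := h2 p q hp hq
  have h4 : ‖ContinuousLinearMap.id ℝ 𝔼‖ ≤ 1 := ContinuousLinearMap.norm_id_le
  calc ‖a ‖p‖ - a ‖q‖‖ * ‖ContinuousLinearMap.id ℝ 𝔼‖ ≤ (L * ‖p - q‖) * 1 := by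
        gcongr; exact h3
    _ = _ := by ring

lemma diffineq (S : Setup Ω a f u D H e) (R : ℝ) : ∃ C ≥ 0, ∀ x ∈ Ω, ‖D x‖ ≤ R →
    tr ((AL a (D x)).comp (fderiv ℝ H x e)) ≤
      C * ‖H x‖ * ‖H x e‖ + |deriv f (u x)| * ⟪D x, e⟫ := by
  obtain ⟨L, hL, h1⟩ := AL_lip (n := n) S.ha (R + 1)
  refine ⟨‖trL 𝔼‖ * L, by positivity, fun x hx hR => ?_⟩
  have x0 : x + (0 : ℝ) • e = x := by simp
  have dD : HasDerivAt (fun t : ℝ => D (x + t • e)) (H x e) 0 := by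
    have h0 : HasFDerivAt D (H x) (x + (0 : ℝ) • e) := by simpa using S.hDH x hx
    exact h0.comp_hasDerivAt 0 (hasDerivAt_line x e 0)
  have dH : HasDerivAt (fun t : ℝ => H (x + t • e)) (fderiv ℝ H x e) 0 := by
    have h0 : HasFDerivAt H (fderiv ℝ H x) (x + (0 : ℝ) • e) := by simpa using S.H_diff hx
    exact h0.comp_hasDerivAt 0 (hasDerivAt_line x e 0)
  have dtr : HasDerivAt (fun t : ℝ => tr ((AL a (D x)).comp (H (x + t • e))))
      (tr ((AL a (D x)).comp (fderiv ℝ H x e))) 0 := by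
    have := ((trL 𝔼).comp (ContinuousLinearMap.compL ℝ 𝔼 𝔼 𝔼 (AL a (D x)))).hasFDerivAt.comp_hasDerivAt
      (0 : ℝ) dH
    exact this
  have df : HasDerivAt (fun t : ℝ => f (u (x + t • e))) (deriv f (u x) * ⟪D x, e⟫) 0 := by
    have h0 : HasFDerivAt u (InnerProductSpace.toDual ℝ 𝔼 (D x)) (x + (0 : ℝ) • e) := by
      rw [x0]; exact (S.hu x hx).hasFDerivAt
    have hfd : HasDerivAt f (deriv f (u x)) (u (x + (0 : ℝ) • e)) := by
      simpa using (S.hf.differentiable (by norm_num) _).hasDerivAt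
    have h2 := h0.comp_hasDerivAt 0 (hasDerivAt_line x e 0)
    have h3 := hfd.comp (0 : ℝ) h2
    exact h3.congr_deriv (by simp)
  have l1 := dtr.tendsto_slope_zero_right
  have l2 := df.tendsto_slope_zero_right
  have l3 := dD.tendsto_slope_zero_right.norm
  have l4 : Tendsto (fun t : ℝ => ‖H (x + t • e)‖) (𝓝[>] 0) (𝓝 ‖H x‖) := by
    have := dH.continuousAt.norm.tendsto
    rw [x0] at this
    exact this.mono_left nhdsWithin_le_nhds
  simp only [zero_add, x0] at l1 l2 l3
  have l5 := (((l3.const_mul (‖trL 𝔼‖ * L)).mul l4)).sub l2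
  have key := le_of_tendsto_of_tendsto l1 l5 ?_
  · refine key.trans ?_
    have : -(deriv f (u x) * ⟪D x, e⟫) ≤ |deriv f (u x)| * ⟪D x, e⟫ := by
      rw [← neg_mul]
      exact mul_le_mul_of_nonneg_right (neg_le_abs _) (S.hw0 x hx)
    linarith
  · have m1 : ∀ᶠ t : ℝ in 𝓝[>] 0, x + t • e ∈ Ω := nhdsWithin_le_nhds (S.line_mem e hx)
    have m2 : ∀ᶠ t : ℝ in 𝓝[>] 0, ‖D (x + t • e)‖ < R + 1 := by
      refine nhdsWithin_le_nhds (dD.continuousAt.norm.eventually_lt_const ?_)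
      simp only [x0]; linarith
    filter_upwards [m1, m2, self_mem_nhdsWithin] with t t1 t2 t3
    have t3' : 0 < t⁻¹ := inv_pos.2 t3
    have s0 := S.strong x hx
    have st := S.strong _ t1
    have b1 : |tr ((AL a (D (x + t • e)) - AL a (D x)).comp (H (x + t • e)))| ≤
        ‖trL 𝔼‖ * L * ‖D (x + t • e) - D x‖ * ‖H (x + t • e)‖ := by
      rw [← trL_apply]
      refine ((trL 𝔼).le_opNorm _).trans ?_
      rw [mul_assoc, mul_assoc]
      gcongr
      refine (ContinuousLinearMap.opNorm_comp_le _ _).trans ?_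
      rw [← mul_assoc]
      gcongr
      exact h1 _ _ t2.le (hR.trans (by linarith))
    rw [ContinuousLinearMap.sub_comp, tr_sub] at b1
    have b2 := (abs_le.1 b1).1
    have b3 : tr ((AL a (D x)).comp (H (x + t • e))) - tr ((AL a (D x)).comp (H x)) ≤
      ‖trL 𝔼‖ * L * ‖D (x + t • e) - D x‖ * ‖H (x + t • e)‖ - (f (u (x + t • e)) - f (u x)) := by
      linarith
    have b4 := mul_le_mul_of_nonneg_left b3 t3'.le
    simp only [smul_eq_mul, norm_smul, Real.norm_eq_abs, abs_of_pos t3']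
    refine b4.trans (le_of_eq ?_)
    ring

end Setup

lemma tr_rank_one (A : 𝔼 →L[ℝ] 𝔼) (z : 𝔼) :
    tr (A.comp ((innerSL ℝ z).smulRight z)) = ⟪A z, z⟫ := by
  rw [tr_eq_sum (stdOrthonormalBasis ℝ 𝔼), real_inner_comm,
    ← (stdOrthonormalBasis ℝ 𝔼).sum_inner_mul_inner]
  refine Finset.sum_congr rfl (fun i _ => ?_)
  simp [inner_smul_right]

lemma barrier_line (y x v : 𝔼) (α ε c t : ℝ) :
    HasDerivAt (fun t : ℝ => ε * (Real.exp (-α * ‖x + t • v - y‖ ^ 2) - c))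
      (ε * (Real.exp (-α * ‖x + t • v - y‖ ^ 2) * (-2 * α * ⟪x + t • v - y, v⟫))) t := by
  have h1 : HasDerivAt (fun t : ℝ => x + t • v - y) v t :=
    (Setup.hasDerivAt_line x v t).sub_const y
  have h2 := (((h1.norm_sq).const_mul (-α)).exp.sub_const c).const_mul ε
  refine h2.congr_deriv ?_
  ring

lemma barrier_line2 (y x v : 𝔼) (α ε : ℝ) :
    HasDerivAt (fun t : ℝ => ε * (Real.exp (-α * ‖x + t • v - y‖ ^ 2) *
        (-2 * α * ⟪x + t • v - y, v⟫)))
      (ε * (Real.exp (-α * ‖x - y‖ ^ 2) * (4 * α ^ 2 * ⟪x - y, v⟫ ^ 2 - 2 * α * ‖v‖ ^ 2))) 0 := by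
  have h1 : HasDerivAt (fun t : ℝ => x + t • v - y) v 0 :=
    (Setup.hasDerivAt_line x v 0).sub_const y
  have h2 := ((((h1.norm_sq).const_mul (-α)).exp).mul
    ((h1.inner ℝ (hasDerivAt_const (0 : ℝ) v)).const_mul (-2 * α))).const_mul ε
  refine h2.congr_deriv ?_
  simp only [zero_smul, add_zero, inner_zero_right, zero_add, real_inner_self_eq_norm_sq]
  ring

namespace Setup
variable {Ω : Set (EuclideanSpace ℝ (Fin n))} {a f : ℝ → ℝ} {u : EuclideanSpace ℝ (Fin n) → ℝ}
  {D : EuclideanSpace ℝ (Fin n) → EuclideanSpace ℝ (Fin n)}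
  {H : EuclideanSpace ℝ (Fin n) → EuclideanSpace ℝ (Fin n) →L[ℝ] EuclideanSpace ℝ (Fin n)}
  {e : EuclideanSpace ℝ (Fin n)}

lemma barrier_contra (S : Setup Ω a f u D H e) {x y : 𝔼} (hx : x ∈ Ω) {α ε c lam Lam C K : ℝ}
    (hα : 0 < α) (hε : 0 < ε) (hK : 0 ≤ K)
    (hmin : IsLocalMin (fun x => ⟪D x, e⟫ - ε * (Real.exp (-α * ‖x - y‖ ^ 2) - c)) x)
    (hwx : ⟪D x, e⟫ ≤ ε * Real.exp (-α * ‖x - y‖ ^ 2))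
    (hlam : ∀ v, lam * ‖v‖ ^ 2 ≤ ⟪Aop a (D x) v, v⟫) (hLam : tr (AL a (D x)) ≤ Lam)
    (hT : tr ((AL a (D x)).comp (fderiv ℝ H x e)) ≤ C * ‖H x e‖ + K * ⟪D x, e⟫)
    (hbig : 2 * α * Lam + C * (2 * α * ‖x - y‖) + K < 4 * α ^ 2 * (lam * ‖x - y‖ ^ 2)) : False := by
  have x0 : ∀ v : 𝔼, x + (0 : ℝ) • v = x := by simp
  set E := Real.exp (-α * ‖x - y‖ ^ 2) with hE
  have hEpos : 0 < E := Real.exp_pos _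
  have hloc : ∀ v : 𝔼, IsLocalMin (fun t : ℝ => ⟪D (x + t • v), e⟫ -
      ε * (Real.exp (-α * ‖x + t • v - y‖ ^ 2) - c)) 0 := by
    intro v
    have hc : ContinuousAt (fun t : ℝ => x + t • v) 0 := by fun_prop
    have h1 : IsLocalMin (fun x => ⟪D x, e⟫ - ε * (Real.exp (-α * ‖x - y‖ ^ 2) - c))
      ((fun t : ℝ => x + t • v) 0) := by simpa only [x0] using hmin
    exact hc.eventually h1
  have hd : ∀ v : 𝔼, ∀ᶠ t : ℝ in 𝓝 0, HasDerivAt (fun t : ℝ => ⟪D (x + t • v), e⟫ -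
      ε * (Real.exp (-α * ‖x + t • v - y‖ ^ 2) - c)) (⟪H (x + t • v) e, v⟫ -
      ε * (Real.exp (-α * ‖x + t • v - y‖ ^ 2) * (-2 * α * ⟪x + t • v - y, v⟫))) t := by
    intro v
    filter_upwards [S.line_mem v hx] with t ht
    exact (S.W_line v ht).sub (barrier_line y x v α ε c t)
  have hgrad : H x e = (-(2 * α * ε * E)) • (x - y) := by
    refine ext_inner_right ℝ (fun v => ?_)
    have h1 := (hloc v).hasDerivAt_eq_zero (hd v).self_of_nhds
    rw [x0] at h1
    rw [inner_smul_left]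
    simp only [conj_trivial]
    rw [← hE] at h1
    linarith
  have hform : ∀ v, 0 ≤ ⟪(fderiv ℝ H x e - (ε * E) • ((4 * α ^ 2) •
      (innerSL ℝ (x - y)).smulRight (x - y) - (2 * α) • ContinuousLinearMap.id ℝ 𝔼)) v, v⟫ := by
    intro v
    have h1 := second_deriv_nonneg (hd v) ((S.W_line2 v hx).sub (barrier_line2 y x v α ε)) (hloc v)
    refine h1.trans (le_of_eq ?_)
    simp only [sub_apply, smul_apply, ContinuousLinearMap.smulRight_apply,
      inner_sub_left, inner_smul_left, innerSL_apply_apply, ContinuousLinearMap.id_apply,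
      real_inner_self_eq_norm_sq, conj_trivial, ← hE]
    ring
  have htr := tr_AL_nonneg S.hapos S.hlam (D x) hform
  rw [ContinuousLinearMap.comp_sub, tr_sub, ContinuousLinearMap.comp_smul, tr_smul,
    ContinuousLinearMap.comp_sub, tr_sub, ContinuousLinearMap.comp_smul, tr_smul,
    ContinuousLinearMap.comp_smul, tr_smul, tr_rank_one, ContinuousLinearMap.comp_id,
    AL_apply] at htr
  have hn : ‖H x e‖ = 2 * α * ε * E * ‖x - y‖ := by
    rw [hgrad, norm_smul, norm_neg, Real.norm_of_nonneg (by positivity)]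
  rw [hn] at hT
  have h1 := hlam (x - y)
  have h2 : K * ⟪D x, e⟫ ≤ K * (ε * E) := mul_le_mul_of_nonneg_left hwx hK
  have hεE : 0 < ε * E := mul_pos hε hEpos
  have h3 : ε * E * (4 * α ^ 2 * (lam * ‖x - y‖ ^ 2) - 2 * α * Lam) ≤
      ε * E * (4 * α ^ 2 * ⟪Aop a (D x) (x - y), x - y⟫ - 2 * α * tr (AL a (D x))) := by
    gcongr
  have h4 : ε * E * (4 * α ^ 2 * (lam * ‖x - y‖ ^ 2) - 2 * α * Lam) ≤
      ε * E * (C * (2 * α * ‖x - y‖) + K) := by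
    refine h3.trans ?_
    have : ε * E * (C * (2 * α * ‖x - y‖) + K) = C * (2 * α * ε * E * ‖x - y‖) + K * (ε * E) := by
      ring
    rw [this]; linarith
  have h5 := le_of_mul_le_mul_left h4 hεE
  linarith

lemma lam1_continuousOn (ha : C11Loc a) : ContinuousOn (lam1 a) (Ici 0) := by
  unfold lam1
  exact ha.1.continuousOn.add (continuousOn_id.mul ha.continuousOn_deriv)

/-- local bounds on a compact subset of the closure -/
lemma bounds (S : Setup Ω a f u D H e) {K : Set 𝔼} (hK : IsCompact K) (hKΩ : K ⊆ closure Ω) :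
    ∃ R M N lam Lam : ℝ, 0 ≤ R ∧ 0 ≤ M ∧ 0 ≤ N ∧ 0 < lam ∧ 0 ≤ Lam ∧ (∀ x ∈ K, ‖D x‖ ≤ R) ∧
      (∀ x ∈ K, ‖H x‖ ≤ M) ∧ (∀ x ∈ K, |deriv f (u x)| ≤ N) ∧
      (∀ x ∈ K, ∀ v, lam * ‖v‖ ^ 2 ≤ ⟪Aop a (D x) v, v⟫) ∧ (∀ x ∈ K, ‖AL a (D x)‖ ≤ Lam) := by
  obtain ⟨R, hR⟩ := hK.exists_bound_of_continuousOn (S.hDcl.mono hKΩ)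
  obtain ⟨M, hM⟩ := hK.exists_bound_of_continuousOn (S.hHcl.mono hKΩ)
  obtain ⟨N, hN⟩ := hK.exists_bound_of_continuousOn (f := fun x => deriv f (u x))
    ((S.hf.continuous_deriv (by norm_num)).comp_continuousOn (S.hucl.mono hKΩ))
  obtain ⟨Lam, hLam⟩ := hK.exists_bound_of_continuousOn (f := fun x => AL a (D x))
    ((continuous_AL S.ha).comp_continuousOn (S.hDcl.mono hKΩ))
  have hc : ContinuousOn (fun t => min (a t) (lam1 a t)) (Icc 0 |R|) := by
    refine ContinuousOn.mono ?_ (fun t ht => ht.1 : Icc 0 |R| ⊆ Ici 0)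
    exact S.ha.1.continuousOn.inf (lam1_continuousOn S.ha)
  obtain ⟨t0, ht0, ht0'⟩ := isCompact_Icc.exists_isMinOn (nonempty_Icc.2 (abs_nonneg R)) hc
  refine ⟨|R|, |M|, |N|, min (a t0) (lam1 a t0), |Lam|, abs_nonneg _, abs_nonneg _, abs_nonneg _,
    lt_min (S.hapos _ ht0.1) (S.hlam _ ht0.1), abs_nonneg _, fun x hx => (hR x hx).trans (le_abs_self _),
    fun x hx => (hM x hx).trans (le_abs_self _), fun x hx => (hN x hx).trans (le_abs_self _),
    fun x hx v => ?_, fun x hx => (hLam x hx).trans (le_abs_self _)⟩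
  refine le_trans ?_ (inner_Aop_lower a (D x) v)
  refine mul_le_mul_of_nonneg_right ?_ (sq_nonneg _)
  exact ht0' ⟨norm_nonneg _, (hR x hx).trans (le_abs_self _)⟩

lemma hopf (S : Setup Ω a f u D H e) {y : 𝔼} {R : ℝ} (hR : 0 < R) (hB : ball y R ⊆ Ω)
    (hpos : ∀ x ∈ ball y R, 0 < ⟪D x, e⟫) :
    ∃ κ > 0, ∀ x ∈ ball y R, R / 2 ≤ ‖x - y‖ → κ * (R - ‖x - y‖) ≤ ⟪D x, e⟫ := by
  have hcl : closedBall y R ⊆ closure Ω := by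
    rw [← closure_ball y hR.ne']; exact closure_mono hB
  obtain ⟨R0, M, N, lam, Lam, hR0, hM0, hN0, hlam0, hLam0, hR1, hM1, hN1, hlam1, hLam1⟩ :=
    S.bounds (isCompact_closedBall y R) hcl
  obtain ⟨C, hC0, hC⟩ := S.diffineq R0
  have hwc : ContinuousOn (fun x => ⟪D x, e⟫) Ω :=
    (S.hDcl.mono subset_closure).inner continuousOn_const
  -- the minimum on the inner sphere
  obtain ⟨m, hm, hm'⟩ : ∃ m > 0, ∀ x ∈ sphere y (R / 2), m ≤ ⟪D x, e⟫ := by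
    have hs : sphere y (R / 2) ⊆ ball y R := fun x hx => by
      rw [mem_sphere] at hx; rw [mem_ball, hx]; linarith
    rcases (sphere y (R / 2)).eq_empty_or_nonempty with h0 | h0
    · exact ⟨1, one_pos, fun x hx => by rw [h0] at hx; exact hx.elim⟩
    · obtain ⟨x0, h1, h2⟩ := (isCompact_sphere y (R / 2)).exists_isMinOn h0
        (hwc.mono (hs.trans hB))
      exact ⟨_, hpos x0 (hs h1), fun x hx => h2 hx⟩
  -- choice of alpha
  set Q := 2 * (‖trL 𝔼‖ * Lam) + 2 * (C * M) * R + N with hQ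
  have hQ0 : 0 ≤ Q := by positivity
  obtain ⟨α, hα1, hα2⟩ : ∃ α : ℝ, 1 ≤ α ∧ Q < α * (lam * R ^ 2) := by
    refine ⟨max 1 (Q / (lam * R ^ 2) + 1), le_max_left _ _, ?_⟩
    have hp : 0 < lam * R ^ 2 := by positivity
    calc Q = Q / (lam * R ^ 2) * (lam * R ^ 2) := by field_simp
      _ < (Q / (lam * R ^ 2) + 1) * (lam * R ^ 2) := by
        apply mul_lt_mul_of_pos_right _ hp; linarith
      _ ≤ _ := by gcongr; exact le_max_right _ _
  have hα : 0 < α := by linarith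
  have main : ∀ r < R, 0 < r → ∀ x, R / 2 ≤ ‖x - y‖ → ‖x - y‖ ≤ r →
      m * (Real.exp (-α * ‖x - y‖ ^ 2) - Real.exp (-α * r ^ 2)) ≤ ⟪D x, e⟫ := by
    intro r hr hr0 x hx1 hx2
    set A : Set 𝔼 := {x | R / 2 ≤ ‖x - y‖ ∧ ‖x - y‖ ≤ r} with hA
    have hAb : A ⊆ ball y R := fun z hz => by
      rw [mem_ball, dist_eq_norm]; exact hz.2.trans_lt hr
    have hAc : IsCompact A := by
      refine (isCompact_closedBall y R).of_isClosed_subset ?_ (hAb.trans ball_subset_closedBall)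
      have hnc : Continuous (fun z : 𝔼 => ‖z - y‖) := by fun_prop
      exact (isClosed_le continuous_const hnc).inter (isClosed_le hnc continuous_const)
    set h : 𝔼 → ℝ := fun x => ⟪D x, e⟫ - m * (Real.exp (-α * ‖x - y‖ ^ 2) - Real.exp (-α * r ^ 2)) with hh
    have hhc : ContinuousOn h A := by
      refine (hwc.mono (hAb.trans hB)).sub (Continuous.continuousOn ?_)
      fun_prop
    obtain ⟨x0, h1, h2⟩ := hAc.exists_isMinOn ⟨x, hx1, hx2⟩ hhc
    have h3 : h x0 ≤ h x := h2 ⟨hx1, hx2⟩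
    suffices 0 ≤ h x0 by have := this.trans h3; simp only [hh] at this; linarith
    by_contra hneg
    push Not at hneg
    have hx0 := hAb h1
    have hx0Ω := hB hx0
    have hx0c := ball_subset_closedBall hx0
    have hE1 : Real.exp (-α * ‖x0 - y‖ ^ 2) ≤ 1 := Real.exp_le_one_iff.2 (by
      have : 0 ≤ α * ‖x0 - y‖ ^ 2 := by positivity
      linarith)
    have ne1 : R / 2 < ‖x0 - y‖ := by
      refine lt_of_le_of_ne h1.1 (fun heq => ?_)
      have := hm' x0 (by rw [mem_sphere, dist_eq_norm, heq])
      have h4 : m * (Real.exp (-α * ‖x0 - y‖ ^ 2) - Real.exp (-α * r ^ 2)) ≤ m * 1 := by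
        gcongr
        linarith [Real.exp_pos (-α * r ^ 2)]
      simp only [hh] at hneg; linarith
    have ne2 : ‖x0 - y‖ < r := by
      refine lt_of_le_of_ne h1.2 (fun heq => ?_)
      simp only [hh, heq] at hneg
      have := hpos x0 hx0
      linarith
    have hloc : IsLocalMin h x0 := by
      refine h2.isLocalMin ?_
      have o1 : ∀ᶠ z in 𝓝 x0, R / 2 < ‖z - y‖ :=
        (by fun_prop : ContinuousAt (fun z : 𝔼 => ‖z - y‖) x0).eventually_const_lt ne1
      have o2 : ∀ᶠ z in 𝓝 x0, ‖z - y‖ < r :=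
        (by fun_prop : ContinuousAt (fun z : 𝔼 => ‖z - y‖) x0).eventually_lt_const ne2
      filter_upwards [o1, o2] with z a1 a2 using ⟨a1.le, a2.le⟩
    have hnx : ‖x0 - y‖ ≤ R := ne2.le.trans hr.le
    refine S.barrier_contra hx0Ω hα hm hN0 (lam := lam) (Lam := ‖trL 𝔼‖ * Lam) (C := C * M) hloc ?_
      (hlam1 x0 hx0c) ?_ ?_ ?_
    · have h4 : m * (Real.exp (-α * ‖x0 - y‖ ^ 2) - Real.exp (-α * r ^ 2)) ≤
        m * Real.exp (-α * ‖x0 - y‖ ^ 2) := by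
        gcongr
        linarith [Real.exp_pos (-α * r ^ 2)]
      simp only [hh] at hneg; linarith
    · rw [← trL_apply]
      refine (le_abs_self _).trans (((trL 𝔼).le_opNorm _).trans ?_)
      gcongr
      exact hLam1 x0 hx0c
    · refine (hC x0 hx0Ω (hR1 x0 hx0c)).trans ?_
      gcongr
      · exact hM1 x0 hx0c
      · exact (hpos x0 hx0).le
      · exact hN1 x0 hx0c
    · have c1 : α * Q < α * (α * (lam * R ^ 2)) := mul_lt_mul_of_pos_left hα2 hα
      have c2 : 2 * α * (‖trL 𝔼‖ * Lam) + C * M * (2 * α * ‖x0 - y‖) + N ≤ α * Q := by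
        rw [hQ]
        have : C * M * (2 * α * ‖x0 - y‖) ≤ C * M * (2 * α * R) := by gcongr
        have : N ≤ α * N := by nlinarith
        linarith
      have c3 : α * (α * (lam * R ^ 2)) ≤ 4 * α ^ 2 * (lam * ‖x0 - y‖ ^ 2) := by
        have : (R / 2) ^ 2 ≤ ‖x0 - y‖ ^ 2 := by gcongr
        have : 4 * α ^ 2 * (lam * (R / 2) ^ 2) ≤ 4 * α ^ 2 * (lam * ‖x0 - y‖ ^ 2) := by gcongr
        refine le_trans (le_of_eq ?_) this
        ring
      linarith
  refine ⟨m * (Real.exp (-α * R ^ 2) * (α * R)), by positivity, fun x hx hx1 => ?_⟩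
  have hxR : ‖x - y‖ < R := by rwa [mem_ball, dist_eq_norm] at hx
  have hlim : m * (Real.exp (-α * ‖x - y‖ ^ 2) - Real.exp (-α * R ^ 2)) ≤ ⟪D x, e⟫ := by
    have ht : Tendsto (fun r => m * (Real.exp (-α * ‖x - y‖ ^ 2) - Real.exp (-α * r ^ 2))) (𝓝[<] R)
        (𝓝 (m * (Real.exp (-α * ‖x - y‖ ^ 2) - Real.exp (-α * R ^ 2)))) := by
      have : Continuous (fun r : ℝ => m * (Real.exp (-α * ‖x - y‖ ^ 2) - Real.exp (-α * r ^ 2))) := by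
        fun_prop
      exact this.continuousAt.tendsto.mono_left nhdsWithin_le_nhds
    refine le_of_tendsto ht ?_
    filter_upwards [Ioo_mem_nhdsLT hxR] with r hr
    exact main r hr.2 ((norm_nonneg _).trans_lt hr.1) x hx1 hr.1.le
  refine le_trans ?_ hlim
  have e1 : Real.exp (-α * ‖x - y‖ ^ 2) =
      Real.exp (-α * R ^ 2) * Real.exp (α * (R ^ 2 - ‖x - y‖ ^ 2)) := by
    rw [← Real.exp_add]; congr 1; ring
  have e2 := Real.add_one_le_exp (α * (R ^ 2 - ‖x - y‖ ^ 2))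
  have e3 : R * (R - ‖x - y‖) ≤ R ^ 2 - ‖x - y‖ ^ 2 := by nlinarith [norm_nonneg (x - y)]
  have e4 : α * (R * (R - ‖x - y‖)) ≤ α * (R ^ 2 - ‖x - y‖ ^ 2) := by gcongr
  rw [e1]
  calc m * (Real.exp (-α * R ^ 2) * (α * R)) * (R - ‖x - y‖)
      = m * (Real.exp (-α * R ^ 2) * (α * (R * (R - ‖x - y‖)))) := by ring
    _ ≤ m * (Real.exp (-α * R ^ 2) * (Real.exp (α * (R ^ 2 - ‖x - y‖ ^ 2)) - 1)) := by
        gcongr; linarith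
    _ = _ := by ring

end Setup

namespace Setup
variable {Ω : Set (EuclideanSpace ℝ (Fin n))} {a f : ℝ → ℝ} {u : EuclideanSpace ℝ (Fin n) → ℝ}
  {D : EuclideanSpace ℝ (Fin n) → EuclideanSpace ℝ (Fin n)}
  {H : EuclideanSpace ℝ (Fin n) → EuclideanSpace ℝ (Fin n) →L[ℝ] EuclideanSpace ℝ (Fin n)}
  {e : EuclideanSpace ℝ (Fin n)}

lemma hopf_slope (S : Setup Ω a f u D H e) {y z : 𝔼} {R : ℝ} (hR : 0 < R) (hB : ball y R ⊆ Ω)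
    (hpos : ∀ x ∈ ball y R, 0 < ⟪D x, e⟫) (hz : ‖y - z‖ = R) :
    ∃ κ > 0, ∀ t : ℝ, 0 < t → t ≤ 1 / 2 →
      z + t • (y - z) ∈ ball y R ∧ κ * t ≤ ⟪D (z + t • (y - z)), e⟫ := by
  obtain ⟨κ, hκ, h⟩ := S.hopf hR hB hpos
  refine ⟨κ * R, by positivity, fun t ht ht2 => ?_⟩
  have e1 : z + t • (y - z) - y = (-(1 - t)) • (y - z) := by module
  have e2 : ‖z + t • (y - z) - y‖ = (1 - t) * R := by
    rw [e1, norm_smul, norm_neg, Real.norm_of_nonneg (by linarith), hz]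
  have hm : z + t • (y - z) ∈ ball y R := by
    rw [mem_ball, dist_eq_norm, e2]; nlinarith
  refine ⟨hm, ?_⟩
  have := h _ hm (by rw [e2]; nlinarith)
  rw [e2] at this
  refine le_trans (le_of_eq ?_) this
  ring

lemma wpos (S : Setup Ω a f u D H e) : ∀ x ∈ Ω, 0 < ⟪D x, e⟫ := by
  have hwc : ContinuousOn (fun x => ⟪D x, e⟫) Ω :=
    (S.hDcl.mono subset_closure).inner continuousOn_const
  set P : Set 𝔼 := Ω ∩ (fun x => ⟪D x, e⟫) ⁻¹' Ioi 0 with hP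
  have hPo : IsOpen P := hwc.isOpen_inter_preimage S.hΩ isOpen_Ioi
  suffices Ω ⊆ P from fun x hx => (this hx).2
  refine S.hconn.subset_of_closure_inter_subset hPo ?_ ?_
  · obtain ⟨x, hx, hx'⟩ := S.hwne
    exact ⟨x, hx, hx, lt_of_le_of_ne (S.hw0 x hx) (Ne.symm hx')⟩
  rintro z0 ⟨hz0, hz0Ω⟩
  refine ⟨hz0Ω, ?_⟩
  by_contra hcon
  have hw0 : ⟪D z0, e⟫ = 0 := le_antisymm (not_lt.1 hcon) (S.hw0 _ hz0Ω)
  obtain ⟨ρ, hρ, hρΩ⟩ := nhds_basis_closedBall.mem_iff.1 (S.hΩ.mem_nhds hz0Ω)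
  obtain ⟨y, hyP, hy⟩ := Metric.mem_closure_iff.1 hz0 (ρ / 2) (by positivity)
  set Z : Set 𝔼 := closedBall z0 ρ ∩ (fun x => ⟪D x, e⟫) ⁻¹' {0} with hZ
  have hZc : IsCompact Z := (isCompact_closedBall z0 ρ).of_isClosed_subset
    ((hwc.mono hρΩ).preimage_isClosed_of_isClosed isClosed_closedBall isClosed_singleton)
    inter_subset_left
  have hz0Z : z0 ∈ Z := ⟨mem_closedBall_self hρ.le, hw0⟩
  obtain ⟨z, hzZ, hzmin⟩ := hZc.exists_isMinOn (f := fun z => dist y z) ⟨z0, hz0Z⟩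
    (by fun_prop)
  have hmin : ∀ z' ∈ Z, dist y z ≤ dist y z' := fun z' h => hzmin h
  have hzΩ : z ∈ Ω := hρΩ hzZ.1
  have hwz : ⟪D z, e⟫ = 0 := hzZ.2
  have hyz : y ≠ z := by
    rintro rfl
    have h1 : 0 < ⟪D y, e⟫ := hyP.2
    rw [hwz] at h1; exact lt_irrefl _ h1
  set R := ‖y - z‖ with hR
  have hR0 : 0 < R := norm_pos_iff.2 (sub_ne_zero.2 hyz)
  have hRle : R < ρ / 2 := by
    rw [hR, ← dist_eq_norm]
    refine (hmin z0 hz0Z).trans_lt ?_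
    rw [dist_comm]; exact hy
  have hBs : ball y R ⊆ closedBall z0 ρ := by
    intro x hx
    rw [mem_closedBall]
    have h1 : dist x y < R := hx
    have h2 := dist_triangle x y z0
    rw [dist_comm y z0] at h2
    linarith
  have hBpos : ∀ x ∈ ball y R, 0 < ⟪D x, e⟫ := by
    intro x hx
    refine lt_of_le_of_ne (S.hw0 x (hρΩ (hBs hx))) (fun h0 => ?_)
    have h1 := hmin x ⟨hBs hx, h0.symm⟩
    have h2 : dist x y < R := hx
    rw [dist_eq_norm y z, dist_comm y x] at h1
    linarith
  obtain ⟨κ, hκ, hs⟩ := S.hopf_slope hR0 (hBs.trans hρΩ) hBpos rfl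
  have hlm : IsLocalMin (fun x => ⟪D x, e⟫) z := by
    filter_upwards [S.hΩ.mem_nhds hzΩ] with x hx
    rw [hwz]; exact S.hw0 x hx
  have hg0 : innerSL ℝ (H z e) = 0 := hlm.hasFDerivAt_eq_zero (S.W_grad hzΩ)
  have hl := (S.W_line (y - z) (x := z) (t := 0) (by simpa using hzΩ)).tendsto_slope_zero_right
  simp only [zero_add, zero_smul, add_zero, hwz, sub_zero] at hl
  have h0 : ⟪H z e, y - z⟫ = 0 := by
    have := congrArg (fun L => L (y - z)) hg0
    simpa using this
  rw [h0] at hl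
  have : κ ≤ 0 := by
    refine ge_of_tendsto hl ?_
    filter_upwards [Ioc_mem_nhdsGT (show (0 : ℝ) < 1 / 2 by norm_num)] with t ht
    have h1 := (hs t ht.1 ht.2).2
    have h2 := ht.1
    rw [smul_eq_mul, inv_mul_eq_div, le_div_iff₀ h2]
    exact h1
  linarith

end Setup

lemma intX {Ω : Set 𝔼} (hΩ : IsOpen Ω) {X : 𝔼 → 𝔼} (hX : ContinuousOn X Ω) {ζ : 𝔼 → ℝ}
    (hζ : IsTestOn Ω ζ) : IntegrableOn (fun x => ⟪X x, gradient ζ x⟫) Ω := by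
  obtain ⟨⟨C, hC⟩, hc, hs⟩ := hζ
  have hKm : MeasurableSet (tsupport ζ) := (isClosed_tsupport ζ).measurableSet
  have hc' : IsCompact (tsupport ζ) := hc
  obtain ⟨M, hM⟩ := hc'.exists_bound_of_continuousOn (hX.mono hs)
  have h1 : IntegrableOn (fun x => ⟪X x, gradient ζ x⟫) (tsupport ζ) := by
    refine IntegrableOn.of_bound hc'.measure_lt_top ?_ (|M| * C) ?_
    · exact AEStronglyMeasurable.inner (𝕜 := ℝ) ((hX.mono hs).aestronglyMeasurable hKm)
        (measurable_gradient ζ).aestronglyMeasurable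
    · refine (ae_restrict_iff' hKm).2 (ae_of_all _ (fun x hx => ?_))
      refine (norm_inner_le_norm _ _).trans ?_
      gcongr
      · exact (hM x hx).trans (le_abs_self _)
      · exact norm_gradient_le hC x
  exact h1.of_forall_sdiff_eq_zero hΩ.measurableSet
    (fun x hx => by simp [gradient_zero_off hx.2])

lemma intc {Ω : Set 𝔼} (hΩ : IsOpen Ω) {c : 𝔼 → ℝ} (hX : ContinuousOn c Ω) {ζ : 𝔼 → ℝ}
    (hζ : IsTestOn Ω ζ) : IntegrableOn (fun x => ζ x * c x) Ω := by
  obtain ⟨⟨C, hC⟩, hc, hs⟩ := hζ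
  have hc' : IsCompact (tsupport ζ) := hc
  have h1 : IntegrableOn (fun x => ζ x * c x) (tsupport ζ) :=
    (hC.continuous.continuousOn.mul (hX.mono hs)).integrableOn_compact hc'
  exact h1.of_forall_sdiff_eq_zero hΩ.measurableSet
    (fun x hx => by simp [image_eq_zero_of_notMem_tsupport hx.2])

/-- the vector field -/
def Gf (a : ℝ → ℝ) (D : 𝔼 → 𝔼) (H : 𝔼 → 𝔼 →L[ℝ] 𝔼) (e x : 𝔼) : 𝔼 :=
  Aop a (D x) (H x (D x)) - (‖D x‖ ^ 2 / ⟪D x, e⟫) • Aop a (D x) (H x e)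

def Nf (a : ℝ → ℝ) (D : 𝔼 → 𝔼) (H : 𝔼 → 𝔼 →L[ℝ] 𝔼) (x : 𝔼) : ℝ :=
  ∑ i : Fin n, ⟪Aop a (D x) (H x (EuclideanSpace.single i (1 : ℝ))),
    H x (EuclideanSpace.single i (1 : ℝ))⟫

def gsw (D : 𝔼 → 𝔼) (H : 𝔼 → 𝔼 →L[ℝ] 𝔼) (e x : 𝔼) : 𝔼 :=
  (2 / ⟪D x, e⟫) • H x (D x) - (‖D x‖ ^ 2 / ⟪D x, e⟫ ^ 2) • H x e

def qf (a : ℝ → ℝ) (D : 𝔼 → 𝔼) (H : 𝔼 → 𝔼 →L[ℝ] 𝔼) (e x : 𝔼) : ℝ :=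
  Nf a D H x - ⟪Aop a (D x) (H x e), gsw D H e x⟫

namespace Setup
variable {Ω : Set (EuclideanSpace ℝ (Fin n))} {a f : ℝ → ℝ} {u : EuclideanSpace ℝ (Fin n) → ℝ}
  {D : EuclideanSpace ℝ (Fin n) → EuclideanSpace ℝ (Fin n)}
  {H : EuclideanSpace ℝ (Fin n) → EuclideanSpace ℝ (Fin n) →L[ℝ] EuclideanSpace ℝ (Fin n)}
  {e : EuclideanSpace ℝ (Fin n)}

lemma cAop (S : Setup Ω a f u D H e) {s : Set 𝔼} (hs : s ⊆ closure Ω) {X : 𝔼 → 𝔼}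
    (hX : ContinuousOn X s) : ContinuousOn (fun x => Aop a (D x) (X x)) s := by
  simp_rw [← AL_apply]
  exact ((continuous_AL S.ha).comp_continuousOn (S.hDcl.mono hs)).clm_apply hX

lemma lin_mul (S : Setup Ω a f u D H e) (v : 𝔼) {h : 𝔼 → ℝ} {h' : 𝔼 → 𝔼}
    (hh : ContDiffOn ℝ 1 h Ω) (hh' : ∀ x ∈ Ω, HasFDerivAt h (innerSL ℝ (h' x)) x)
    {ζ : 𝔼 → ℝ} (hζ : IsTestOn Ω ζ) :
    ∫ x in Ω, (h x * ⟪Aop a (D x) (H x v), gradient ζ x⟫ + ζ x * ⟪Aop a (D x) (H x v), h' x⟫) =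
      ∫ x in Ω, deriv f (u x) * ⟪D x, v⟫ * (ζ x * h x) := by
  obtain ⟨h1, h2, h3⟩ := lip_mul_C1 S.hΩ hζ.1 hζ.2.1 hζ.2.2 hh
  rw [← S.linearized v ⟨h1, h2, h3.trans hζ.2.2⟩]
  obtain ⟨⟨C, hC⟩, -, -⟩ := hζ
  refine setIntegral_congr_ae S.hΩ.measurableSet ?_
  filter_upwards [hC.ae_differentiableAt (μ := volume)] with x hx hxΩ
  have h4 := (hx.hasFDerivAt.mul (hh' x hxΩ)).fderiv
  have h5 : ∀ X : 𝔼, ⟪X, gradient (fun x => ζ x * h x) x⟫ = h x * ⟪X, gradient ζ x⟫ + ζ x * ⟪X, h' x⟫ := by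
    intro X
    have h6 : fderiv ℝ (fun x => ζ x * h x) x = _ := h4
    rw [inner_gradient_right, inner_gradient_right, h6]
    simp
    rw [real_inner_comm]; ring
  rw [h5]

lemma Wc1 (S : Setup Ω a f u D H e) (v : 𝔼) : ContDiffOn ℝ 1 (fun x => ⟪D x, v⟫) Ω :=
  (S.hD.of_le (by norm_num)).inner ℝ contDiffOn_const

lemma Wgrad' (S : Setup Ω a f u D H e) (v : 𝔼) {x : 𝔼} (hx : x ∈ Ω) :
    HasFDerivAt (fun x => ⟪D x, v⟫) (innerSL ℝ (H x v)) x := by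
  have h2 := (S.hDH _ hx).inner ℝ (hasFDerivAt_const v x)
  refine h2.congr_fderiv ?_
  ext w
  simp [S.hsymm _ (subset_closure hx)]
  rw [real_inner_comm, S.hsymm _ (subset_closure hx)]

lemma s2grad (S : Setup Ω a f u D H e) {x : 𝔼} (hx : x ∈ Ω) :
    HasFDerivAt (fun x => ‖D x‖ ^ 2) (innerSL ℝ ((2 : ℝ) • H x (D x))) x := by
  have h2 := (S.hDH _ hx).norm_sq
  refine h2.congr_fderiv ?_
  ext w
  simp [S.hsymm _ (subset_closure hx), inner_smul_left]

lemma s2C1 (S : Setup Ω a f u D H e) : ContDiffOn ℝ 1 (fun x => ‖D x‖ ^ 2) Ω :=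
  (S.hD.of_le (by norm_num)).norm_sq ℝ

lemma swgrad (S : Setup Ω a f u D H e) {x : 𝔼} (hx : x ∈ Ω) :
    HasFDerivAt (fun x => ‖D x‖ ^ 2 / ⟪D x, e⟫) (innerSL ℝ (gsw D H e x)) x := by
  have hw := (S.wpos x hx).ne'
  have h2 := (S.s2grad hx).mul ((hasDerivAt_inv hw).comp_hasFDerivAt x (S.Wgrad' e hx))
  have h3 : HasFDerivAt (fun x => ‖D x‖ ^ 2 * (⟪D x, e⟫)⁻¹) _ x := h2
  simp_rw [div_eq_mul_inv]
  refine h3.congr_fderiv ?_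
  ext w
  simp [gsw, inner_sub_left, inner_smul_left]
  ring

lemma swC1 (S : Setup Ω a f u D H e) : ContDiffOn ℝ 1 (fun x => ‖D x‖ ^ 2 / ⟪D x, e⟫) Ω :=
  S.s2C1.div (S.Wc1 e) (fun x hx => (S.wpos x hx).ne')

lemma cHv (S : Setup Ω a f u D H e) {s : Set 𝔼} (hs : s ⊆ closure Ω) (v : 𝔼) :
    ContinuousOn (fun x => H x v) s := (S.hHcl.mono hs).clm_apply continuousOn_const

lemma cHD (S : Setup Ω a f u D H e) {s : Set 𝔼} (hs : s ⊆ closure Ω) :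
    ContinuousOn (fun x => H x (D x)) s := (S.hHcl.mono hs).clm_apply (S.hDcl.mono hs)

lemma cG (S : Setup Ω a f u D H e) {s : Set 𝔼} (hs : s ⊆ closure Ω) (hw : ∀ x ∈ s, ⟪D x, e⟫ ≠ 0) :
    ContinuousOn (Gf a D H e) s :=
  (S.cAop hs (S.cHD hs)).sub ((((S.hDcl.mono hs).norm.pow 2).div
    ((S.hDcl.mono hs).inner continuousOn_const) hw).smul (S.cAop hs (S.cHv hs e)))

lemma cGΩ (S : Setup Ω a f u D H e) : ContinuousOn (Gf a D H e) Ω :=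
  S.cG subset_closure (fun x hx => (S.wpos x hx).ne')

lemma cN (S : Setup Ω a f u D H e) {s : Set 𝔼} (hs : s ⊆ closure Ω) :
    ContinuousOn (Nf a D H) s := by
  unfold Nf
  exact continuousOn_finsetSum _ (fun i _ => (S.cAop hs (S.cHv hs _)).inner (S.cHv hs _))

lemma cgsw (S : Setup Ω a f u D H e) : ContinuousOn (gsw D H e) Ω := by
  have hw : ∀ x ∈ Ω, ⟪D x, e⟫ ≠ 0 := fun x hx => (S.wpos x hx).ne'
  have hcw : ContinuousOn (fun x => ⟪D x, e⟫) Ω := (S.Wc1 e).continuousOn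
  exact ((continuousOn_const.div hcw hw).smul (S.cHD subset_closure)).sub
    ((S.s2C1.continuousOn.div (hcw.pow 2) (fun x hx => pow_ne_zero 2 (hw x hx))).smul
      (S.cHv subset_closure e))

lemma cq (S : Setup Ω a f u D H e) : ContinuousOn (qf a D H e) Ω :=
  (S.cN subset_closure).sub ((S.cAop subset_closure (S.cHv subset_closure e)).inner S.cgsw)

lemma weak_id (S : Setup Ω a f u D H e) {ζ : 𝔼 → ℝ} (hζ : IsTestOn Ω ζ) :
    (∫ x in Ω, ζ x * qf a D H e x) + ∫ x in Ω, ⟪Gf a D H e x, gradient ζ x⟫ = 0 := by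
  have hΩc : Ω ⊆ closure Ω := subset_closure
  set b : Fin n → 𝔼 := fun i => EuclideanSpace.single i (1 : ℝ) with hb
  have cAv : ∀ v, ContinuousOn (fun x => Aop a (D x) (H x v)) Ω := fun v =>
    S.cAop hΩc (S.cHv hΩc v)
  have I : ∀ v : 𝔼, ∀ h : 𝔼 → ℝ, ∀ h' : 𝔼 → 𝔼, ContinuousOn h Ω → ContinuousOn h' Ω →
      IntegrableOn (fun x => h x * ⟪Aop a (D x) (H x v), gradient ζ x⟫ +
        ζ x * ⟪Aop a (D x) (H x v), h' x⟫) Ω := by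
    intro v h h' hc hc'
    refine Integrable.add ?_ (intc S.hΩ ((cAv v).inner hc') hζ)
    refine (intX S.hΩ (hc.smul (cAv v)) hζ).congr (ae_of_all _ (fun x => ?_))
    simp [inner_smul_left]
  have e1 : ∀ i, ∫ x in Ω, (⟪D x, b i⟫ * ⟪Aop a (D x) (H x (b i)), gradient ζ x⟫ +
      ζ x * ⟪Aop a (D x) (H x (b i)), H x (b i)⟫) =
      ∫ x in Ω, deriv f (u x) * ⟪D x, b i⟫ * (ζ x * ⟪D x, b i⟫) := fun i =>
    S.lin_mul (b i) (S.Wc1 (b i)) (fun x hx => S.Wgrad' (b i) hx) hζ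
  have e2 := S.lin_mul e S.swC1 (fun x hx => S.swgrad hx) hζ
  have sumD : ∀ x, ∑ i, ⟪D x, b i⟫ * ⟪D x, b i⟫ = ‖D x‖ ^ 2 := by
    intro x
    rw [← real_inner_self_eq_norm_sq, ← (EuclideanSpace.basisFun (Fin n) ℝ).sum_inner_mul_inner]
    refine Finset.sum_congr rfl (fun i _ => ?_)
    rw [real_inner_comm (D x) ((EuclideanSpace.basisFun (Fin n) ℝ) i)]
    simp [hb]
  have sumHD : ∀ x, ∑ i, ⟪D x, b i⟫ • H x (b i) = H x (D x) := by
    intro x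
    conv_rhs => rw [← (EuclideanSpace.basisFun (Fin n) ℝ).sum_repr' (D x)]
    rw [map_sum]
    refine Finset.sum_congr rfl (fun i _ => ?_)
    rw [map_smul, real_inner_comm]
    simp [hb]
  have hcf : ContinuousOn (fun x => deriv f (u x)) Ω :=
    (S.hf.continuous_deriv (by norm_num)).comp_continuousOn (S.hucl.mono hΩc)
  have s1 : ∫ x in Ω, (⟪Aop a (D x) (H x (D x)), gradient ζ x⟫ + ζ x * Nf a D H x) =
      ∫ x in Ω, deriv f (u x) * ‖D x‖ ^ 2 * ζ x := by
    have l : ∀ x, ⟪Aop a (D x) (H x (D x)), gradient ζ x⟫ + ζ x * Nf a D H x =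
      ∑ i, (⟪D x, b i⟫ * ⟪Aop a (D x) (H x (b i)), gradient ζ x⟫ +
      ζ x * ⟪Aop a (D x) (H x (b i)), H x (b i)⟫) := by
      intro x
      rw [Finset.sum_add_distrib, ← Finset.mul_sum]
      congr 1
      rw [← sumHD x, ← AL_apply, map_sum, sum_inner]
      refine Finset.sum_congr rfl (fun i _ => ?_)
      rw [map_smul, inner_smul_left, AL_apply]; simp
    have r : ∀ x, deriv f (u x) * ‖D x‖ ^ 2 * ζ x =
        ∑ i, deriv f (u x) * ⟪D x, b i⟫ * (ζ x * ⟪D x, b i⟫) := by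
      intro x
      rw [← sumD, Finset.mul_sum, Finset.sum_mul]
      refine Finset.sum_congr rfl (fun i _ => by ring)
    simp_rw [l, r]
    rw [integral_finsetSum, integral_finsetSum]
    · exact Finset.sum_congr rfl (fun i _ => e1 i)
    · intro i _
      have := intc S.hΩ (c := fun x => deriv f (u x) * ⟪D x, b i⟫ * ⟪D x, b i⟫)
        ((hcf.mul (S.Wc1 (b i)).continuousOn).mul (S.Wc1 (b i)).continuousOn) hζ
      refine this.congr (ae_of_all _ (fun x => ?_))
      simp only; ring
    · intro i _
      exact I (b i) _ _ (S.Wc1 (b i)).continuousOn (S.cHv hΩc (b i))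
  have s2 : ∫ x in Ω, deriv f (u x) * ⟪D x, e⟫ * (ζ x * (‖D x‖ ^ 2 / ⟪D x, e⟫)) =
      ∫ x in Ω, deriv f (u x) * ‖D x‖ ^ 2 * ζ x := by
    refine setIntegral_congr_fun S.hΩ.measurableSet (fun x hx => ?_)
    have := (S.wpos x hx).ne'
    field_simp
  rw [s2, ← s1] at e2
  have i1 : IntegrableOn (fun x => ⟪Aop a (D x) (H x (D x)), gradient ζ x⟫ + ζ x * Nf a D H x) Ω :=
    (intX S.hΩ (S.cAop hΩc (S.cHD hΩc)) hζ).add (intc S.hΩ (S.cN hΩc) hζ)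
  have i2 := I e _ _ S.swC1.continuousOn S.cgsw
  have e3 := sub_eq_zero.2 e2.symm
  rw [← integral_sub i1 i2] at e3
  rw [← integral_add (intc S.hΩ S.cq hζ) (intX S.hΩ S.cGΩ hζ), ← e3]
  refine integral_congr_ae (ae_of_all _ (fun x => ?_))
  simp only [qf, Gf, inner_sub_left, inner_smul_left, conj_trivial]
  ring

end Setup

/-- gradient of the modulus of the gradient -/
def gs (D : 𝔼 → 𝔼) (H : 𝔼 → 𝔼 →L[ℝ] 𝔼) (x : 𝔼) : 𝔼 := ‖D x‖⁻¹ • H x (D x)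

def gk (D : 𝔼 → 𝔼) (H : 𝔼 → 𝔼 →L[ℝ] 𝔼) (e x : 𝔼) : 𝔼 :=
  (⟪D x, e⟫)⁻¹ • gs D H x - (‖D x‖ / ⟪D x, e⟫ ^ 2) • H x e

def Qf (a : ℝ → ℝ) (D : 𝔼 → 𝔼) (H : 𝔼 → 𝔼 →L[ℝ] 𝔼) (x : 𝔼) : ℝ :=
  Nf a D H x - ⟪Aop a (D x) (gs D H x), gs D H x⟫

lemma Nf_tr (a : ℝ → ℝ) (D : 𝔼 → 𝔼) (H : 𝔼 → 𝔼 →L[ℝ] 𝔼) (x : 𝔼)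
    (hs : ∀ v w, ⟪H x v, w⟫ = ⟪v, H x w⟫) :
    Nf a D H x = tr ((AL a (D x)).comp ((H x).comp (H x))) := by
  have h1 : tr ((AL a (D x)).comp ((H x).comp (H x))) = tr ((H x).comp ((AL a (D x)).comp (H x))) := by
    unfold tr
    exact LinearMap.trace_mul_comm ℝ (((AL a (D x)).comp (H x) : 𝔼 →L[ℝ] 𝔼) : 𝔼 →ₗ[ℝ] 𝔼)
      ((H x : 𝔼 →L[ℝ] 𝔼) : 𝔼 →ₗ[ℝ] 𝔼)
  rw [h1, tr_eq_sum (EuclideanSpace.basisFun (Fin n) ℝ), Nf]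
  refine Finset.sum_congr rfl (fun i _ => ?_)
  simp only [EuclideanSpace.basisFun_apply, ContinuousLinearMap.comp_apply, AL_apply]
  rw [← hs, real_inner_comm]

lemma Qf_nonneg {a : ℝ → ℝ} (hapos : ∀ t ≥ (0 : ℝ), 0 < a t)
    (hlam : ∀ t ≥ (0 : ℝ), 0 < lam1 a t) (D : 𝔼 → 𝔼) (H : 𝔼 → 𝔼 →L[ℝ] 𝔼) (x : 𝔼)
    (hs : ∀ v w, ⟪H x v, w⟫ = ⟪v, H x w⟫) : 0 ≤ Qf a D H x := by
  unfold Qf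
  rw [Nf_tr a D H x hs, ← AL_apply, ← tr_rank_one, ← tr_sub, ← ContinuousLinearMap.comp_sub]
  refine tr_AL_nonneg hapos hlam (D x) (fun v => ?_)
  simp only [sub_apply, ContinuousLinearMap.comp_apply, ContinuousLinearMap.smulRight_apply,
    innerSL_apply_apply, inner_sub_left, inner_smul_left, conj_trivial]
  rw [hs, real_inner_self_eq_norm_sq]
  have h1 : ⟪gs D H x, v⟫ = ⟪‖D x‖⁻¹ • D x, H x v⟫ := by
    simp only [gs, inner_smul_left, hs]
  have h2 : ‖(‖D x‖⁻¹ • D x)‖ ≤ 1 := by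
    rw [norm_smul, norm_inv, norm_norm]; exact inv_mul_le_one
  have h3 := abs_real_inner_le_norm (‖D x‖⁻¹ • D x) (H x v)
  have h4 : |⟪gs D H x, v⟫| ≤ ‖H x v‖ := by
    rw [h1]; refine h3.trans ?_
    exact mul_le_of_le_one_left (norm_nonneg _) h2
  have h5 := sq_le_sq' (by linarith [neg_abs_le ⟪gs D H x, v⟫, norm_nonneg (H x v)])
    ((le_abs_self _).trans h4)
  nlinarith

lemma qf_eq (a : ℝ → ℝ) (D : 𝔼 → 𝔼) (H : 𝔼 → 𝔼 →L[ℝ] 𝔼) (e x : 𝔼) (hw : ⟪D x, e⟫ ≠ 0) :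
    qf a D H e x = Qf a D H x + ⟪D x, e⟫ ^ 2 * ⟪Aop a (D x) (gk D H e x), gk D H e x⟫ := by
  have hD : ‖D x‖ ≠ 0 := by
    rw [norm_ne_zero_iff]; intro h; apply hw; simp [h]
  have hsym : ⟪Aop a (D x) (H x (D x)), H x e⟫ = ⟪Aop a (D x) (H x e), H x (D x)⟫ := by
    rw [inner_Aop_symm, real_inner_comm]
  unfold qf Qf gk gs gsw
  simp only [sub_eq_add_neg, ← neg_smul, Aop_add, Aop_smul, inner_add_left, inner_add_right, inner_smul_left,
    inner_smul_right, conj_trivial, hsym]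
  field_simp
  ring

lemma qf_nonneg {a : ℝ → ℝ} (hapos : ∀ t ≥ (0 : ℝ), 0 < a t)
    (hlam : ∀ t ≥ (0 : ℝ), 0 < lam1 a t) (D : 𝔼 → 𝔼) (H : 𝔼 → 𝔼 →L[ℝ] 𝔼) (e x : 𝔼)
    (hw : ⟪D x, e⟫ ≠ 0) (hs : ∀ v w, ⟪H x v, w⟫ = ⟪v, H x w⟫) : 0 ≤ qf a D H e x := by
  rw [qf_eq a D H e x hw]
  exact add_nonneg (Qf_nonneg hapos hlam D H x hs)
    (mul_nonneg (sq_nonneg _) (inner_Aop_nonneg hapos hlam _ _))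

lemma expand (a : ℝ → ℝ) (D : 𝔼 → 𝔼) (H : 𝔼 → 𝔼 →L[ℝ] 𝔼) (e x : 𝔼) (hw : ⟪D x, e⟫ ≠ 0)
    (φ : ℝ) (g : 𝔼) :
    ⟪D x, e⟫ ^ 2 * ⟪Aop a (D x) (φ • gk D H e x + (‖D x‖ / ⟪D x, e⟫) • g),
      φ • gk D H e x + (‖D x‖ / ⟪D x, e⟫) • g⟫ =
    ‖D x‖ ^ 2 * ⟪Aop a (D x) g, g⟫ + ⟪Gf a D H e x, (2 * φ) • g⟫ +
      φ ^ 2 * (qf a D H e x - Qf a D H x) := by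
  have hD : ‖D x‖ ≠ 0 := by
    rw [norm_ne_zero_iff]; intro h; apply hw; simp [h]
  rw [qf_eq a D H e x hw]
  have hG : Gf a D H e x = (‖D x‖ * ⟪D x, e⟫) • Aop a (D x) (gk D H e x) := by
    unfold Gf gk gs
    rw [sub_eq_add_neg _ ((‖D x‖ / ⟪D x, e⟫ ^ 2) • H x e), ← neg_smul, Aop_add, Aop_smul, Aop_smul,
      Aop_smul, smul_add, smul_smul, smul_smul, smul_smul, sub_eq_add_neg, ← neg_smul]
    congr 1
    · rw [show ‖D x‖ * ⟪D x, e⟫ * (⟪D x, e⟫)⁻¹ * ‖D x‖⁻¹ = 1 by field_simp, one_smul]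
    · congr 1
      field_simp
  rw [hG]
  have hsym : ⟪Aop a (D x) g, gk D H e x⟫ = ⟪Aop a (D x) (gk D H e x), g⟫ := by
    rw [inner_Aop_symm, real_inner_comm]
  simp only [Aop_add, Aop_smul, inner_add_left, inner_add_right, inner_smul_left,
    inner_smul_right, conj_trivial, hsym]
  field_simp
  ring

lemma Qf_formula (a : ℝ → ℝ) (D : 𝔼 → 𝔼) (H : 𝔼 → 𝔼 →L[ℝ] 𝔼) (x : 𝔼) (hD0 : D x ≠ 0)
    (hs : ∀ v w, ⟪H x v, w⟫ = ⟪v, H x w⟫) :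
    lam1 a ‖D x‖ * ‖gs D H x - ⟪gs D H x, ‖D x‖⁻¹ • D x⟫ • (‖D x‖⁻¹ • D x)‖ ^ 2 +
      lam2 a ‖D x‖ * (∑ i : Fin n, ‖H x (EuclideanSpace.single i (1 : ℝ))‖ ^ 2 - ‖gs D H x‖ ^ 2 -
        ‖gs D H x - ⟪gs D H x, ‖D x‖⁻¹ • D x⟫ • (‖D x‖⁻¹ • D x)‖ ^ 2) = Qf a D H x := by
  have hD : ‖D x‖ ≠ 0 := norm_ne_zero_iff.2 hD0
  have hN : Nf a D H x = a ‖D x‖ * ∑ i : Fin n, ‖H x (EuclideanSpace.single i (1 : ℝ))‖ ^ 2 +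
      deriv a ‖D x‖ / ‖D x‖ * ‖H x (D x)‖ ^ 2 := by
    unfold Nf
    simp_rw [inner_Aop]
    rw [Finset.sum_add_distrib, ← Finset.mul_sum, ← Finset.mul_sum]
    congr 1
    · congr 1
      exact Finset.sum_congr rfl (fun i _ => by rw [real_inner_self_eq_norm_sq])
    · congr 1
      rw [← real_inner_self_eq_norm_sq, ← (EuclideanSpace.basisFun (Fin n) ℝ).sum_inner_mul_inner]
      refine Finset.sum_congr rfl (fun i _ => ?_)
      rw [← hs (D x)]
      rw [real_inner_comm (H x (D x)) ((EuclideanSpace.basisFun (Fin n) ℝ) i)]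
      simp only [EuclideanSpace.basisFun_apply]
  have hT : ‖gs D H x - ⟪gs D H x, ‖D x‖⁻¹ • D x⟫ • (‖D x‖⁻¹ • D x)‖ ^ 2 =
      ‖gs D H x‖ ^ 2 - (‖D x‖⁻¹ * ⟪gs D H x, D x⟫) ^ 2 := by
    rw [norm_sub_sq_real, norm_smul, norm_smul, inner_smul_right, inner_smul_right, norm_inv, norm_norm,
      inv_mul_cancel₀ hD, mul_one, Real.norm_eq_abs, sq_abs]
    ring
  have hg : ‖gs D H x‖ ^ 2 = (‖D x‖⁻¹) ^ 2 * ‖H x (D x)‖ ^ 2 := by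
    rw [gs, norm_smul, mul_pow, norm_inv, norm_norm]
  unfold Qf
  rw [hT, hN, inner_Aop, real_inner_self_eq_norm_sq, hg, real_inner_comm (gs D H x) (D x)]
  simp only [lam1, lam2]
  field_simp
  ring

/-- a local defining function of the domain -/
structure Chart (Ω : Set 𝔼) (V : Set 𝔼) (g : 𝔼 → ℝ) : Prop where
  hV : IsOpen V
  hg : ContDiffOn ℝ 2 g V
  hne : ∀ x ∈ V, gradient g x ≠ 0
  hΩV : Ω ∩ V = {x ∈ V | g x < 0}

lemma Chart.mem_iff {Ω V : Set 𝔼} {g : 𝔼 → ℝ} (c : Chart Ω V g) {x : 𝔼} (hx : x ∈ V) :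
    x ∈ Ω ↔ g x < 0 := by
  have := c.hΩV
  constructor
  · intro h
    have h1 : x ∈ Ω ∩ V := ⟨h, hx⟩
    rw [this] at h1; exact h1.2
  · intro h
    have h1 : x ∈ {x ∈ V | g x < 0} := ⟨hx, h⟩
    rw [← this] at h1; exact h1.1

lemma Chart.cont {Ω V : Set 𝔼} {g : 𝔼 → ℝ} (c : Chart Ω V g) {x : 𝔼} (hx : x ∈ V) :
    ContinuousAt g x := c.hg.continuousOn.continuousAt (c.hV.mem_nhds hx)

lemma Chart.grad {Ω V : Set 𝔼} {g : 𝔼 → ℝ} (c : Chart Ω V g) {x : 𝔼} (hx : x ∈ V) :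
    HasGradientAt g (gradient g x) x :=
  ((c.hg.contDiffAt (c.hV.mem_nhds hx)).differentiableAt (by norm_num)).hasGradientAt

lemma Chart.grad_cont {Ω V : Set 𝔼} {g : 𝔼 → ℝ} (c : Chart Ω V g) :
    ContinuousOn (gradient g) V := by
  have h1 : ContinuousOn (fderiv ℝ g) V := c.hg.continuousOn_fderiv_of_isOpen c.hV (by norm_num)
  exact (InnerProductSpace.toDual ℝ 𝔼).symm.continuous.comp_continuousOn h1

lemma Chart.zero {Ω V : Set 𝔼} {g : 𝔼 → ℝ} (c : Chart Ω V g) (hΩ : IsOpen Ω) {x : 𝔼} (hx : x ∈ V)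
    (hf : x ∈ frontier Ω) : g x = 0 := by
  rw [hΩ.frontier_eq] at hf
  apply le_antisymm
  · by_contra h
    push Not at h
    have h1 : ∀ᶠ y in 𝓝 x, 0 < g y := (c.cont hx).eventually (lt_mem_nhds h)
    have h2 := h1.and (c.hV.mem_nhds hx)
    obtain ⟨y, hy, hy2⟩ := (mem_closure_iff_nhds.1 hf.1 _ h2)
    have := (c.mem_iff hy.2).1 hy2
    linarith [hy.1]
  · by_contra h
    push Not at h
    exact hf.2 ((c.mem_iff hx).2 h)

lemma Chart.deriv_line {Ω V : Set 𝔼} {g : 𝔼 → ℝ} (c : Chart Ω V g) (x v : 𝔼) (s : ℝ)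
    (hx : x + s • v ∈ V) : HasDerivAt (fun s : ℝ => g (x + s • v)) ⟪gradient g (x + s • v), v⟫ s := by
  have h1 := (c.grad hx).hasFDerivAt
  have h2 : HasDerivAt (fun s : ℝ => x + s • v) v s := by
    simpa using ((hasDerivAt_id s).smul_const v).const_add x
  exact (h1.comp_hasDerivAt s h2).congr_deriv (by simp)

lemma Chart.vert {Ω V : Set 𝔼} {g : 𝔼 → ℝ} (c : Chart Ω V g) (hΩ : IsOpen Ω) {q : 𝔼} (hq : q ∈ V)
    (hf : q ∈ frontier Ω) {ρ : ℝ} (hρ : 0 < ρ) :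
    ∃ r > 0, r ≤ ρ ∧ ball q r ⊆ V ∧ ∀ x ∈ ball q r, x ∈ Ω → ∃ τ > 0,
      τ * (‖gradient g q‖ ^ 2 / 2) ≤ - g x ∧ x + τ • gradient g q ∈ frontier Ω ∧
      (∀ s ∈ Icc 0 τ, x + s • gradient g q ∈ ball q ρ) ∧
      (∀ s ∈ Ico 0 τ, x + s • gradient g q ∈ Ω) := by
  set N := gradient g q with hN
  have hN0 : 0 < ‖N‖ := norm_pos_iff.2 (c.hne q hq)
  have h1 : ∀ᶠ x in 𝓝 q, ‖N‖ ^ 2 / 2 < ⟪gradient g x, N⟫ := by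
    have : ContinuousAt (fun x => ⟪gradient g x, N⟫) q :=
      (c.grad_cont.continuousAt (c.hV.mem_nhds hq)).inner continuousAt_const
    refine this.eventually (lt_mem_nhds ?_)
    show ‖N‖ ^ 2 / 2 < ⟪N, N⟫
    rw [real_inner_self_eq_norm_sq]
    nlinarith
  obtain ⟨ρ1, hρ1, hb⟩ := Metric.eventually_nhds_iff_ball.1 (h1.and (c.hV.mem_nhds hq))
  set ρ' := min ρ1 ρ with hρ'
  have hρ'0 : 0 < ρ' := lt_min hρ1 hρ
  set T := ρ' / (2 * ‖N‖) with hT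
  have hT0 : 0 < T := by positivity
  have hTN : T * ‖N‖ = ρ' / 2 := by rw [hT]; field_simp
  have h2 : ∀ᶠ x in 𝓝 q, - (T * (‖N‖ ^ 2 / 2)) < g x := by
    refine (c.cont hq).eventually (lt_mem_nhds ?_)
    rw [c.zero hΩ hq hf]
    have : 0 < T * (‖N‖ ^ 2 / 2) := by positivity
    linarith
  obtain ⟨r1, hr1, hb1⟩ := Metric.eventually_nhds_iff_ball.1 h2
  have hle : ρ' ≤ ρ := min_le_right _ _
  have hle1 : ρ' ≤ ρ1 := min_le_left _ _
  have hrl : min r1 (ρ' / 2) ≤ ρ' / 2 := min_le_right _ _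
  refine ⟨min r1 (ρ' / 2), by positivity, by linarith, ?_, ?_⟩
  · intro x hx
    exact (hb x (ball_subset_ball (by linarith) hx)).2
  intro x hx hxΩ
  have hball : ∀ s ∈ Icc 0 T, x + s • N ∈ ball q ρ' := by
    intro s hs
    rw [mem_ball, dist_eq_norm] at hx ⊢
    have e1 : x + s • N - q = (x - q) + s • N := by abel
    rw [e1]
    refine (norm_add_le _ _).trans_lt ?_
    rw [norm_smul, Real.norm_eq_abs, abs_of_nonneg hs.1]
    have : s * ‖N‖ ≤ T * ‖N‖ := mul_le_mul_of_nonneg_right hs.2 hN0.le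
    linarith
  have hd : ∀ s ∈ Icc 0 T, HasDerivAt (fun s : ℝ => g (x + s • N)) ⟪gradient g (x + s • N), N⟫ s :=
    fun s hs => c.deriv_line x N s (hb _ (ball_subset_ball hle1 (hball s hs))).2
  have hcon : ContinuousOn (fun s : ℝ => g (x + s • N)) (Icc 0 T) :=
    fun s hs => (hd s hs).continuousAt.continuousWithinAt
  have hslope : ∀ s ∈ Icc 0 T, ∀ t ∈ Icc 0 T, s ≤ t →
      ‖N‖ ^ 2 / 2 * (t - s) ≤ g (x + t • N) - g (x + s • N) := by
    refine Convex.mul_sub_le_image_sub_of_le_deriv (convex_Icc 0 T) hcon ?_ ?_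
    · intro s hs
      exact (hd s (interior_subset hs)).differentiableAt.differentiableWithinAt
    · intro s hs
      rw [(hd s (interior_subset hs)).deriv]
      exact (hb _ (ball_subset_ball hle1 (hball s (interior_subset hs)))).1.le
  have hxV : x ∈ V := (hb x (ball_subset_ball (by linarith) hx)).2
  have hg0 : g x < 0 := (c.mem_iff hxV).1 hxΩ
  have hgT : 0 < g (x + T • N) := by
    have := hslope 0 ⟨le_rfl, hT0.le⟩ T ⟨hT0.le, le_rfl⟩ hT0.le
    have h3 := hb1 x (ball_subset_ball (min_le_left _ _) hx)
    simp only [zero_smul, add_zero] at this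
    linarith
  have hiv := intermediate_value_Ioo hT0.le hcon
  obtain ⟨τ, hτ, hτ0⟩ := hiv (show (0 : ℝ) ∈ Ioo _ _ from ⟨by simpa using hg0, hgT⟩)
  simp only at hτ0
  have hτI : τ ∈ Icc 0 T := Ioo_subset_Icc_self hτ
  have hyV : x + τ • N ∈ V := (hb _ (ball_subset_ball hle1 (hball τ hτI))).2
  have hin : ∀ s ∈ Ico 0 τ, x + s • N ∈ Ω := by
    intro s hs
    have hsI : s ∈ Icc 0 T := ⟨hs.1, hs.2.le.trans hτ.2.le⟩
    rw [c.mem_iff (hb _ (ball_subset_ball hle1 (hball s hsI))).2]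
    have := hslope s hsI τ hτI hs.2.le
    have h4 : 0 < ‖N‖ ^ 2 / 2 * (τ - s) := mul_pos (by positivity) (by linarith [hs.2])
    linarith
  refine ⟨τ, hτ.1, ?_, ?_, ?_, hin⟩
  · have := hslope 0 ⟨le_rfl, hT0.le⟩ τ hτI hτ.1.le
    simp only [zero_smul, add_zero] at this
    linarith
  · rw [hΩ.frontier_eq]
    refine ⟨?_, fun h => ?_⟩
    · have ht : Tendsto (fun s : ℝ => x + s • N) (𝓝[<] τ) (𝓝 (x + τ • N)) := by
        refine Tendsto.mono_left ?_ nhdsWithin_le_nhds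
        exact (by fun_prop : Continuous (fun s : ℝ => x + s • N)).tendsto τ
      refine mem_closure_of_tendsto ht ?_
      filter_upwards [Ioo_mem_nhdsLT hτ.1] with s hs
      exact hin s ⟨hs.1.le, hs.2⟩
    · have := (c.mem_iff hyV).1 h
      linarith
  · intro s hs
    exact ball_subset_ball hle (hball s ⟨hs.1, hs.2.trans hτ.2.le⟩)

lemma mvt_seg {Ω : Set 𝔼} {F : 𝔼 → ℝ} {DF : 𝔼 → 𝔼} (hF : ContinuousOn F (closure Ω))
    (hDF : ∀ x ∈ Ω, HasGradientAt F (DF x) x) (p d : 𝔼) {T : ℝ} (hT : 0 < T)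
    (h0 : p ∈ closure Ω) (h1 : p + T • d ∈ closure Ω) (h : ∀ s ∈ Ioo 0 T, p + s • d ∈ Ω) :
    ∃ s ∈ Ioo 0 T, F (p + T • d) - F p = T * ⟪DF (p + s • d), d⟫ := by
  have hm : ∀ s ∈ Icc 0 T, p + s • d ∈ closure Ω := by
    intro s hs
    rcases eq_or_lt_of_le hs.1 with h2 | h2
    · rw [← h2]; simpa using h0
    rcases eq_or_lt_of_le hs.2 with h3 | h3
    · rw [h3]; exact h1
    exact subset_closure (h s ⟨h2, h3⟩)
  obtain ⟨s, hs, h2⟩ := exists_hasDerivAt_eq_slope (fun s : ℝ => F (p + s • d))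
    (fun s => ⟪DF (p + s • d), d⟫) hT
    (hF.comp (by fun_prop : Continuous (fun s : ℝ => p + s • d)).continuousOn hm)
    (fun s hs => by
      have h2 : HasDerivAt (fun s : ℝ => p + s • d) d s := by
        simpa using ((hasDerivAt_id s).smul_const d).const_add p
      exact ((hDF _ (h s hs)).hasFDerivAt.comp_hasDerivAt s h2).congr_deriv (by simp))
  refine ⟨s, hs, ?_⟩
  rw [h2]
  simp only [zero_smul, add_zero, sub_zero]
  field_simp

lemma Chart.tang {Ω V : Set 𝔼} {g : 𝔼 → ℝ} (c : Chart Ω V g) (hΩ : IsOpen Ω) {q : 𝔼} (hq : q ∈ V)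
    (hf : q ∈ frontier Ω) {F : 𝔼 → ℝ} {DF : 𝔼 → 𝔼} (hF : ContinuousOn F (closure Ω))
    (hDFc : ContinuousOn DF (closure Ω))
    (hDF : ∀ x ∈ Ω, HasGradientAt F (DF x) x)
    (hlc : ∀ᶠ y in 𝓝 q, y ∈ frontier Ω → F y = F q) :
    ∃ k : ℝ, DF q = k • gradient g q := by
  set N := gradient g q with hN
  have hN0 : 0 < ‖N‖ := norm_pos_iff.2 (c.hne q hq)
  have hqc : q ∈ closure Ω := frontier_subset_closure hf
  suffices hX : ∀ X, ⟪N, X⟫ = 0 → ⟪DF q, X⟫ = 0 by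
    refine ⟨⟪DF q, N⟫ / ‖N‖ ^ 2, ?_⟩
    set X := DF q - (⟪DF q, N⟫ / ‖N‖ ^ 2) • N with hXdef
    have h1 : ⟪N, X⟫ = 0 := by
      rw [hXdef, inner_sub_right, inner_smul_right, real_inner_self_eq_norm_sq, real_inner_comm]
      field_simp; ring
    have h2 := hX X h1
    have h3 : ⟪X, X⟫ = 0 := by
      nth_rewrite 1 [hXdef]
      rw [inner_sub_left, inner_smul_left, h1, h2]; simp
    rw [inner_self_eq_zero] at h3
    exact sub_eq_zero.1 h3
  intro X hX
  -- bound for `DF` near `q`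
  obtain ⟨M, hM0, ρ, hρ, hM⟩ : ∃ M > 0, ∃ ρ > 0, ∀ x ∈ ball q ρ, x ∈ closure Ω →
      ‖DF x‖ ≤ M ∧ (x ∈ frontier Ω → F x = F q) := by
    have h1 : ∀ᶠ x in 𝓝[closure Ω] q, ‖DF x‖ < ‖DF q‖ + 1 :=
      (hDFc q hqc).norm.eventually (gt_mem_nhds (by linarith))
    rw [eventually_nhdsWithin_iff] at h1
    obtain ⟨ρ, hρ, hb⟩ := Metric.eventually_nhds_iff_ball.1 (h1.and hlc)
    exact ⟨‖DF q‖ + 1, by positivity, ρ, hρ, fun x hx hx2 => ⟨((hb x hx).1 hx2).le, (hb x hx).2⟩⟩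
  obtain ⟨r, hr, hrρ, hrV, hvert⟩ := c.vert hΩ hq hf hρ
  have key : ∀ κ : ℝ, 0 < κ → |⟪DF q, X - κ • N⟫| ≤ 4 * κ * M * ‖N‖ := by
    intro κ hκ
    set d := X - κ • N with hd
    have hder := c.deriv_line q d 0 (by simpa using hq)
    simp only [zero_smul, add_zero] at hder
    have hval : ⟪gradient g q, d⟫ = - (κ * ‖N‖ ^ 2) := by
      rw [← hN, hd, inner_sub_right, hX, inner_smul_right, real_inner_self_eq_norm_sq]; ring
    rw [hval] at hder
    have hlim := hder.tendsto_slope_zero_right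
    simp only [zero_add, zero_smul, add_zero, c.zero hΩ hq hf, sub_zero, smul_eq_mul] at hlim
    have hpos : 0 < κ * ‖N‖ ^ 2 := by positivity
    have ev1 : ∀ᶠ t in 𝓝[>] (0 : ℝ), t⁻¹ * g (q + t • d) < 0 :=
      hlim.eventually (gt_mem_nhds (by linarith))
    have ev2 : ∀ᶠ t in 𝓝[>] (0 : ℝ), - (2 * (κ * ‖N‖ ^ 2)) < t⁻¹ * g (q + t • d) :=
      hlim.eventually (lt_mem_nhds (by linarith))
    have hcd : Tendsto (fun t : ℝ => q + t • d) (𝓝[>] 0) (𝓝 q) := by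
      have : Tendsto (fun t : ℝ => q + t • d) (𝓝 0) (𝓝 (q + (0 : ℝ) • d)) :=
        (by fun_prop : Continuous (fun t : ℝ => q + t • d)).tendsto 0
      simp only [zero_smul, add_zero] at this
      exact this.mono_left nhdsWithin_le_nhds
    have ev3 : ∀ᶠ t in 𝓝[>] (0 : ℝ), q + t • d ∈ ball q r := hcd.eventually (ball_mem_nhds q hr)
    have hall := (ev1.and ev2).and ev3
    rw [eventually_nhdsWithin_iff, Metric.eventually_nhds_iff_ball] at hall
    obtain ⟨t0, ht0, hall⟩ := hall
    have hall' : ∀ t ∈ Ioo 0 t0, q + t • d ∈ Ω ∧ - g (q + t • d) ≤ 2 * (κ * ‖N‖ ^ 2) * t ∧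
        q + t • d ∈ ball q r := by
      intro t ht
      have h1 := hall t (by rw [mem_ball, dist_zero_right, Real.norm_eq_abs, abs_of_pos ht.1]; exact ht.2) ht.1
      refine ⟨?_, ?_, h1.2⟩
      · rw [c.mem_iff (hrV h1.2)]
        have h2 := h1.1.1
        have := (mul_neg_iff.1 h2).resolve_right (fun h => by
          have := inv_pos.2 ht.1; linarith [h.1])
        exact this.2
      · have h2 := h1.1.2
        have h3 := mul_lt_mul_of_pos_left h2 ht.1
        rw [mul_inv_cancel_left₀ ht.1.ne'] at h3
        linarith
    -- for every small `t` there is a point in the segment where the estimate holds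
    have hest : ∀ t ∈ Ioo 0 t0, ∃ s ∈ Ioo 0 t, |⟪DF (q + s • d), d⟫| ≤ 4 * κ * M * ‖N‖ := by
      intro t ht
      obtain ⟨hz, hgz, hzr⟩ := hall' t ht
      obtain ⟨s, hs, hs1⟩ := mvt_seg hF hDF q d ht.1 hqc (subset_closure hz)
        (fun s hs => (hall' s ⟨hs.1, hs.2.trans ht.2⟩).1)
      refine ⟨s, hs, ?_⟩
      obtain ⟨τ, hτ, hτ1, hy, hyb, hyΩ⟩ := hvert _ hzr hz
      rw [← hN] at hτ1 hy hyb hyΩ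
      obtain ⟨s', hs', hs2⟩ := mvt_seg hF hDF (q + t • d) N hτ (subset_closure hz)
        (frontier_subset_closure hy) (fun s hs => hyΩ s ⟨hs.1.le, hs.2⟩)
      rw [(hM _ (hyb τ ⟨hτ.le, le_rfl⟩) (frontier_subset_closure hy)).2 hy] at hs2
      have h5 := (hM _ (hyb s' ⟨hs'.1.le, hs'.2.le⟩) (subset_closure (hyΩ s' ⟨hs'.1.le, hs'.2⟩))).1
      have h6 : |⟪DF (q + t • d + s' • N), N⟫| ≤ M * ‖N‖ :=
        (abs_real_inner_le_norm _ _).trans (by gcongr)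
      have h7 : t * |⟪DF (q + s • d), d⟫| = τ * |⟪DF (q + t • d + s' • N), N⟫| := by
        have e1 := abs_mul t ⟪DF (q + s • d), d⟫
        have e2 := abs_mul τ ⟪DF (q + t • d + s' • N), N⟫
        rw [abs_of_pos ht.1] at e1
        rw [abs_of_pos hτ] at e2
        rw [← e1, ← e2, ← hs1, ← hs2, abs_sub_comm]
      have h8 : τ ≤ 4 * κ * t := by
        have : τ * (‖N‖ ^ 2 / 2) ≤ 4 * κ * t * (‖N‖ ^ 2 / 2) := by linarith
        exact le_of_mul_le_mul_right this (by positivity)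
      have h9 : t * |⟪DF (q + s • d), d⟫| ≤ t * (4 * κ * M * ‖N‖) := by
        rw [h7]
        calc _ ≤ (4 * κ * t) * (M * ‖N‖) :=
              mul_le_mul h8 h6 (abs_nonneg _) (hτ.le.trans h8)
          _ = _ := by ring
      exact le_of_mul_le_mul_left h9 ht.1
    -- pass to the limit
    by_contra hcon
    push Not at hcon
    have hT : Tendsto (fun s : ℝ => |⟪DF (q + s • d), d⟫|) (𝓝[Ioo 0 t0] 0) (𝓝 |⟪DF q, d⟫|) := by
      have h1 : Tendsto (fun s : ℝ => q + s • d) (𝓝[Ioo 0 t0] 0) (𝓝[closure Ω] q) := by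
        refine tendsto_nhdsWithin_iff.2 ⟨hcd.mono_left (nhdsWithin_mono _ Ioo_subset_Ioi_self), ?_⟩
        filter_upwards [self_mem_nhdsWithin] with s hs
        exact subset_closure (hall' s hs).1
      have h2 : Tendsto DF (𝓝[closure Ω] q) (𝓝 (DF q)) := hDFc q hqc
      exact ((h2.comp h1).inner tendsto_const_nhds).abs
    have h3 := hT.eventually (lt_mem_nhds hcon)
    rw [eventually_nhdsWithin_iff, Metric.eventually_nhds_iff_ball] at h3
    obtain ⟨ε, hε, h3⟩ := h3
    obtain ⟨s, hs, hs1⟩ := hest (min ε t0 / 2) ⟨by positivity, by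
      have := min_le_right ε t0; linarith⟩
    have h4 := h3 s (by
      rw [mem_ball, dist_zero_right, Real.norm_eq_abs, abs_of_pos hs.1]
      have := min_le_left ε t0; linarith [hs.2]) ⟨hs.1, by
      have := min_le_right ε t0; linarith [hs.2]⟩
    linarith
  -- let `κ → 0`
  have hl : Tendsto (fun κ : ℝ => |⟪DF q, X - κ • N⟫|) (𝓝[>] 0) (𝓝 |⟪DF q, X - (0 : ℝ) • N⟫|) :=
    ((by fun_prop : Continuous (fun κ : ℝ => |⟪DF q, X - κ • N⟫|)).tendsto 0).mono_left nhdsWithin_le_nhds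
  have hr' : Tendsto (fun κ : ℝ => 4 * κ * M * ‖N‖) (𝓝[>] 0) (𝓝 (4 * 0 * M * ‖N‖)) :=
    ((by fun_prop : Continuous (fun κ : ℝ => 4 * κ * M * ‖N‖)).tendsto 0).mono_left nhdsWithin_le_nhds
  have := le_of_tendsto_of_tendsto hl hr' (by
    filter_upwards [self_mem_nhdsWithin] with κ hκ
    exact key κ hκ)
  simp only [zero_smul, sub_zero, mul_zero, zero_mul] at this
  exact abs_nonpos_iff.1 this

lemma hasGrad_of_innerSL {F : 𝔼 → ℝ} {v x : 𝔼} (h : HasFDerivAt F (innerSL ℝ v) x) :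
    HasGradientAt F v x := by
  rw [hasGradientAt_iff_hasFDerivAt]
  exact h.congr_fderiv (by ext w; simp)

lemma Chart.interior_ball {Ω V : Set 𝔼} {g : 𝔼 → ℝ} (c : Chart Ω V g) (hΩ : IsOpen Ω) {q : 𝔼}
    (hq : q ∈ V) (hf : q ∈ frontier Ω) :
    ∃ R > 0, ball (q - R • gradient g q) (R * ‖gradient g q‖) ⊆ Ω := by
  set N := gradient g q with hN
  have hN0 : 0 < ‖N‖ := norm_pos_iff.2 (c.hne q hq)
  have hC1 : ContDiffAt ℝ 1 (gradient g) q := by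
    have h1 : ContDiffAt ℝ 1 (fderiv ℝ g) q :=
      (c.hg.contDiffAt (c.hV.mem_nhds hq)).fderiv_right (by norm_num)
    exact (InnerProductSpace.toDual ℝ 𝔼).symm.contDiff.contDiffAt.comp q h1
  obtain ⟨L, t, ht, hL⟩ := hC1.exists_lipschitzOnWith
  obtain ⟨ρ, hρ, hb⟩ := Metric.mem_nhds_iff.1 (inter_mem ht (c.hV.mem_nhds hq))
  have hquad : ∀ x ∈ ball q ρ, g x ≤ ⟪N, x - q⟫ + L * ‖x - q‖ ^ 2 := by
    intro x hx
    have hseg : ∀ s ∈ Icc (0 : ℝ) 1, q + s • (x - q) ∈ ball q ρ := by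
      intro s hs
      rw [mem_ball, dist_eq_norm] at hx ⊢
      rw [add_sub_cancel_left, norm_smul, Real.norm_eq_abs, abs_of_nonneg hs.1]
      exact (mul_le_of_le_one_left (norm_nonneg _) hs.2).trans_lt hx
    have hd : ∀ s ∈ Icc (0 : ℝ) 1, HasDerivAt (fun s : ℝ => g (q + s • (x - q)))
        ⟪gradient g (q + s • (x - q)), x - q⟫ s :=
      fun s hs => c.deriv_line q (x - q) s (hb (hseg s hs)).2
    obtain ⟨s, hs, h2⟩ := exists_hasDerivAt_eq_slope (fun s : ℝ => g (q + s • (x - q)))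
      (fun s => ⟪gradient g (q + s • (x - q)), x - q⟫) zero_lt_one
      (fun s hs => (hd s hs).continuousAt.continuousWithinAt)
      (fun s hs => hd s (Ioo_subset_Icc_self hs))
    simp only [zero_smul, add_zero, one_smul, add_sub_cancel, sub_zero, div_one,
      c.zero hΩ hq hf] at h2
    rw [← h2]
    have h3 : ⟪gradient g (q + s • (x - q)), x - q⟫ = ⟪N, x - q⟫ +
        ⟪gradient g (q + s • (x - q)) - N, x - q⟫ := by rw [inner_sub_left]; ring
    rw [h3]
    have hsI := Ioo_subset_Icc_self hs
    have h4 : ‖gradient g (q + s • (x - q)) - N‖ ≤ L * ‖x - q‖ := by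
      have := hL.norm_sub_le (hb (hseg s hsI)).1 (hb (mem_ball_self hρ)).1
      rw [add_sub_cancel_left, norm_smul, Real.norm_eq_abs, abs_of_nonneg hsI.1] at this
      refine this.trans ?_
      gcongr
      exact mul_le_of_le_one_left (norm_nonneg _) hsI.2
    have h5 := real_inner_le_norm (gradient g (q + s • (x - q)) - N) (x - q)
    have h6 : ‖gradient g (q + s • (x - q)) - N‖ * ‖x - q‖ ≤ L * ‖x - q‖ * ‖x - q‖ := by gcongr
    nlinarith
  set R := min (ρ / (2 * ‖N‖)) (1 / (2 * (L + 1))) with hR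
  have hR0 : 0 < R := by positivity
  have hR1 : R * ‖N‖ ≤ ρ / 2 := by
    calc R * ‖N‖ ≤ ρ / (2 * ‖N‖) * ‖N‖ := by gcongr; exact min_le_left _ _
      _ = ρ / 2 := by field_simp
  have hR2 : 2 * R * (L + 1) ≤ 1 := by
    calc 2 * R * (L + 1) ≤ 2 * (1 / (2 * (L + 1))) * (L + 1) := by gcongr; exact min_le_right _ _
      _ = 1 := by field_simp
  refine ⟨R, hR0, fun x hx => ?_⟩
  rw [mem_ball, dist_eq_norm] at hx
  have e1 : x - (q - R • N) = (x - q) + R • N := by abel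
  rw [e1] at hx
  have hxq : x ∈ ball q ρ := by
    rw [mem_ball, dist_eq_norm]
    have h1 : x - q = ((x - q) + R • N) - R • N := by abel
    rw [h1]
    refine (norm_sub_le _ _).trans_lt ?_
    rw [norm_smul, Real.norm_eq_abs, abs_of_pos hR0]
    linarith
  have h2 := pow_lt_pow_left₀ hx (norm_nonneg _) two_ne_zero
  rw [norm_add_sq_real, norm_smul, Real.norm_eq_abs, abs_of_pos hR0, inner_smul_right,
    real_inner_comm] at h2
  have h3 : ‖x - q‖ ^ 2 + 2 * R * ⟪N, x - q⟫ < 0 := by linarith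
  rw [c.mem_iff (hb hxq).2]
  have h4 := hquad x hxq
  have h5 : 2 * R * g x < 0 := by
    have : 2 * R * g x ≤ 2 * R * (⟪N, x - q⟫ + L * ‖x - q‖ ^ 2) := by gcongr
    have h6 : 2 * R * (L + 1) * ‖x - q‖ ^ 2 ≤ 1 * ‖x - q‖ ^ 2 := by gcongr
    have h7 : 0 ≤ R * ‖x - q‖ ^ 2 := by positivity
    nlinarith
  by_contra hcon
  push Not at hcon
  have : 0 ≤ 2 * R * g x := by positivity
  linarith

namespace Setup
variable {Ω : Set (EuclideanSpace ℝ (Fin n))} {a f : ℝ → ℝ} {u : EuclideanSpace ℝ (Fin n) → ℝ}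
  {D : EuclideanSpace ℝ (Fin n) → EuclideanSpace ℝ (Fin n)}
  {H : EuclideanSpace ℝ (Fin n) → EuclideanSpace ℝ (Fin n) →L[ℝ] EuclideanSpace ℝ (Fin n)}
  {e : EuclideanSpace ℝ (Fin n)}

lemma cW (S : Setup Ω a f u D H e) (v : 𝔼) : ContinuousOn (fun x => ⟪D x, v⟫) (closure Ω) :=
  S.hDcl.inner continuousOn_const

lemma bdry_hopf (S : Setup Ω a f u D H e) {V : Set 𝔼} {g : 𝔼 → ℝ} (c : Chart Ω V g) {q : 𝔼}
    (hq : q ∈ V) (hf : q ∈ frontier Ω) (hw : ⟪D q, e⟫ = 0) : ⟪H q e, gradient g q⟫ < 0 := by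
  obtain ⟨R, hR, hB⟩ := c.interior_ball S.hΩ hq hf
  set N := gradient g q with hN
  have hN0 : 0 < ‖N‖ := norm_pos_iff.2 (c.hne q hq)
  have hqc : q ∈ closure Ω := frontier_subset_closure hf
  have hd : (q - R • N) - q = - (R • N) := by abel
  obtain ⟨κ, hκ, h⟩ := S.hopf_slope (y := q - R • N) (z := q) (R := R * ‖N‖) (by positivity) hB
    (fun x hx => S.wpos x (hB hx)) (by
      rw [hd, norm_neg, norm_smul, Real.norm_eq_abs, abs_of_pos hR])
  rw [hd] at h
  set d := - (R • N) with hdd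
  have hin : ∀ t ∈ Ioc (0 : ℝ) (1 / 2), q + t • d ∈ Ω := fun t ht => hB (h t ht.1 ht.2).1
  have hest : ∀ t ∈ Ioc (0 : ℝ) (1 / 2), ∃ s ∈ Ioo 0 t, κ ≤ ⟪H (q + s • d) e, d⟫ := by
    intro t ht
    obtain ⟨s, hs, hs1⟩ := mvt_seg (S.cW e) (fun x hx => hasGrad_of_innerSL (S.Wgrad' e hx)) q d ht.1
      hqc (subset_closure (hin t ht)) (fun s hs => hin s ⟨hs.1, hs.2.le.trans ht.2⟩)
    refine ⟨s, hs, ?_⟩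
    simp only [hw, sub_zero] at hs1
    have h1 := (h t ht.1 ht.2).2
    rw [hs1, mul_comm κ] at h1
    exact le_of_mul_le_mul_left h1 ht.1
  have hlim : κ ≤ ⟪H q e, d⟫ := by
    by_contra hcon
    push Not at hcon
    have h1 : ∀ᶠ x in 𝓝[closure Ω] q, ⟪H x e, d⟫ < κ :=
      ((S.cHv subset_rfl e).inner continuousOn_const q hqc).eventually (gt_mem_nhds hcon)
    have h2 : Tendsto (fun t : ℝ => q + t • d) (𝓝[Ioc 0 (1 / 2)] 0) (𝓝[closure Ω] q) := by
      refine tendsto_nhdsWithin_iff.2 ⟨?_, ?_⟩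
      · have : Tendsto (fun t : ℝ => q + t • d) (𝓝 0) (𝓝 (q + (0 : ℝ) • d)) :=
          (by fun_prop : Continuous (fun t : ℝ => q + t • d)).tendsto 0
        simp only [zero_smul, add_zero] at this
        exact this.mono_left nhdsWithin_le_nhds
      · filter_upwards [self_mem_nhdsWithin] with s hs
        exact subset_closure (hin s hs)
    have h3 := h2.eventually h1
    rw [eventually_nhdsWithin_iff, Metric.eventually_nhds_iff_ball] at h3
    obtain ⟨ε, hε, h3⟩ := h3
    have hm1 := min_le_left ε (1 / 2)
    have hm2 := min_le_right ε (1 / 2)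
    have hm0 : 0 < min ε (1 / 2) := by positivity
    obtain ⟨s, hs, hs1⟩ := hest (min ε (1 / 2)) ⟨hm0, hm2⟩
    have := h3 s (by
      rw [mem_ball, dist_zero_right, Real.norm_eq_abs, abs_of_pos hs.1]; linarith [hs.2])
      ⟨hs.1, by linarith [hs.2]⟩
    linarith
  rw [hdd, inner_neg_right, inner_smul_right] at hlim
  by_contra hcon
  push Not at hcon
  have : 0 ≤ R * ⟪H q e, N⟫ := by positivity
  linarith

lemma bdry (S : Setup Ω a f u D H e) {V : Set 𝔼} {g : 𝔼 → ℝ} (c : Chart Ω V g) {q : 𝔼}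
    (hq : q ∈ V) (hf : q ∈ frontier Ω)
    (hlc : ∀ᶠ y in 𝓝 q, y ∈ frontier Ω → u y = u q ∧ ‖D y‖ = ‖D q‖) :
    ∃ G, Tendsto (Gf a D H e) (𝓝[Ω] q) (𝓝 G) ∧ ⟪G, gradient g q⟫ = 0 := by
  have hqc : q ∈ closure Ω := frontier_subset_closure hf
  set N := gradient g q with hN
  have hN0 : 0 < ‖N‖ := norm_pos_iff.2 (c.hne q hq)
  obtain ⟨k, hk⟩ := c.tang S.hΩ hq hf S.hucl S.hDcl S.hu (hlc.mono (fun y h hy => (h hy).1))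
  rw [← hN] at hk
  by_cases hD0 : D q = 0
  · -- degenerate case
    have hw : ⟪D q, e⟫ = 0 := by rw [hD0, inner_zero_left]
    have hop := S.bdry_hopf c hq hf hw
    rw [← hN] at hop
    set κ := - ⟪H q e, N⟫ / 2 with hκ
    have hκ0 : 0 < κ := by rw [hκ]; linarith
    have ev1 : ∀ᶠ x in 𝓝[closure Ω] q, ⟪H x e, N⟫ < - κ :=
      ((S.cHv subset_rfl e).inner continuousOn_const q hqc).eventually
        (gt_mem_nhds (by show ⟪H q e, N⟫ < - κ; rw [hκ]; linarith))
    have ev2 : ∀ᶠ x in 𝓝[closure Ω] q, ‖H x‖ < ‖H q‖ + 1 :=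
      (S.hHcl q hqc).norm.eventually (gt_mem_nhds (by linarith))
    have ev := ev1.and ev2
    rw [eventually_nhdsWithin_iff] at ev
    obtain ⟨ρ, hρ, hb⟩ := Metric.eventually_nhds_iff_ball.1 (ev.and hlc)
    set M := ‖H q‖ + 1 with hM
    have hM0 : 0 < M := by positivity
    obtain ⟨r, hr, hrρ, hrV, hvert⟩ := c.vert S.hΩ hq hf hρ
    rw [← hN] at hvert
    have hest : ∀ x ∈ ball q r, x ∈ Ω → ‖D x‖ ^ 2 / ⟪D x, e⟫ ≤ M * ‖N‖ / κ * ‖D x‖ := by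
      intro x hx hxΩ
      obtain ⟨τ, hτ, -, hy, hyb, hyΩ⟩ := hvert x hx hxΩ
      have hDy : D (x + τ • N) = 0 := by
        have := ((hb _ (hyb τ ⟨hτ.le, le_rfl⟩)).2 hy).2
        rw [hD0, norm_zero] at this
        exact norm_eq_zero.1 this
      have hwx : κ * τ ≤ ⟪D x, e⟫ := by
        obtain ⟨s, hs, hs1⟩ := mvt_seg (S.cW e) (fun x hx => hasGrad_of_innerSL (S.Wgrad' e hx)) x N hτ
          (subset_closure hxΩ) (frontier_subset_closure hy) (fun s hs => hyΩ s ⟨hs.1.le, hs.2⟩)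
        simp only [hDy, inner_zero_left, zero_sub] at hs1
        have h1 := ((hb _ (hyb s ⟨hs.1.le, hs.2.le⟩)).1
          (subset_closure (hyΩ s ⟨hs.1.le, hs.2⟩))).1
        have h2 := mul_lt_mul_of_pos_left h1 hτ
        linarith
      have hsx : ‖D x‖ ≤ τ * (M * ‖N‖) := by
        obtain ⟨s, hs, hs1⟩ := mvt_seg (S.cW (D x))
          (fun z hz => hasGrad_of_innerSL (S.Wgrad' (D x) hz)) x N hτ
          (subset_closure hxΩ) (frontier_subset_closure hy) (fun s hs => hyΩ s ⟨hs.1.le, hs.2⟩)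
        simp only [hDy, inner_zero_left, zero_sub, real_inner_self_eq_norm_sq] at hs1
        have h1 := ((hb _ (hyb s ⟨hs.1.le, hs.2.le⟩)).1
          (subset_closure (hyΩ s ⟨hs.1.le, hs.2⟩))).2
        have h2 : |⟪H (x + s • N) (D x), N⟫| ≤ M * ‖D x‖ * ‖N‖ := by
          refine (abs_real_inner_le_norm _ _).trans ?_
          gcongr
          exact ((H (x + s • N)).le_opNorm _).trans (by gcongr)
        have h3 := neg_le_of_abs_le h2
        have h4 : ‖D x‖ * ‖D x‖ ≤ τ * (M * ‖N‖) * ‖D x‖ := by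
          have := mul_le_mul_of_nonneg_left h3 hτ.le
          nlinarith
        by_contra hcon
        push Not at hcon
        have h5 : 0 < ‖D x‖ := lt_of_le_of_lt (by positivity) hcon
        nlinarith
      have hw := S.wpos x hxΩ
      rw [div_le_iff₀ hw]
      calc ‖D x‖ ^ 2 = ‖D x‖ * ‖D x‖ := by ring
        _ ≤ ‖D x‖ * (τ * (M * ‖N‖)) := by gcongr
        _ = M * ‖N‖ / κ * ‖D x‖ * (κ * τ) := by field_simp
        _ ≤ _ := by gcongr
    refine ⟨0, ?_, inner_zero_left _⟩
    have t1 : Tendsto (fun x => Aop a (D x) (H x (D x))) (𝓝[Ω] q) (𝓝 0) := by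
      have := (S.cAop subset_rfl (S.cHD subset_rfl) q hqc).mono_left
        (nhdsWithin_mono q subset_closure)
      have e1 : Aop a (D q) (H q (D q)) = 0 := by rw [hD0, map_zero, ← AL_apply, map_zero]
      simp only [e1] at this
      exact this
    have t2 : Tendsto (fun x => Aop a (D x) (H x e)) (𝓝[Ω] q) (𝓝 (Aop a (D q) (H q e))) :=
      (S.cAop subset_rfl (S.cHv subset_rfl e) q hqc).mono_left (nhdsWithin_mono q subset_closure)
    have t3 : Tendsto (fun x => M * ‖N‖ / κ * ‖D x‖) (𝓝[Ω] q) (𝓝 0) := by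
      have h1 : Tendsto D (𝓝[Ω] q) (𝓝 0) := by
        have := (S.hDcl q hqc).mono_left (nhdsWithin_mono q subset_closure)
        rwa [hD0] at this
      simpa using h1.norm.const_mul (M * ‖N‖ / κ)
    have t4 : Tendsto (fun x => ‖D x‖ ^ 2 / ⟪D x, e⟫) (𝓝[Ω] q) (𝓝 0) := by
      refine squeeze_zero' ?_ ?_ t3
      · filter_upwards [self_mem_nhdsWithin] with x hx
        exact div_nonneg (sq_nonneg _) (S.wpos x hx).le
      · filter_upwards [self_mem_nhdsWithin, mem_nhdsWithin_of_mem_nhds (ball_mem_nhds q hr)] with x hx hx2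
        exact hest x hx2 hx
    have := t1.sub (t4.smul t2)
    rw [zero_smul, sub_zero] at this
    exact this
  · -- nondegenerate case
    have hk0 : k ≠ 0 := by rintro rfl; apply hD0; rw [hk, zero_smul]
    have hc2 : ContinuousOn (fun x => (2 : ℝ) • H x (D x)) (closure Ω) := by
      exact ContinuousOn.const_smul (S.cHD subset_rfl) (2 : ℝ)
    obtain ⟨m, hm⟩ := c.tang S.hΩ hq hf (F := fun x => ‖D x‖ ^ 2)
      (DF := fun x => (2 : ℝ) • H x (D x)) (S.hDcl.norm.pow 2) hc2
      (fun x hx => hasGrad_of_innerSL (S.s2grad hx))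
      (hlc.mono (fun y h hy => by simp only [(h hy).2]))
    rw [← hN] at hm
    have hNk : N = k⁻¹ • D q := by rw [hk, smul_smul, inv_mul_cancel₀ hk0, one_smul]
    obtain ⟨μ, hμ⟩ : ∃ μ : ℝ, H q (D q) = μ • D q := by
      refine ⟨2⁻¹ * m * k⁻¹, ?_⟩
      rw [mul_smul, ← hNk, mul_smul, ← hm, smul_smul]; norm_num
    have hHe : ⟪H q e, D q⟫ = μ * ⟪D q, e⟫ := by
      rw [S.hsymm q hqc, hμ, inner_smul_right, real_inner_comm]
    have hw : ⟪D q, e⟫ ≠ 0 := by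
      intro hw
      have h1 := S.bdry_hopf c hq hf hw
      rw [← hN, hNk, inner_smul_right, hHe, hw] at h1
      simp at h1
    refine ⟨Gf a D H e q, ?_, ?_⟩
    · have h1 : ContinuousOn (Gf a D H e) (insert q Ω) :=
        S.cG (insert_subset hqc subset_closure) (by
          intro x hx
          rcases hx with rfl | hx
          · exact hw
          · exact (S.wpos x hx).ne')
      exact (h1 q (mem_insert _ _)).mono_left (nhdsWithin_mono q (subset_insert _ _))
    · have h2 : ⟪Gf a D H e q, D q⟫ = 0 := by
        rw [Gf, inner_sub_left, inner_smul_left, inner_Aop_symm, inner_Aop_symm, Aop_self,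
          inner_smul_right, inner_smul_right, hHe, hμ, inner_smul_left, real_inner_self_eq_norm_sq]
        simp only [conj_trivial]
        field_simp
        ring
      rw [hNk, inner_smul_right, h2, mul_zero]

end Setup

lemma fatou_int {μ : Measure 𝔼} {F : ℕ → 𝔼 → ℝ} {f : 𝔼 → ℝ} {L : ℝ}
    (hF : ∀ k, Integrable (F k) μ) (h0 : ∀ k, ∀ᵐ x ∂μ, 0 ≤ F k x) (hle : ∀ k, ∀ᵐ x ∂μ, F k x ≤ f x)
    (hlim : ∀ᵐ x ∂μ, Tendsto (fun k => F k x) atTop (𝓝 (f x)))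
    (hL : Tendsto (fun k => ∫ x, F k x ∂μ) atTop (𝓝 L)) :
    Integrable f μ ∧ ∫ x, f x ∂μ = L := by
  have hm : AEStronglyMeasurable f μ :=
    aestronglyMeasurable_of_tendsto_ae atTop (fun k => (hF k).aestronglyMeasurable) hlim
  have hintg : Integrable f μ := by
    refine ⟨hm, ?_⟩
    rw [hasFiniteIntegral_iff_enorm]
    have h1 : ∫⁻ x, ‖f x‖ₑ ∂μ ≤ liminf (fun k => ∫⁻ x, ‖F k x‖ₑ ∂μ) atTop := by
      calc ∫⁻ x, ‖f x‖ₑ ∂μ = ∫⁻ x, liminf (fun k => ‖F k x‖ₑ) atTop ∂μ := by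
            refine lintegral_congr_ae (hlim.mono (fun x hx => ?_))
            exact ((continuous_enorm.tendsto _).comp hx).liminf_eq.symm
        _ ≤ _ := lintegral_liminf_le' (fun k => (hF k).aestronglyMeasurable.enorm)
    have h2 : (fun k => ∫⁻ x, ‖F k x‖ₑ ∂μ) = fun k => ENNReal.ofReal (∫ x, F k x ∂μ) := by
      funext k
      rw [← ofReal_integral_norm_eq_lintegral_enorm (hF k)]
      congr 1
      refine integral_congr_ae ((h0 k).mono (fun x hx => ?_))
      exact Real.norm_of_nonneg hx
    have h3 : liminf (fun k => ENNReal.ofReal (∫ x, F k x ∂μ)) atTop = ENNReal.ofReal L :=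
      ((ENNReal.continuous_ofReal.tendsto L).comp hL).liminf_eq
    rw [h2, h3] at h1
    exact h1.trans_lt ENNReal.ofReal_lt_top
  refine ⟨hintg, ?_⟩
  refine tendsto_nhds_unique ?_ hL
  refine tendsto_integral_of_dominated_convergence f (fun k => (hF k).aestronglyMeasurable) hintg
    (fun k => ?_) hlim
  filter_upwards [h0 k, hle k] with x hx hx2
  rwa [Real.norm_of_nonneg hx]

/-- one dimensional cutoff -/
def th (t : ℝ) : ℝ := Real.smoothTransition (t - 1)

lemma th_C1 : ContDiff ℝ 1 th := by
  unfold th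
  exact Real.smoothTransition.contDiff.comp (contDiff_id.sub contDiff_const)

lemma th_mono : Monotone th := fun s t h => Real.smoothTransition.monotone (by linarith)

lemma th_nonneg (t : ℝ) : 0 ≤ th t := Real.smoothTransition.nonneg _

lemma th_le_one (t : ℝ) : th t ≤ 1 := Real.smoothTransition.le_one _

lemma th_zero {t : ℝ} (h : t ≤ 1) : th t = 0 :=
  Real.smoothTransition.zero_of_nonpos (by linarith)

lemma th_one {t : ℝ} (h : 2 ≤ t) : th t = 1 :=
  Real.smoothTransition.one_of_one_le (by linarith)

lemma th_deriv_zero {t : ℝ} (h : 2 < t) : deriv th t = 0 := by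
  have : th =ᶠ[𝓝 t] fun _ => (1 : ℝ) := by
    filter_upwards [lt_mem_nhds h] with s hs
    exact th_one hs.le
  rw [this.deriv_eq]; simp

lemma intG {Ω : Set 𝔼} (hΩ : IsOpen Ω) {G : 𝔼 → 𝔼} (hG : ContinuousOn G Ω) {ζ c : 𝔼 → ℝ}
    (hζ : ∃ C, LipschitzWith C ζ) (hcs : HasCompactSupport ζ) {M : ℝ}
    (hM : ∀ x ∈ tsupport ζ, x ∈ Ω → ‖G x‖ ≤ M) (hc : Continuous c) (hc1 : ∀ x, |c x| ≤ 1) :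
    IntegrableOn (fun x => c x * ⟪G x, gradient ζ x⟫) Ω := by
  obtain ⟨C, hC⟩ := hζ
  have hKm : MeasurableSet (tsupport ζ) := (isClosed_tsupport ζ).measurableSet
  have hc' : IsCompact (tsupport ζ) := hcs
  have h1 : IntegrableOn (fun x => c x * ⟪G x, gradient ζ x⟫) (Ω ∩ tsupport ζ) := by
    refine IntegrableOn.of_bound ((measure_mono inter_subset_right).trans_lt hc'.measure_lt_top)
      ?_ (|M| * C) ?_
    · refine hc.aestronglyMeasurable.mul ?_
      exact AEStronglyMeasurable.inner (𝕜 := ℝ)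
        ((hG.mono inter_subset_left).aestronglyMeasurable (hΩ.measurableSet.inter hKm))
        (measurable_gradient ζ).aestronglyMeasurable
    · refine (ae_restrict_iff' (hΩ.measurableSet.inter hKm)).2 (ae_of_all _ (fun x hx => ?_))
      rw [norm_mul, Real.norm_eq_abs]
      refine (mul_le_of_le_one_left (norm_nonneg _) (hc1 x)).trans ?_
      refine (norm_inner_le_norm _ _).trans ?_
      gcongr
      · exact (hM x hx.2 hx.1).trans (le_abs_self _)
      · exact norm_gradient_le hC x
  refine h1.of_forall_sdiff_eq_zero hΩ.measurableSet (fun x hx => ?_)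
  have : x ∉ tsupport ζ := fun h => hx.2 ⟨hx.1, h⟩
  simp [gradient_zero_off this]

lemma bdry_limit {Ω : Set 𝔼} (hΩ : IsOpen Ω) {G : 𝔼 → 𝔼} {q : 𝔼 → ℝ} (hG : ContinuousOn G Ω)
    (hqc : ContinuousOn q Ω) (hq0 : ∀ x ∈ Ω, 0 ≤ q x)
    (hwk : ∀ ζ, IsTestOn Ω ζ → (∫ x in Ω, ζ x * q x) + ∫ x in Ω, ⟪G x, gradient ζ x⟫ = 0)
    {ζ : 𝔼 → ℝ} (hζ : ∃ C, LipschitzWith C ζ) (hcs : HasCompactSupport ζ) (hζ0 : ∀ x, 0 ≤ ζ x)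
    {h : 𝔼 → ℝ} (hh : ContDiff ℝ 1 h)
    (h1 : ∀ x ∈ tsupport ζ, (x ∈ Ω ↔ h x < 0))
    {m : ℝ} (hm : 0 < m) {v : 𝔼} (h2 : ∀ x ∈ tsupport ζ, m ≤ ⟪- gradient h x, v⟫)
    {M : ℝ} (hM : ∀ x ∈ tsupport ζ, x ∈ Ω → ‖G x‖ ≤ M)
    (h4 : ∀ ε > 0, ∃ δ > 0, ∀ x ∈ tsupport ζ, x ∈ Ω → - δ < h x → |⟪G x, gradient h x⟫| ≤ ε) :
    IntegrableOn (fun x => ζ x * q x) Ω ∧ IntegrableOn (fun x => ⟪G x, gradient ζ x⟫) Ω ∧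
      (∫ x in Ω, ζ x * q x) + ∫ x in Ω, ⟪G x, gradient ζ x⟫ = 0 := by
  have hG1 : IntegrableOn (fun x => ⟪G x, gradient ζ x⟫) Ω := by
    simpa using intG hΩ hG hζ hcs hM (c := fun _ => 1) continuous_const (by simp)
  obtain ⟨C, hC⟩ := id hζ
  have hK : IsCompact (tsupport ζ) := hcs
  set χ : ℕ → 𝔼 → ℝ := fun k x => th (- h x * (k + 1)) with hχ
  have hχC1 : ∀ k, ContDiff ℝ 1 (χ k) := fun k => th_C1.comp (hh.neg.mul contDiff_const)
  have hgh : Continuous (gradient h) :=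
    (InnerProductSpace.toDual ℝ 𝔼).symm.continuous.comp (hh.continuous_fderiv (by norm_num))
  set p : ℕ → 𝔼 → ℝ := fun k x => (k + 1) * deriv th (- h x * (k + 1)) with hp
  have hp0 : ∀ k x, 0 ≤ p k x := fun k x => mul_nonneg (by positivity) th_mono.deriv_nonneg
  have hpc : ∀ k, Continuous (p k) := fun k =>
    continuous_const.mul ((th_C1.continuous_deriv le_rfl).comp (hh.continuous.neg.mul continuous_const))
  have hχg : ∀ k x, HasFDerivAt (χ k) (innerSL ℝ (- (p k x) • gradient h x)) x := by
    intro k x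
    have e1 : HasFDerivAt h (innerSL ℝ (gradient h x)) x :=
      ((hh.differentiable (by norm_num) x).hasGradientAt.hasFDerivAt).congr_fderiv (by ext w; simp)
    have e2 := e1.neg.mul_const ((k : ℝ) + 1)
    have e3 := (th_C1.differentiable (by norm_num) (- h x * (k + 1))).hasDerivAt.comp_hasFDerivAt x e2
    refine e3.congr_fderiv ?_
    ext w
    simp [hp, inner_smul_left]
    ring
  set Z : ℕ → 𝔼 → ℝ := fun k x => ζ x * χ k x with hZ
  have hZt : ∀ k, IsTestOn Ω (Z k) := by
    intro k
    obtain ⟨t1, t2, t3⟩ := lip_mul_C1 isOpen_univ hζ hcs (subset_univ _) (hχC1 k).contDiffOn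
    refine ⟨t1, t2, ?_⟩
    have hcl : IsClosed (tsupport ζ ∩ {x | h x ≤ - (1 / ((k : ℝ) + 1))}) :=
      (isClosed_tsupport ζ).inter (isClosed_le hh.continuous continuous_const)
    have hsub : tsupport (Z k) ⊆ tsupport ζ ∩ {x | h x ≤ - (1 / ((k : ℝ) + 1))} := by
      refine closure_minimal ?_ hcl
      intro x hx
      have hx1 : ζ x * χ k x ≠ 0 := hx
      refine ⟨subset_closure (left_ne_zero_of_mul hx1), ?_⟩
      by_contra hcon
      simp only [mem_setOf_eq, not_le] at hcon
      apply right_ne_zero_of_mul hx1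
      refine th_zero ?_
      have : (0 : ℝ) < k + 1 := by positivity
      have h5 : - h x < 1 / ((k : ℝ) + 1) := by linarith
      rw [lt_div_iff₀ this] at h5
      exact h5.le
    intro x hx
    have := hsub hx
    rw [h1 x this.1]
    have h6 := this.2
    simp only [mem_setOf_eq] at h6
    have : (0 : ℝ) < 1 / ((k : ℝ) + 1) := by positivity
    linarith
  have hae : ∀ᵐ x, ∀ k, gradient (Z k) x = χ k x • gradient ζ x + (- (ζ x * p k x)) • gradient h x := by
    filter_upwards [hC.ae_differentiableAt (μ := volume)] with x hx k
    have e1 : HasFDerivAt ζ (innerSL ℝ (gradient ζ x)) x :=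
      (hx.hasGradientAt.hasFDerivAt).congr_fderiv (by ext w; simp)
    have e2 : HasFDerivAt (Z k) _ x := e1.mul (hχg k x)
    refine HasGradientAt.gradient (hasGrad_of_innerSL (e2.congr_fderiv ?_))
    ext w
    simp [inner_add_left, inner_smul_left]
    ring
  -- the mass of the derivative of the cutoff is bounded
  obtain ⟨B, hB0, hB⟩ : ∃ B > 0, ∀ k, ∫ x in Ω, ζ x * p k x ≤ B := by
    refine ⟨(C * ‖v‖ * volume.real (tsupport ζ)) / m + 1, by positivity, fun k => ?_⟩
    have i1 : Integrable (fun x => ζ x * p k x) :=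
      (hC.continuous.mul (hpc k)).integrable_of_hasCompactSupport hcs.mul_right
    have i2 : Integrable (fun x => χ k x * ⟪gradient ζ x, v⟫) := by
      refine integrable_of_bdd_compact (K := tsupport ζ) (M := C * ‖v‖) ?_ hK ?_ ?_
      · exact (hχC1 k).continuous.aestronglyMeasurable.mul
          (AEStronglyMeasurable.inner (𝕜 := ℝ) (measurable_gradient ζ).aestronglyMeasurable
            aestronglyMeasurable_const)
      · intro x hx; simp [gradient_zero_off hx]
      · intro x
        rw [norm_mul, Real.norm_eq_abs, abs_of_nonneg (th_nonneg _)]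
        refine (mul_le_of_le_one_left (norm_nonneg _) (th_le_one _)).trans ?_
        refine (norm_inner_le_norm _ _).trans ?_
        gcongr
        exact norm_gradient_le hC x
    have i3 : Integrable (fun x => ζ x * p k x * ⟪- gradient h x, v⟫) := by
      refine ((hC.continuous.mul (hpc k)).mul (hgh.neg.inner continuous_const)).integrable_of_hasCompactSupport ?_
      exact (hcs.mul_right (f' := p k)).mul_right
    have e1 : ∫ x in Ω, ⟪gradient (Z k) x, v⟫ = 0 := by
      rw [setIntegral_eq_integral_of_forall_compl_eq_zero (fun x hx => by
        rw [gradient_zero_off (fun h => hx ((hZt k).2.2 h)), inner_zero_left])]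
      have := integral_fderiv_zero (hZt k).1 (hZt k).2.1 v
      rw [← this]
      congr 1
      funext x
      rw [inner_gradient_left]
    have e2 : ∫ x in Ω, ⟪gradient (Z k) x, v⟫ =
        (∫ x in Ω, χ k x * ⟪gradient ζ x, v⟫) + ∫ x in Ω, ζ x * p k x * ⟪- gradient h x, v⟫ := by
      rw [← integral_add i2.integrableOn i3.integrableOn]
      refine integral_congr_ae (ae_restrict_of_ae (hae.mono (fun x hx => ?_)))
      simp only [hx k, inner_add_left, inner_smul_left, conj_trivial, inner_neg_left]
      ring
    have e3 : m * ∫ x in Ω, ζ x * p k x ≤ ∫ x in Ω, ζ x * p k x * ⟪- gradient h x, v⟫ := by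
      rw [← integral_const_mul]
      refine integral_mono (i1.integrableOn.const_mul m) i3.integrableOn (fun x => ?_)
      by_cases hx : x ∈ tsupport ζ
      · have := mul_le_mul_of_nonneg_left (h2 x hx) (mul_nonneg (hζ0 x) (hp0 k x))
        simp only
        linarith
      · simp [image_eq_zero_of_notMem_tsupport hx]
    have e4 : |∫ x in Ω, χ k x * ⟪gradient ζ x, v⟫| ≤ C * ‖v‖ * volume.real (tsupport ζ) := by
      have hKi : Integrable ((tsupport ζ).indicator (fun _ => C * ‖v‖)) :=
        (integrable_indicator_iff hK.measurableSet).2 (integrableOn_const hK.measure_lt_top.ne)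
      have := norm_integral_le_of_norm_le (μ := volume.restrict Ω) (f := fun x => χ k x * ⟪gradient ζ x, v⟫)
        hKi.integrableOn (ae_of_all _ (fun x => by
          by_cases hx : x ∈ tsupport ζ
          · rw [indicator_of_mem hx, norm_mul, Real.norm_eq_abs, abs_of_nonneg (th_nonneg _)]
            refine (mul_le_of_le_one_left (norm_nonneg _) (th_le_one _)).trans ?_
            refine (norm_inner_le_norm _ _).trans ?_
            gcongr
            exact norm_gradient_le hC x
          · rw [indicator_of_notMem hx, gradient_zero_off hx]; simp))
      rw [Real.norm_eq_abs] at this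
      refine this.trans ?_
      refine (setIntegral_le_integral hKi (ae_of_all _ (fun x =>
        indicator_nonneg (fun _ _ => by positivity) x))).trans ?_
      rw [integral_indicator hK.measurableSet, setIntegral_const, smul_eq_mul, mul_comm]
    have e5 := neg_le_of_abs_le e4
    have e6 : m * ∫ x in Ω, ζ x * p k x ≤ C * ‖v‖ * volume.real (tsupport ζ) := by linarith
    rw [mul_comm, ← le_div_iff₀ hm] at e6
    linarith
  -- pointwise convergence of the cutoffs
  have hχ1 : ∀ x ∈ tsupport ζ, x ∈ Ω → Tendsto (fun k => χ k x) atTop (𝓝 1) := by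
    intro x hx hxΩ
    have hx0 := (h1 x hx).1 hxΩ
    refine tendsto_const_nhds.congr' ?_
    obtain ⟨k0, hk0⟩ := exists_nat_gt (2 / (- h x))
    filter_upwards [eventually_ge_atTop k0] with k hk
    refine (th_one ?_).symm
    rw [div_lt_iff₀ (by linarith)] at hk0
    have : (k0 : ℝ) ≤ k := by exact_mod_cast hk
    nlinarith
  -- convergence of the first order terms
  have hI : Tendsto (fun k => ∫ x in Ω, χ k x * ⟪G x, gradient ζ x⟫) atTop
      (𝓝 (∫ x in Ω, ⟪G x, gradient ζ x⟫)) := by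
    refine tendsto_integral_of_dominated_convergence (fun x => ‖⟪G x, gradient ζ x⟫‖) ?_ hG1.norm ?_ ?_
    · intro k
      exact (hχC1 k).continuous.aestronglyMeasurable.mul hG1.aestronglyMeasurable
    · intro k
      refine ae_of_all _ (fun x => ?_)
      rw [norm_mul, Real.norm_eq_abs, abs_of_nonneg (th_nonneg _)]
      exact mul_le_of_le_one_left (norm_nonneg _) (th_le_one _)
    · refine (ae_restrict_iff' hΩ.measurableSet).2 (ae_of_all _ (fun x hx => ?_))
      by_cases hxK : x ∈ tsupport ζ
      · simpa using (hχ1 x hxK hx).mul_const ⟪G x, gradient ζ x⟫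
      · simp [gradient_zero_off hxK]
  have hJ : Tendsto (fun k => ∫ x in Ω, - (ζ x * p k x) * ⟪G x, gradient h x⟫) atTop (𝓝 0) := by
    rw [Metric.tendsto_atTop]
    intro ε hε
    obtain ⟨δ, hδ, hδ1⟩ := h4 (ε / (2 * B)) (by positivity)
    obtain ⟨k0, hk0⟩ := exists_nat_gt (2 / δ)
    refine ⟨k0, fun k hk => ?_⟩
    rw [dist_zero_right]
    have i1 : Integrable (fun x => ζ x * p k x) :=
      (hC.continuous.mul (hpc k)).integrable_of_hasCompactSupport hcs.mul_right
    have := norm_integral_le_of_norm_le (μ := volume.restrict Ω)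
      (f := fun x => - (ζ x * p k x) * ⟪G x, gradient h x⟫)
      (g := fun x => (ε / (2 * B)) * (ζ x * p k x)) (i1.integrableOn.const_mul _)
      ((ae_restrict_iff' hΩ.measurableSet).2 (ae_of_all _ (fun x hx => by
        rw [norm_mul, norm_neg, Real.norm_of_nonneg (mul_nonneg (hζ0 x) (hp0 k x)), mul_comm,
          Real.norm_eq_abs]
        by_cases hxK : x ∈ tsupport ζ
        · by_cases hxh : - δ < h x
          · exact mul_le_mul_of_nonneg_right (hδ1 x hxK hx hxh) (mul_nonneg (hζ0 x) (hp0 k x))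
          · have : p k x = 0 := by
              simp only [hp]
              rw [th_deriv_zero, mul_zero]
              rw [div_lt_iff₀ hδ] at hk0
              have : (k0 : ℝ) ≤ k := by exact_mod_cast hk
              nlinarith
            simp [this]
        · simp [image_eq_zero_of_notMem_tsupport hxK])))
    refine this.trans_lt ?_
    rw [integral_const_mul]
    calc ε / (2 * B) * ∫ x in Ω, ζ x * p k x ≤ ε / (2 * B) * B := by
          gcongr; exact hB k
      _ = ε / 2 := by field_simp
      _ < ε := by linarith
  have hsplit : ∀ k, ∫ x in Ω, ⟪G x, gradient (Z k) x⟫ =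
      (∫ x in Ω, χ k x * ⟪G x, gradient ζ x⟫) + ∫ x in Ω, - (ζ x * p k x) * ⟪G x, gradient h x⟫ := by
    intro k
    have i1 := intG hΩ hG hζ hcs hM (hχC1 k).continuous (fun x => by
      rw [abs_of_nonneg (th_nonneg _)]; exact th_le_one _)
    have i2 := intX hΩ hG (hZt k)
    have e1 : (fun x => - (ζ x * p k x) * ⟪G x, gradient h x⟫) =ᵐ[volume.restrict Ω]
        fun x => ⟪G x, gradient (Z k) x⟫ - χ k x * ⟪G x, gradient ζ x⟫ := by
      refine ae_restrict_of_ae (hae.mono (fun x hx => ?_))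
      simp only [hx k, inner_add_right, inner_smul_right]
      ring
    rw [integral_congr_ae e1, integral_sub i2 i1]
    ring
  have hfin : Tendsto (fun k => ∫ x in Ω, Z k x * q x) atTop (𝓝 (- ∫ x in Ω, ⟪G x, gradient ζ x⟫)) := by
    have := (hI.add hJ).neg
    rw [add_zero] at this
    refine this.congr (fun k => ?_)
    have := hwk _ (hZt k)
    rw [hsplit k] at this
    linarith
  obtain ⟨r1, r2⟩ := fatou_int (μ := volume.restrict Ω) (F := fun k x => Z k x * q x)
    (f := fun x => ζ x * q x) (fun k => intc hΩ hqc (hZt k))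
    (fun k => (ae_restrict_iff' hΩ.measurableSet).2 (ae_of_all _ (fun x hx =>
      mul_nonneg (mul_nonneg (hζ0 x) (th_nonneg _)) (hq0 x hx))))
    (fun k => (ae_restrict_iff' hΩ.measurableSet).2 (ae_of_all _ (fun x hx =>
      mul_le_mul_of_nonneg_right (mul_le_of_le_one_right (hζ0 x) (th_le_one _)) (hq0 x hx))))
    ((ae_restrict_iff' hΩ.measurableSet).2 (ae_of_all _ (fun x hx => by
      by_cases hxK : x ∈ tsupport ζ
      · simpa using ((hχ1 x hxK hx).const_mul (ζ x)).mul_const (q x)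
      · simp [hZ, image_eq_zero_of_notMem_tsupport hxK])))
    hfin
  exact ⟨r1, hG1, by rw [r2]; ring⟩

def Good (Ω : Set 𝔼) (G : 𝔼 → 𝔼) (q ζ : 𝔼 → ℝ) : Prop :=
  IntegrableOn (fun x => ζ x * q x) Ω ∧ IntegrableOn (fun x => ⟪G x, gradient ζ x⟫) Ω ∧
      (∫ x in Ω, ζ x * q x) + ∫ x in Ω, ⟪G x, gradient ζ x⟫ = 0

lemma Good.finset_sum {Ω : Set 𝔼} {G : 𝔼 → 𝔼} {q ζ : 𝔼 → ℝ} {ι : Type*} [Fintype ι] {Z : ι → 𝔼 → ℝ}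
    (hZ : ∀ i, Good Ω G q (Z i)) (hL : ∀ i, ∃ C, LipschitzWith C (Z i))
    (hs : ∀ x, ζ x = ∑ i, Z i x) : Good Ω G q ζ := by
  have hae : ∀ᵐ x, gradient ζ x = ∑ i, gradient (Z i) x := by
    have h1 : ∀ᵐ x, ∀ i, DifferentiableAt ℝ (Z i) x := by
      rw [ae_all_iff]
      intro i
      obtain ⟨C, hC⟩ := hL i
      exact hC.ae_differentiableAt
    filter_upwards [h1] with x hx
    have h2 : ζ = fun x => ∑ i, Z i x := funext hs
    unfold gradient
    rw [h2, fderiv_fun_sum (fun i _ => hx i), map_sum]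
  have e1 : (fun x => ζ x * q x) = fun x => ∑ i, Z i x * q x := by
    funext x; rw [hs, Finset.sum_mul]
  have e2 : (fun x => ⟪G x, gradient ζ x⟫) =ᵐ[volume.restrict Ω] fun x => ∑ i, ⟪G x, gradient (Z i) x⟫ := by
    refine ae_restrict_of_ae (hae.mono (fun x hx => ?_))
    simp only [hx, inner_sum]
  have i1 : ∀ i ∈ Finset.univ, Integrable (fun x => Z i x * q x) (volume.restrict Ω) := fun i _ => (hZ i).1
  have i2 : ∀ i ∈ Finset.univ, Integrable (fun x => ⟪G x, gradient (Z i) x⟫) (volume.restrict Ω) :=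
    fun i _ => (hZ i).2.1
  refine ⟨?_, ?_, ?_⟩
  · rw [e1]; exact integrable_finsetSum _ i1
  · exact (integrable_finsetSum _ i2).congr e2.symm
  · rw [integral_congr_ae e2, e1, integral_finsetSum _ i1, integral_finsetSum _ i2,
      ← Finset.sum_add_distrib]
    exact Finset.sum_eq_zero (fun i _ => (hZ i).2.2)

open scoped Manifold ContDiff in
lemma Good.of_local {Ω : Set 𝔼} {G : 𝔼 → 𝔼} {q : 𝔼 → ℝ}
    (hloc : ∀ p : 𝔼, ∃ U, IsOpen U ∧ p ∈ U ∧ ∀ ζ : 𝔼 → ℝ, (∃ C, LipschitzWith C ζ) →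
      HasCompactSupport ζ → (∀ x, 0 ≤ ζ x) → tsupport ζ ⊆ U → Good Ω G q ζ)
    {ζ : 𝔼 → ℝ} (hζ : ∃ C, LipschitzWith C ζ) (hcs : HasCompactSupport ζ) (hζ0 : ∀ x, 0 ≤ ζ x) :
    Good Ω G q ζ := by
  choose U hU hpU hg using hloc
  have hK : IsCompact (tsupport ζ) := hcs
  obtain ⟨t, ht⟩ := hK.elim_finite_subcover U hU (fun x _ => mem_iUnion.2 ⟨x, hpU x⟩)
  obtain ⟨f, hf⟩ := SmoothPartitionOfUnity.exists_isSubordinate 𝓘(ℝ, 𝔼) (isClosed_tsupport ζ)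
    (fun i : t => U i) (fun i => hU i) (by
      intro x hx
      have := ht hx
      simp only [mem_iUnion] at this ⊢
      obtain ⟨i, hi, hx⟩ := this
      exact ⟨⟨i, hi⟩, hx⟩)
  have hC1 : ∀ i, ContDiff ℝ 1 (f i : 𝔼 → ℝ) := fun i =>
    (f i).contMDiff.contDiff.of_le (by exact_mod_cast le_top)
  have hlm := fun i => lip_mul_C1 isOpen_univ hζ hcs (subset_univ _) (hC1 i).contDiffOn
  refine Good.finset_sum (Z := fun (i : t) x => ζ x * f i x) (fun i => ?_) (fun i => (hlm i).1) (fun x => ?_)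
  · refine hg i _ (hlm i).1 (hlm i).2.1 (fun x => mul_nonneg (hζ0 x) (f.nonneg i x)) ?_
    refine Subset.trans ?_ (hf i)
    refine closure_mono (fun x hx => ?_)
    exact right_ne_zero_of_mul (show ζ x * f i x ≠ 0 from hx)
  · rw [← Finset.mul_sum]
    by_cases hx : x ∈ tsupport ζ
    · have := f.sum_eq_one hx
      rw [finsum_eq_sum_of_fintype] at this
      rw [this, mul_one]
    · simp [image_eq_zero_of_notMem_tsupport hx]

namespace Setup
variable {Ω : Set (EuclideanSpace ℝ (Fin n))} {a f : ℝ → ℝ} {u : EuclideanSpace ℝ (Fin n) → ℝ}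
  {D : EuclideanSpace ℝ (Fin n) → EuclideanSpace ℝ (Fin n)}
  {H : EuclideanSpace ℝ (Fin n) → EuclideanSpace ℝ (Fin n) →L[ℝ] EuclideanSpace ℝ (Fin n)}
  {e : EuclideanSpace ℝ (Fin n)}

lemma q0 (S : Setup Ω a f u D H e) : ∀ x ∈ Ω, 0 ≤ qf a D H e x := fun x hx =>
  qf_nonneg S.hapos S.hlam D H e x (S.wpos x hx).ne' (S.hsymm x (subset_closure hx))

lemma good_bdry (S : Setup Ω a f u D H e) {V : Set 𝔼} {g : 𝔼 → ℝ} (c : Chart Ω V g) {p : 𝔼}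
    (hp : p ∈ V)
    (hlc : ∀ q ∈ frontier Ω, ∀ᶠ y in 𝓝 q, y ∈ frontier Ω → u y = u q ∧ ‖D y‖ = ‖D q‖) :
    ∃ U, IsOpen U ∧ p ∈ U ∧ ∀ ζ : 𝔼 → ℝ, (∃ C, LipschitzWith C ζ) →
      HasCompactSupport ζ → (∀ x, 0 ≤ ζ x) → tsupport ζ ⊆ U →
      Good Ω (Gf a D H e) (qf a D H e) ζ := by
  set N := gradient g p with hN
  have hN0 : 0 < ‖N‖ := norm_pos_iff.2 (c.hne p hp)
  have hcN : ContinuousOn (fun x => ⟪gradient g x, N⟫) V := c.grad_cont.inner continuousOn_const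
  refine ⟨V ∩ (fun x => ⟪gradient g x, N⟫) ⁻¹' Ioi (‖N‖ ^ 2 / 2),
    hcN.isOpen_inter_preimage c.hV isOpen_Ioi, ⟨hp, ?_⟩, ?_⟩
  · show ‖N‖ ^ 2 / 2 < ⟪N, N⟫
    rw [real_inner_self_eq_norm_sq]
    nlinarith
  intro ζ hζ hcs hζ0 hsub
  have hK : IsCompact (tsupport ζ) := hcs
  have hKV : tsupport ζ ⊆ V := fun x hx => (hsub hx).1
  obtain ⟨h, hh, -, -, hext⟩ := exists_C1_ext hK c.hV hKV (c.hg.of_le (by norm_num))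
  have hloc : ∀ x ∈ tsupport ζ, h =ᶠ[𝓝 x] g := fun x hx => by
    exact (eventually_nhdsSet_iff_forall.1 hext) x hx
  have hgr : ∀ x ∈ tsupport ζ, gradient h x = gradient g x := fun x hx => by
    unfold gradient; rw [(hloc x hx).fderiv_eq]
  have hval : ∀ x ∈ tsupport ζ, h x = g x := fun x hx => (hloc x hx).self_of_nhds
  -- behaviour near points of the support
  have hfr : ∀ x ∈ tsupport ζ, x ∉ Ω → x ∈ closure Ω → x ∈ frontier Ω := fun x _ h1 h2 => by
    rw [S.hΩ.frontier_eq]; exact ⟨h2, h1⟩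
  obtain ⟨M, hM⟩ : ∃ M, ∀ x ∈ tsupport ζ, x ∈ Ω → ‖Gf a D H e x‖ ≤ M := by
    refine hK.induction_on (p := fun s => ∃ M, ∀ x ∈ s, x ∈ Ω → ‖Gf a D H e x‖ ≤ M)
      ⟨0, by simp⟩ (fun s t hst ⟨M, hM⟩ => ⟨M, fun x hx => hM x (hst hx)⟩) ?_ ?_
    · rintro s t ⟨M, hM⟩ ⟨M', hM'⟩
      refine ⟨max M M', ?_⟩
      rintro x (hx | hx) hxΩ
      · exact (hM x hx hxΩ).trans (le_max_left _ _)
      · exact (hM' x hx hxΩ).trans (le_max_right _ _)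
    · intro x hx
      by_cases hxc : x ∈ closure Ω
      · obtain ⟨G0, hG0⟩ : ∃ G0, Tendsto (Gf a D H e) (𝓝[Ω] x) (𝓝 G0) := by
          by_cases hxΩ : x ∈ Ω
          · exact ⟨_, S.cGΩ x hxΩ⟩
          · have hf := hfr x hx hxΩ hxc
            obtain ⟨G0, hG0, -⟩ := S.bdry c (hKV hx) hf (hlc x hf)
            exact ⟨G0, hG0⟩
        have ev := hG0.norm.eventually (gt_mem_nhds (show ‖G0‖ < ‖G0‖ + 1 by linarith))
        rw [eventually_nhdsWithin_iff] at ev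
        exact ⟨_, mem_nhdsWithin_of_mem_nhds ev, ‖G0‖ + 1, fun y hy hyΩ => (hy hyΩ).le⟩
      · refine ⟨(closure Ω)ᶜ, mem_nhdsWithin_of_mem_nhds (isClosed_closure.isOpen_compl.mem_nhds hxc),
          0, fun y hy hyΩ => absurd (subset_closure hyΩ) hy⟩
  have h4 : ∀ ε > 0, ∃ δ > 0, ∀ x ∈ tsupport ζ, x ∈ Ω → - δ < g x →
      |⟪Gf a D H e x, gradient g x⟫| ≤ ε := by
    intro ε hε
    refine hK.induction_on (p := fun s => ∃ δ > 0, ∀ x ∈ s, x ∈ Ω → - δ < g x →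
      |⟪Gf a D H e x, gradient g x⟫| ≤ ε)
      ⟨1, one_pos, by simp⟩ (fun s t hst ⟨δ, hδ, hM⟩ => ⟨δ, hδ, fun x hx => hM x (hst hx)⟩) ?_ ?_
    · rintro s t ⟨δ, hδ, hM⟩ ⟨δ', hδ', hM'⟩
      refine ⟨min δ δ', lt_min hδ hδ', ?_⟩
      have m1 := min_le_left δ δ'
      have m2 := min_le_right δ δ'
      rintro x (hx | hx) hxΩ hxg
      · exact hM x hx hxΩ (by linarith)
      · exact hM' x hx hxΩ (by linarith)
    · intro x hx
      by_cases hxΩ : x ∈ Ω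
      · have hg0 := (c.mem_iff (hKV hx)).1 hxΩ
        have ev : ∀ᶠ y in 𝓝 x, g y < g x / 2 := (c.cont (hKV hx)).eventually (gt_mem_nhds (by linarith))
        refine ⟨_, mem_nhdsWithin_of_mem_nhds ev, - g x / 2, by linarith, fun y hy _ h2 => ?_⟩
        have hy' : g y < g x / 2 := hy
        exfalso; linarith
      by_cases hxc : x ∈ closure Ω
      · have hf := hfr x hx hxΩ hxc
        obtain ⟨G0, hG0, hz⟩ := S.bdry c (hKV hx) hf (hlc x hf)
        have t1 : Tendsto (gradient g) (𝓝[Ω] x) (𝓝 (gradient g x)) :=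
          (c.grad_cont.continuousAt (c.hV.mem_nhds (hKV hx))).mono_left nhdsWithin_le_nhds
        have t2 := (Filter.Tendsto.inner (𝕜 := ℝ) hG0 t1).abs
        rw [hz, abs_zero] at t2
        have ev := t2.eventually (gt_mem_nhds hε)
        rw [eventually_nhdsWithin_iff] at ev
        exact ⟨_, mem_nhdsWithin_of_mem_nhds ev, 1, one_pos, fun y hy hyΩ _ => (hy hyΩ).le⟩
      · refine ⟨(closure Ω)ᶜ, mem_nhdsWithin_of_mem_nhds (isClosed_closure.isOpen_compl.mem_nhds hxc),
          1, one_pos, fun y hy hyΩ => absurd (subset_closure hyΩ) hy⟩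
  refine bdry_limit S.hΩ S.cGΩ S.cq S.q0 (fun ζ hζ => S.weak_id hζ) hζ hcs hζ0 hh
    (fun x hx => by rw [hval x hx]; exact c.mem_iff (hKV hx)) (m := ‖N‖ ^ 2 / 2) (by positivity)
    (v := - N) (fun x hx => ?_) hM (fun ε hε => ?_)
  · rw [hgr x hx, inner_neg_neg]
    exact (hsub hx).2.le
  · obtain ⟨δ, hδ, h5⟩ := h4 ε hε
    exact ⟨δ, hδ, fun x hx hxΩ hxg => by
      rw [hgr x hx]; rw [hval x hx] at hxg; exact h5 x hx hxΩ hxg⟩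

lemma good (S : Setup Ω a f u D H e)
    (hch : ∀ q ∈ frontier Ω, ∃ V g, Chart Ω V g ∧ q ∈ V)
    (hlc : ∀ q ∈ frontier Ω, ∀ᶠ y in 𝓝 q, y ∈ frontier Ω → u y = u q ∧ ‖D y‖ = ‖D q‖)
    {ζ : 𝔼 → ℝ} (hζ : ∃ C, LipschitzWith C ζ) (hcs : HasCompactSupport ζ) (hζ0 : ∀ x, 0 ≤ ζ x) :
    Good Ω (Gf a D H e) (qf a D H e) ζ := by
  refine Good.of_local (fun p => ?_) hζ hcs hζ0
  by_cases hpc : p ∈ closure Ω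
  · by_cases hpΩ : p ∈ Ω
    · refine ⟨Ω, S.hΩ, hpΩ, fun ζ h1 h2 h3 h4 => ?_⟩
      have ht : IsTestOn Ω ζ := ⟨h1, h2, h4⟩
      exact ⟨intc S.hΩ S.cq ht, intX S.hΩ S.cGΩ ht, S.weak_id ht⟩
    · obtain ⟨V, g, c, hpV⟩ := hch p (by rw [S.hΩ.frontier_eq]; exact ⟨hpc, hpΩ⟩)
      exact S.good_bdry c hpV hlc
  · refine ⟨(closure Ω)ᶜ, isClosed_closure.isOpen_compl, hpc, fun ζ h1 h2 h3 h4 => ?_⟩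
    have hz : ∀ x ∈ Ω, x ∉ tsupport ζ := fun x hx h => h4 h (subset_closure hx)
    have z1 : ∀ x ∈ Ω, ζ x * qf a D H e x = 0 := fun x hx => by
      simp [image_eq_zero_of_notMem_tsupport (hz x hx)]
    have z2 : ∀ x ∈ Ω, ⟪Gf a D H e x, gradient ζ x⟫ = 0 := fun x hx => by
      simp [gradient_zero_off (hz x hx)]
    refine ⟨?_, ?_, ?_⟩
    · exact integrableOn_zero.congr_fun (fun x hx => (z1 x hx).symm) S.hΩ.measurableSet
    · exact integrableOn_zero.congr_fun (fun x hx => (z2 x hx).symm) S.hΩ.measurableSet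
    · rw [setIntegral_eq_zero_of_forall_eq_zero z1, setIntegral_eq_zero_of_forall_eq_zero z2, add_zero]

end Setup

namespace Setup
variable {Ω : Set (EuclideanSpace ℝ (Fin n))} {a f : ℝ → ℝ} {u : EuclideanSpace ℝ (Fin n) → ℝ}
  {D : EuclideanSpace ℝ (Fin n) → EuclideanSpace ℝ (Fin n)}
  {H : EuclideanSpace ℝ (Fin n) → EuclideanSpace ℝ (Fin n) →L[ℝ] EuclideanSpace ℝ (Fin n)}
  {e : EuclideanSpace ℝ (Fin n)}

lemma Dne (S : Setup Ω a f u D H e) {x : 𝔼} (hx : x ∈ Ω) : D x ≠ 0 := by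
  intro h
  have := S.wpos x hx
  simp [h] at this

lemma normgrad (S : Setup Ω a f u D H e) {x : 𝔼} (hx : x ∈ Ω) :
    HasFDerivAt (fun y => ‖D y‖) (innerSL ℝ (gs D H x)) x := by
  have h := (hasFDerivAt_norm_of_ne (S.Dne hx)).comp x (S.hDH x hx)
  refine HasFDerivAt.congr_fderiv (f := fun y => ‖D y‖) h ?_
  ext v
  simp [gs, inner_smul_left, S.hsymm _ (subset_closure hx)]

lemma quotgrad (S : Setup Ω a f u D H e) {x : 𝔼} (hx : x ∈ Ω) {φ : 𝔼 → ℝ}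
    (hφ : DifferentiableAt ℝ φ x) :
    gradient (fun y => φ y * ‖D y‖ / ⟪D y, e⟫) x =
      φ x • gk D H e x + (‖D x‖ / ⟪D x, e⟫) • gradient φ x := by
  have hw := (S.wpos x hx).ne'
  have h1 := (hφ.hasFDerivAt.mul (S.normgrad hx)).mul
    ((hasDerivAt_inv hw).comp_hasFDerivAt x (S.Wgrad' e hx))
  have h2 : HasFDerivAt (fun y => φ y * ‖D y‖ * (⟪D y, e⟫)⁻¹) _ x := h1
  have h3 : HasFDerivAt (fun y => φ y * ‖D y‖ / ⟪D y, e⟫)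
      (innerSL ℝ (φ x • gk D H e x + (‖D x‖ / ⟪D x, e⟫) • gradient φ x)) x := by
    simp_rw [div_eq_mul_inv] at h2 ⊢
    refine h2.congr_fderiv ?_
    ext v
    have : ⟪gradient φ x, v⟫ = fderiv ℝ φ x v := by rw [inner_gradient_left]
    simp [gk, inner_add_left, inner_sub_left, inner_smul_left, this]
    field_simp
    ring
  exact (hasGrad_of_innerSL h3).gradient

lemma final (S : Setup Ω a f u D H e)
    (hch : ∀ q ∈ frontier Ω, ∃ V g, Chart Ω V g ∧ q ∈ V)
    (hlc : ∀ q ∈ frontier Ω, ∀ᶠ y in 𝓝 q, y ∈ frontier Ω → u y = u q ∧ ‖D y‖ = ‖D q‖)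
    {φ : 𝔼 → ℝ} (hφ : ∃ C, LipschitzWith C φ) (hcs : HasCompactSupport φ) :
    (∫ x in Ω, φ x ^ 2 * Qf a D H x) +
      (∫ x in Ω, ⟪D x, e⟫ ^ 2 * ⟪Aop a (D x) (gradient (fun y => φ y * ‖D y‖ / ⟪D y, e⟫) x),
        gradient (fun y => φ y * ‖D y‖ / ⟪D y, e⟫) x⟫) ≤
      ∫ x in Ω, ‖D x‖ ^ 2 * ⟪Aop a (D x) (gradient φ x), gradient φ x⟫ := by
  obtain ⟨C, hC⟩ := hφ
  have hζs : HasCompactSupport (fun x => φ x ^ 2) := by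
    have : HasCompactSupport (fun x => φ x * φ x) := hcs.mul_left
    simpa only [sq] using this
  have hζl : ∃ C', LipschitzWith C' (fun x => φ x ^ 2) := lip_sq hC hcs
  obtain ⟨g1, g2, g3⟩ := S.good hch hlc hζl hζs (fun x => sq_nonneg (φ x))
  have hm : MeasurableSet Ω := S.hΩ.measurableSet
  have hae : ∀ᵐ x ∂(volume.restrict Ω), x ∈ Ω ∧ DifferentiableAt ℝ φ x :=
    (ae_restrict_mem hm).and (ae_restrict_of_ae hC.ae_differentiableAt)
  have cD : ContinuousOn D Ω := S.hDcl.mono subset_closure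
  have cgs : ContinuousOn (gs D H) Ω :=
    (cD.norm.inv₀ (fun x hx => norm_ne_zero_iff.2 (S.Dne hx))).smul (S.cHD subset_closure)
  have cQ : ContinuousOn (Qf a D H) Ω :=
    (S.cN subset_closure).sub ((S.cAop subset_closure cgs).inner cgs)
  have iQ : IntegrableOn (fun x => φ x ^ 2 * Qf a D H x) Ω := by
    refine Integrable.mono' g1
      (((hC.continuous.pow 2).continuousOn.mul cQ).aestronglyMeasurable hm) ?_
    filter_upwards [ae_restrict_mem hm] with x hx
    have hs := S.hsymm _ (subset_closure hx)
    have hQ := Qf_nonneg S.hapos S.hlam D H x hs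
    rw [Real.norm_of_nonneg (mul_nonneg (sq_nonneg _) hQ), qf_eq a D H e x (S.wpos x hx).ne']
    refine mul_le_mul_of_nonneg_left ?_ (sq_nonneg _)
    exact le_add_of_nonneg_right
      (mul_nonneg (sq_nonneg _) (inner_Aop_nonneg S.hapos S.hlam _ _))
  have iT : IntegrableOn (fun x => ‖D x‖ ^ 2 * ⟪Aop a (D x) (gradient φ x), gradient φ x⟫) Ω := by
    have hK : IsCompact (tsupport φ ∩ closure Ω) := IsCompact.inter_right hcs isClosed_closure
    have cA : ContinuousOn (fun x => AL a (D x)) (closure Ω) :=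
      (continuous_AL S.ha).comp_continuousOn S.hDcl
    obtain ⟨M, hM⟩ := hK.exists_bound_of_continuousOn (S.hDcl.mono inter_subset_right)
    obtain ⟨N, hN⟩ := hK.exists_bound_of_continuousOn (cA.mono inter_subset_right)
    have hmeas : AEStronglyMeasurable
        (fun x => ‖D x‖ ^ 2 * ⟪Aop a (D x) (gradient φ x), gradient φ x⟫) (volume.restrict Ω) := by
      simp_rw [← AL_apply]
      have m1 : AEStronglyMeasurable (fun x => AL a (D x)) (volume.restrict Ω) :=
        (cA.mono subset_closure).aestronglyMeasurable hm
      have m2 : AEStronglyMeasurable (gradient φ) (volume.restrict Ω) :=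
        (measurable_gradient φ).aestronglyMeasurable
      have m3 : AEStronglyMeasurable (fun x => AL a (D x) (gradient φ x)) (volume.restrict Ω) := by
        have hc : Continuous (fun z : (𝔼 →L[ℝ] 𝔼) × 𝔼 => z.1 z.2) :=
          continuous_fst.clm_apply continuous_snd
        exact hc.comp_aestronglyMeasurable (m1.prodMk m2)
      have m4 : AEStronglyMeasurable (fun x => ‖D x‖ ^ 2) (volume.restrict Ω) :=
        (cD.norm.pow 2).aestronglyMeasurable hm
      exact m4.mul (m3.inner (𝕜 := ℝ) m2)
    have h1 : IntegrableOn (fun x => ‖D x‖ ^ 2 * ⟪Aop a (D x) (gradient φ x), gradient φ x⟫)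
        (Ω ∩ tsupport φ) := by
      refine IntegrableOn.of_bound (C := M ^ 2 * (N * C * C)) ?_
        (hmeas.mono_measure (Measure.restrict_mono inter_subset_left le_rfl)) ?_
      · exact lt_of_le_of_lt (measure_mono inter_subset_right) (IsCompact.measure_lt_top hcs)
      · filter_upwards [ae_restrict_mem (hm.inter (isClosed_tsupport φ).measurableSet)] with x hx
        have hx' : x ∈ tsupport φ ∩ closure Ω := ⟨hx.2, subset_closure hx.1⟩
        have hN0 : 0 ≤ N := (norm_nonneg _).trans (hN x hx')
        rw [norm_mul, norm_pow, norm_norm, ← AL_apply]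
        gcongr
        · exact hM x hx'
        · refine (norm_inner_le_norm _ _).trans ?_
          gcongr
          · refine (ContinuousLinearMap.le_opNorm _ _).trans ?_
            gcongr
            · exact hN x hx'
            · exact norm_gradient_le hC x
          · exact norm_gradient_le hC x
    refine h1.of_forall_sdiff_eq_zero hm (fun x hx => ?_)
    have : x ∉ tsupport φ := fun h => hx.2 ⟨hx.1, h⟩
    simp [gradient_zero_off this]
  have hE : (fun x => ⟪D x, e⟫ ^ 2 * ⟪Aop a (D x) (gradient (fun y => φ y * ‖D y‖ / ⟪D y, e⟫) x),
        gradient (fun y => φ y * ‖D y‖ / ⟪D y, e⟫) x⟫) =ᵐ[volume.restrict Ω]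
      fun x => (‖D x‖ ^ 2 * ⟪Aop a (D x) (gradient φ x), gradient φ x⟫ +
        ⟪Gf a D H e x, gradient (fun y => φ y ^ 2) x⟫) +
        (φ x ^ 2 * qf a D H e x - φ x ^ 2 * Qf a D H x) := by
    filter_upwards [hae] with x hx
    have hgr : gradient (fun y => φ y ^ 2) x = (2 * φ x) • gradient φ x := by
      have h1 := hx.2.hasFDerivAt.pow 2
      have h2 : HasFDerivAt (fun y => φ y ^ 2) _ x := h1
      unfold gradient
      rw [h2.fderiv]
      simp
    rw [S.quotgrad hx.1 hx.2, expand a D H e x (S.wpos x hx.1).ne', hgr]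
    ring
  have s1 := integral_add (iT.add g2) (g1.sub iQ)
  have s2 := integral_add iT g2
  have s3 := integral_sub g1 iQ
  simp only [Pi.add_apply, Pi.sub_apply] at s1
  rw [integral_congr_ae hE, s1, s2, s3]
  linarith
end Setup

lemma setup_of {Ω : Set 𝔼} (hΩ : IsOpen Ω) (hconn : IsPreconnected Ω)
    {a : ℝ → ℝ} (ha : C11Loc a)
    (hapos : ∀ t ≥ (0 : ℝ), 0 < a t) (hlam : ∀ t ≥ (0 : ℝ), 0 < lam1 a t)
    {f : ℝ → ℝ} (hf : ContDiff ℝ 1 f) {u : 𝔼 → ℝ}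
    (hu3 : ContDiffOn ℝ 3 u Ω) (hucl : ContinuousOn u (closure Ω)) {Du : 𝔼 → 𝔼}
    (hDu : ∀ x ∈ Ω, Du x = gradient u x) (hDuc : ContinuousOn Du (closure Ω))
    {H : 𝔼 → 𝔼 →L[ℝ] 𝔼} (hH : ContinuousOn H (closure Ω))
    (hH2 : ∀ x ∈ Ω, H x = fderiv ℝ (gradient u) x)
    (hsol : IsWeakSolution a f Ω u) {e : 𝔼} (hw0 : ∀ x ∈ Ω, 0 ≤ ⟪gradient u x, e⟫)
    (hwne : ∃ x ∈ Ω, ⟪gradient u x, e⟫ ≠ 0) : Setup Ω a f u Du H e := by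
  have hfd : ContDiffOn ℝ 2 (fderiv ℝ u) Ω := hu3.fderiv_of_isOpen hΩ (by norm_num)
  have hgr : ContDiffOn ℝ 2 (gradient u) Ω :=
    (InnerProductSpace.toDual ℝ 𝔼).symm.contDiff.comp_contDiffOn hfd
  have hgd : ∀ x ∈ Ω, HasFDerivAt (gradient u) (H x) x := fun x hx => by
    rw [hH2 x hx]
    exact ((hgr.contDiffAt (hΩ.mem_nhds hx)).differentiableAt (by norm_num)).hasFDerivAt
  have hev : ∀ x ∈ Ω, Du =ᶠ[𝓝 x] gradient u := fun x hx => by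
    filter_upwards [hΩ.mem_nhds hx] with y hy using hDu y hy
  have hsymΩ : ∀ v w, ∀ x ∈ Ω, ⟪H x v, w⟫ = ⟪v, H x w⟫ := by
    intro v w x hx
    have key : ∀ v w, ⟪H x v, w⟫ = fderiv ℝ (fderiv ℝ u) x v w := by
      intro v w
      have h1 := (hgd x hx).inner ℝ (hasFDerivAt_const w x)
      have h2 : HasFDerivAt (fun y => fderiv ℝ u y w) _ x :=
        (((hfd.contDiffAt (hΩ.mem_nhds hx)).differentiableAt (by norm_num)).hasFDerivAt.clm_apply
          (hasFDerivAt_const w x))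
      have h3 : (fun y => ⟪gradient u y, w⟫) = fun y => fderiv ℝ u y w := by
        funext y; rw [inner_gradient_left]
      rw [h3] at h1
      have h4 := h1.unique h2
      have := DFunLike.congr_fun h4 v
      simpa using this
    have hs : IsSymmSndFDerivAt ℝ u x :=
      (hu3.contDiffAt (hΩ.mem_nhds hx)).isSymmSndFDerivAt (by simp; norm_num)
    rw [key, real_inner_comm, key, hs.eq]
  refine ⟨hΩ, hconn, ha, hapos, hlam, hf, ?_, ?_, ?_, ?_, hucl, hDuc, hH, ?_, ?_, ?_⟩
  · intro x hx
    rw [hDu x hx]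
    exact ((hu3.contDiffAt (hΩ.mem_nhds hx)).differentiableAt (by norm_num)).hasGradientAt
  · exact hgr.congr hDu
  · intro x hx
    exact (hgd x hx).congr_of_eventuallyEq (hev x hx)
  · intro x hx v w
    have c1 : ContinuousOn (fun x => ⟪H x v, w⟫ - ⟪v, H x w⟫) (closure Ω) :=
      ((hH.clm_apply continuousOn_const).inner continuousOn_const).sub
        (continuousOn_const.inner (hH.clm_apply continuousOn_const))
    have h1 : ⟪H x v, w⟫ - ⟪v, H x w⟫ ∈ closure ({0} : Set ℝ) := by
      refine ((c1 x hx).mono subset_closure).mem_closure hx (fun y hy => ?_)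
      simp [hsymΩ v w y hy]
    rw [closure_singleton, mem_singleton_iff, sub_eq_zero] at h1
    exact h1
  · intro φ hφ
    rw [← hsol φ hφ]
    refine setIntegral_congr_fun hΩ.measurableSet (fun x hx => ?_)
    simp only [hDu x hx, inner_smul_left]
    simp
  · intro x hx; rw [hDu x hx]; exact hw0 x hx
  · obtain ⟨x, hx, h⟩ := hwne
    exact ⟨x, hx, by rw [hDu x hx]; exact h⟩

lemma hlc_of {Ω : Set 𝔼} {η : 𝔼 → 𝔼} (hΩ : IsCkDomainWithNormal 2 Ω η) {a f : ℝ → ℝ}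
    {u : 𝔼 → ℝ} {Du : 𝔼 → 𝔼} {H : 𝔼 → 𝔼 →L[ℝ] 𝔼} {e : 𝔼} (S : Setup Ω a f u Du H e)
    (hulc : ∀ p ∈ frontier Ω, ∃ V ∈ 𝓝 p, ∀ q ∈ V ∩ frontier Ω,
      u q = u p ∧ ⟪Du q, η q⟫ = ⟪Du p, η p⟫) :
    ∀ q ∈ frontier Ω, ∀ᶠ y in 𝓝 q, y ∈ frontier Ω → u y = u q ∧ ‖Du y‖ = ‖Du q‖ := by
  have hN : ∀ y ∈ frontier Ω, ‖Du y‖ = |⟪Du y, η y⟫| := by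
    intro y hy
    obtain ⟨V, g, hV, hyV, hg, hne, hΩV, hη⟩ := hΩ.2.2.2 y hy
    have c : Chart Ω V g := ⟨hV, hg, hne, hΩV⟩
    obtain ⟨W, hW, hW2⟩ := hulc y hy
    obtain ⟨k, hk⟩ := c.tang S.hΩ hyV hy S.hucl S.hDcl S.hu (by
      filter_upwards [hW] with z hz hzf using (hW2 z ⟨hz, hzf⟩).1)
    have hn : ‖gradient g y‖ ≠ 0 := norm_ne_zero_iff.2 (hne y hyV)
    rw [hk, hη, inner_neg_right, inner_smul_left, inner_smul_right, real_inner_self_eq_norm_sq,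
      abs_neg, norm_smul]
    have : (starRingEnd ℝ) k * (‖gradient g y‖⁻¹ * ‖gradient g y‖ ^ 2) = k * ‖gradient g y‖ := by
      simp; left; field_simp
    rw [this, abs_mul, abs_norm, Real.norm_eq_abs]
  intro q hq
  obtain ⟨W, hW, hW2⟩ := hulc q hq
  filter_upwards [hW] with y hy hyf
  obtain ⟨h1, h2⟩ := hW2 y ⟨hy, hyf⟩
  exact ⟨h1, by rw [hN y hyf, hN q hq, h2]⟩

/-- Theorem 4.4 of the paper (the geometric Poincaré inequality), in the Euclidean
(Ricci-flat) case with `Ω₀ = Ω` and the Killing field a constant field `e`. -/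
theorem geometric_poincare_inequality
    (n : ℕ) (Ω : Set (EuclideanSpace ℝ (Fin n)))
    (η : EuclideanSpace ℝ (Fin n) → EuclideanSpace ℝ (Fin n))
    (hΩ : IsCkDomainWithNormal 2 Ω η)
    (a : ℝ → ℝ) (ha : C11Loc a)
    (hapos : ∀ t ≥ (0 : ℝ), 0 < a t) (hlam : ∀ t ≥ (0 : ℝ), 0 < lam1 a t)
    (f : ℝ → ℝ) (hf : ContDiff ℝ 1 f)
    (u : EuclideanSpace ℝ (Fin n) → ℝ)
    (hu3 : ContDiffOn ℝ 3 u Ω) (hucl : ContinuousOn u (closure Ω))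
    (Du : EuclideanSpace ℝ (Fin n) → EuclideanSpace ℝ (Fin n))
    (hDu : ∀ x ∈ Ω, Du x = gradient u x) (hDuc : ContinuousOn Du (closure Ω))
    (hD2u : ∃ H : EuclideanSpace ℝ (Fin n) →
        EuclideanSpace ℝ (Fin n) →L[ℝ] EuclideanSpace ℝ (Fin n),
      ContinuousOn H (closure Ω) ∧ ∀ x ∈ Ω, H x = fderiv ℝ (gradient u) x)
    (hsol : IsWeakSolution a f Ω u) (hstab : IsStable a f Ω u)
    (hulc : ∀ p ∈ frontier Ω, ∃ V ∈ 𝓝 p, ∀ q ∈ V ∩ frontier Ω,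
      u q = u p ∧ ⟪Du q, η q⟫ = ⟪Du p, η p⟫)
    (e : EuclideanSpace ℝ (Fin n))
    (hw0 : ∀ x ∈ Ω, 0 ≤ ⟪gradient u x, e⟫)
    (hwne : ∃ x ∈ Ω, ⟪gradient u x, e⟫ ≠ 0) :
    (∀ x ∈ Ω, 0 < ⟪gradient u x, e⟫) ∧
    ∀ φ : EuclideanSpace ℝ (Fin n) → ℝ,
      (∃ K, LipschitzWith K φ) → HasCompactSupport φ →
      (∫ x in Ω, φ x ^ 2 *
          (lam1 a ‖gradient u x‖ * ‖tangGrad u x‖ ^ 2 +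
            lam2 a ‖gradient u x‖ *
              (hessFrob2 u x - ‖gradient (fun y => ‖gradient u y‖) x‖ ^ 2 -
                ‖tangGrad u x‖ ^ 2))) +
        (∫ x in Ω, ⟪gradient u x, e⟫ ^ 2 *
          ⟪Aop a (gradient u x)
              (gradient (fun y => φ y * ‖gradient u y‖ / ⟪gradient u y, e⟫) x),
            gradient (fun y => φ y * ‖gradient u y‖ / ⟪gradient u y, e⟫) x⟫)
      ≤ ∫ x in Ω, ‖gradient u x‖ ^ 2 *
          ⟪Aop a (gradient u x) (gradient φ x), gradient φ x⟫ := by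
  obtain ⟨H, hH, hH2⟩ := hD2u
  have S : Setup Ω a f u Du H e := setup_of hΩ.2.1 hΩ.2.2.1.isPreconnected ha hapos hlam hf hu3 hucl
    hDu hDuc hH hH2 hsol hw0 hwne
  have hO : IsOpen Ω := hΩ.2.1
  have hch : ∀ q ∈ frontier Ω, ∃ V g, Chart Ω V g ∧ q ∈ V := by
    intro q hq
    obtain ⟨V, g, hV, hyV, hg, hne, hΩV, hη⟩ := hΩ.2.2.2 q hq
    exact ⟨V, g, ⟨hV, hg, hne, hΩV⟩, hyV⟩
  have hlc := hlc_of hΩ S hulc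
  refine ⟨fun x hx => by rw [← hDu x hx]; exact S.wpos x hx, ?_⟩
  intro φ hφ hcs
  have hev : ∀ x ∈ Ω, gradient u =ᶠ[𝓝 x] Du := fun x hx => by
    filter_upwards [hO.mem_nhds hx] with y hy using (hDu y hy).symm
  have hgn : ∀ x ∈ Ω, gradient (fun y => ‖gradient u y‖) x = gs Du H x := by
    intro x hx
    have h1 : (fun y => ‖gradient u y‖) =ᶠ[𝓝 x] fun y => ‖Du y‖ :=
      (hev x hx).mono (fun y hy => by simp only [hy])
    exact (hasGrad_of_innerSL ((S.normgrad hx).congr_of_eventuallyEq h1)).gradient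
  have hgq : ∀ x ∈ Ω, gradient (fun y => φ y * ‖gradient u y‖ / ⟪gradient u y, e⟫) x =
      gradient (fun y => φ y * ‖Du y‖ / ⟪Du y, e⟫) x := by
    intro x hx
    have h1 : (fun y => φ y * ‖gradient u y‖ / ⟪gradient u y, e⟫) =ᶠ[𝓝 x]
        fun y => φ y * ‖Du y‖ / ⟪Du y, e⟫ :=
      (hev x hx).mono (fun y hy => by simp only [hy])
    unfold gradient at h1 ⊢
    rw [h1.fderiv_eq]
  have hfin := S.final hch hlc hφ hcs
  have e1 : ∫ x in Ω, φ x ^ 2 *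
          (lam1 a ‖gradient u x‖ * ‖tangGrad u x‖ ^ 2 +
            lam2 a ‖gradient u x‖ *
              (hessFrob2 u x - ‖gradient (fun y => ‖gradient u y‖) x‖ ^ 2 -
                ‖tangGrad u x‖ ^ 2)) = ∫ x in Ω, φ x ^ 2 * Qf a Du H x := by
    refine setIntegral_congr_fun hO.measurableSet (fun x hx => ?_)
    have := Qf_formula a Du H x (S.Dne hx) (S.hsymm x (subset_closure hx))
    simp only [tangGrad, hessFrob2, hgn x hx, ← hH2 x hx, ← hDu x hx]
    rw [this]
  have e2 : ∫ x in Ω, ⟪gradient u x, e⟫ ^ 2 *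
          ⟪Aop a (gradient u x)
              (gradient (fun y => φ y * ‖gradient u y‖ / ⟪gradient u y, e⟫) x),
            gradient (fun y => φ y * ‖gradient u y‖ / ⟪gradient u y, e⟫) x⟫ =
      ∫ x in Ω, ⟪Du x, e⟫ ^ 2 * ⟪Aop a (Du x) (gradient (fun y => φ y * ‖Du y‖ / ⟪Du y, e⟫) x),
        gradient (fun y => φ y * ‖Du y‖ / ⟪Du y, e⟫) x⟫ := by
    refine setIntegral_congr_fun hO.measurableSet (fun x hx => ?_)
    simp only [hgq x hx, ← hDu x hx]
  have e3 : ∫ x in Ω, ‖gradient u x‖ ^ 2 *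
          ⟪Aop a (gradient u x) (gradient φ x), gradient φ x⟫ =
      ∫ x in Ω, ‖Du x‖ ^ 2 * ⟪Aop a (Du x) (gradient φ x), gradient φ x⟫ := by
    refine setIntegral_congr_fun hO.measurableSet (fun x hx => ?_)
    simp only [← hDu x hx]
  rw [e1, e2, e3]
  exact hfin
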